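/- Let n > q ≥ 2 and 0 ≤ k ≤ q+1. Let Π be a Nambu structure of order q on an open neighborhood U of 0 in ℝⁿ which is real-analytic (each coordinate function of Π in the standard basis of ⋀^q(ℝⁿ) is real-analytic on U), with Π(0) = 0 and with linear part Π_{k,q} at 0. Then Π is locally analytically linearizable at 0: there exist an open neighborhood W ⊆ U of 0 and a real-analytic diffeomorphism φ from W onto an open neighborhood of 0 in ℝⁿ with φ(0) = 0 such that (φ_*Π)(y) = Π_{k,q}(y) for all y ∈ φ(W). -/

import Mathlib

open scoped ContDiff

namespace NambuLin

/-- Index set for the standard basis of the `q`-th exterior power of `ℝⁿ`: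
increasing multi-indices, encoded as `q`-element subsets of `Fin n`. -/
abbrev Idx (n q : ℕ) := {s : Finset (Fin n) // s.card = q}

/-- A `q`-vector of `ℝⁿ`, given by its coordinates in the standard basis
`{e_{i₁} ∧ ⋯ ∧ e_{i_q}}` of `⋀^q(ℝⁿ)`. -/
abbrev MultiVec (n q : ℕ) := Idx n q → ℝ

/-- The Jacobian matrix of a map `φ : ℝⁿ → ℝⁿ` at a point `x`. -/
noncomputable def jac {n : ℕ} (φ : (Fin n → ℝ) → (Fin n → ℝ)) (x : Fin n → ℝ) :
    Matrix (Fin n) (Fin n) ℝ :=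
  Matrix.of fun i j => fderiv ℝ φ x (Pi.single j 1) i

/-- The `q`-th exterior power `⋀^q A` of a matrix `A`, acting on `q`-vectors in
coordinates: `((⋀^q A) w)_J = ∑_I det(A[J,I]) w_I`. -/
noncomputable def extPow (n q : ℕ) (A : Matrix (Fin n) (Fin n) ℝ) (w : MultiVec n q) :
    MultiVec n q :=
  fun J => ∑ I : Idx n q,
    (A.submatrix (J.1.orderEmbOfFin J.2) (I.1.orderEmbOfFin I.2)).det * w I

/-- The constant `q`-vector `e₁ ∧ ⋯ ∧ e_q` in coordinates. -/
def stdVec (n q : ℕ) : MultiVec n q :=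
  fun J => if (J : Finset (Fin n)) = Finset.univ.filter (fun i : Fin n => (i : ℕ) < q) then 1 else 0

/-- `φ` is a `C^∞` diffeomorphism from the open set `W` onto the open set `φ '' W`. -/
def IsSmoothDiffeoOn {n : ℕ} (φ : (Fin n → ℝ) → (Fin n → ℝ)) (W : Set (Fin n → ℝ)) : Prop :=
  IsOpen W ∧ IsOpen (φ '' W) ∧ ContDiffOn ℝ ∞ φ W ∧
    ∃ ψ : (Fin n → ℝ) → (Fin n → ℝ), ContDiffOn ℝ ∞ ψ (φ '' W) ∧
      (∀ x ∈ W, ψ (φ x) = x) ∧ (∀ y ∈ φ '' W, φ (ψ y) = y)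

/-- `P` is a (smooth) Nambu structure of order `q` on `U`: it is a smooth `q`-vector
field, and around every point where it does not vanish there is a local `C^∞`
coordinate system in which it becomes the constant `q`-vector `e₁ ∧ ⋯ ∧ e_q`. -/
def IsNambu (n q : ℕ) (P : (Fin n → ℝ) → MultiVec n q) (U : Set (Fin n → ℝ)) : Prop :=
  ContDiffOn ℝ ∞ P U ∧
    ∀ p ∈ U, P p ≠ 0 →
      ∃ W, p ∈ W ∧ W ⊆ U ∧ ∃ φ, IsSmoothDiffeoOn φ W ∧
        ∀ x ∈ W, extPow n q (jac φ x) (P x) = stdVec n q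

/-- The signs `ε_j` (`= 1` for the first `k` indices, `= -1` afterwards;
`0`-based indexing, so `ε_j = 1` iff `j < k`). -/
def eps {n : ℕ} (k : ℕ) (j : Fin n) : ℝ := if (j : ℕ) < k then 1 else -1

/-- The set of indices `{1, …, q+1}` (in `0`-based form: `{0,…,q}`). -/
def topIdx (n q : ℕ) : Finset (Fin n) := Finset.univ.filter (fun i : Fin n => (i : ℕ) < q + 1)

/-- The nondegenerate Type 1 linear Nambu structure `Π_{k,q}` of order `q` and
signature `(k, q+1-k)`:
`Π_{k,q}(x) = ∑_{j=1}^{q+1} (−1)^{j−1} ε_j x_j e₁ ∧ ⋯ ∧ ê_j ∧ ⋯ ∧ e_{q+1}`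
(here written with `0`-based indices `j`, whence the sign `(−1)^j`). -/
def modelPi (n q k : ℕ) (x : Fin n → ℝ) : MultiVec n q :=
  fun J => ∑ j : Fin n,
    if ((j : ℕ) < q + 1 ∧ (J : Finset (Fin n)) = (topIdx n q).erase j)
    then (-1 : ℝ) ^ (j : ℕ) * eps k j * x j else 0

/-- `φ` is a real-analytic diffeomorphism from the open set `W` onto the open set
`φ '' W` (with real-analytic inverse). -/
def IsAnalyticDiffeoOn {n : ℕ} (φ : (Fin n → ℝ) → (Fin n → ℝ)) (W : Set (Fin n → ℝ)) : Prop :=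
  IsOpen W ∧ IsOpen (φ '' W) ∧ AnalyticOnNhd ℝ φ W ∧
    ∃ ψ : (Fin n → ℝ) → (Fin n → ℝ), AnalyticOnNhd ℝ ψ (φ '' W) ∧
      (∀ x ∈ W, ψ (φ x) = x) ∧ (∀ y ∈ φ '' W, φ (ψ y) = y)

end NambuLin


namespace NambuLin

open MvPolynomial Finset
open scoped Nat

/-- polynomials in `n` variables -/
abbrev Pol (n : ℕ) := MvPolynomial (Fin n) ℝ

/-- multi-index factorial -/
noncomputable def mfac {n : ℕ} (α : Fin n →₀ ℕ) : ℝ := ∏ i, ((α i)! : ℝ)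

lemma mfac_pos {n : ℕ} (α : Fin n →₀ ℕ) : 0 < mfac α :=
  Finset.prod_pos fun i _ => by exact_mod_cast Nat.factorial_pos _

lemma mfac_add_single {n : ℕ} (α : Fin n →₀ ℕ) (i : Fin n) :
    mfac (α + Finsupp.single i 1) = (α i + 1) * mfac α := by
  unfold mfac
  rw [← Finset.mul_prod_erase univ _ (mem_univ i), ← Finset.mul_prod_erase univ (fun j => ((α j)! : ℝ)) (mem_univ i)]
  have : ∏ x ∈ univ.erase i, (((α + Finsupp.single i 1 : Fin n →₀ ℕ) x)! : ℝ) = ∏ x ∈ univ.erase i, ((α x)! : ℝ) := by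
    apply Finset.prod_congr rfl
    intro x hx
    have hx' : x ≠ i := (Finset.mem_erase.1 hx).1
    simp [Finsupp.single_apply, hx'.symm]
  rw [this]
  simp [Nat.factorial_succ]
  ring

/-- exponents of total degree `d` -/
def expo (n d : ℕ) : Finset (Fin n →₀ ℕ) := Finset.finsuppAntidiag univ d

lemma mem_expo {n d : ℕ} {α : Fin n →₀ ℕ} : α ∈ expo n d ↔ α.degree = d := by
  simp [expo, Finset.mem_finsuppAntidiag, Finsupp.degree_eq_sum]

/-- Fischer pairing -/
noncomputable def fis {n : ℕ} (f g : Pol n) : ℝ := ∑ α ∈ f.support, mfac α * coeff α f * coeff α g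

lemma fis_eq {n : ℕ} {f : Pol n} {s : Finset (Fin n →₀ ℕ)} (h : f.support ⊆ s) (g : Pol n) :
    fis f g = ∑ α ∈ s, mfac α * coeff α f * coeff α g := by
  unfold fis
  apply Finset.sum_subset h
  intro α _ hα
  rw [MvPolynomial.notMem_support_iff.1 hα]; simp

lemma fis_comm {n : ℕ} (f g : Pol n) : fis f g = fis g f := by
  rw [fis_eq (subset_union_left (s₂ := g.support)) g, fis_eq (subset_union_right (s₁ := f.support)) f]
  exact Finset.sum_congr rfl fun _ _ => by ring

lemma fis_add_right {n : ℕ} (f g h : Pol n) : fis f (g + h) = fis f g + fis f h := by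
  simp only [fis, ← Finset.sum_add_distrib, coeff_add]
  exact Finset.sum_congr rfl fun _ _ => by ring

lemma fis_smul_right {n : ℕ} (c : ℝ) (f g : Pol n) : fis f (c • g) = c * fis f g := by
  simp only [fis, Finset.mul_sum, coeff_smul, smul_eq_mul]
  exact Finset.sum_congr rfl fun _ _ => by ring

lemma fis_C_mul_right {n : ℕ} (c : ℝ) (f g : Pol n) : fis f (C c * g) = c * fis f g := by
  rw [← smul_eq_C_mul, fis_smul_right]

lemma fis_add_left {n : ℕ} (f g h : Pol n) : fis (f + g) h = fis f h + fis g h := by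
  rw [fis_comm, fis_add_right, fis_comm h f, fis_comm h g]

lemma fis_smul_left {n : ℕ} (c : ℝ) (f g : Pol n) : fis (c • f) g = c * fis f g := by
  rw [fis_comm, fis_smul_right, fis_comm g f]

lemma fis_C_mul_left {n : ℕ} (c : ℝ) (f g : Pol n) : fis (C c * f) g = c * fis f g := by
  rw [← smul_eq_C_mul, fis_smul_left]

lemma fis_neg_right {n : ℕ} (f g : Pol n) : fis f (-g) = - fis f g := by
  have := fis_smul_right (-1) f g; simpa using this

lemma fis_neg_left {n : ℕ} (f g : Pol n) : fis (-f) g = - fis f g := by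
  have := fis_smul_left (-1) f g; simpa using this

lemma fis_sub_right {n : ℕ} (f g h : Pol n) : fis f (g - h) = fis f g - fis f h := by
  rw [sub_eq_add_neg, fis_add_right, fis_neg_right]; ring

lemma fis_sub_left {n : ℕ} (f g h : Pol n) : fis (f - g) h = fis f h - fis g h := by
  rw [sub_eq_add_neg, fis_add_left, fis_neg_left]; ring

lemma fis_zero_right {n : ℕ} (f : Pol n) : fis f 0 = 0 := by simp [fis]

lemma fis_zero_left {n : ℕ} (f : Pol n) : fis 0 f = 0 := by simp [fis]

lemma fis_sum_right {n : ℕ} {ι : Type*} (s : Finset ι) (f : Pol n) (g : ι → Pol n) :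
    fis f (∑ i ∈ s, g i) = ∑ i ∈ s, fis f (g i) := by
  classical
  induction s using Finset.induction_on with
  | empty => simp [fis_zero_right]
  | insert a s ha ih => rw [Finset.sum_insert ha, Finset.sum_insert ha, fis_add_right, ih]

lemma fis_sum_left {n : ℕ} {ι : Type*} (s : Finset ι) (f : Pol n) (g : ι → Pol n) :
    fis (∑ i ∈ s, g i) f = ∑ i ∈ s, fis (g i) f := by
  rw [fis_comm, fis_sum_right]; exact Finset.sum_congr rfl fun _ _ => fis_comm _ _

lemma fis_self_nonneg {n : ℕ} (f : Pol n) : 0 ≤ fis f f :=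
  Finset.sum_nonneg fun α _ => by
    rw [mul_assoc]; exact mul_nonneg (mfac_pos α).le (mul_self_nonneg _)

lemma fis_self_eq_zero {n : ℕ} {f : Pol n} (h : fis f f = 0) : f = 0 := by
  unfold fis at h
  rw [Finset.sum_eq_zero_iff_of_nonneg] at h
  · ext α
    by_cases hα : α ∈ f.support
    · have := h α hα
      rw [mul_assoc] at this
      rcases mul_eq_zero.1 this with h1 | h1
      · exact absurd h1 (mfac_pos α).ne'
      · simpa using h1
    · simpa using hα
  · intro α _
    rw [mul_assoc]; exact mul_nonneg (mfac_pos α).le (mul_self_nonneg _)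

/-- adjointness of `∂ᵢ` and multiplication by `Xᵢ` -/
lemma fis_pderiv_left {n : ℕ} (i : Fin n) (f g : Pol n) : fis (pderiv i f) g = fis f (X i * g) := by
  classical
  set s : Finset (Fin n →₀ ℕ) := (pderiv i f).support
  have h2 : fis f (X i * g) = ∑ α ∈ f.support ∪ s.image (fun α => Finsupp.single i 1 + α),
      mfac α * coeff α f * coeff α (X i * g) := fis_eq subset_union_left _
  have h3 : ∑ α ∈ f.support ∪ s.image (fun α => Finsupp.single i 1 + α),
      mfac α * coeff α f * coeff α (X i * g)
      = ∑ α ∈ s.image (fun α => Finsupp.single i 1 + α), mfac α * coeff α f * coeff α (X i * g) := by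
    symm
    apply Finset.sum_subset subset_union_right
    intro α _ hα'
    by_cases hi : i ∈ α.support
    · have hle : Finsupp.single i 1 ≤ α := by
        rw [Finsupp.single_le_iff]; exact Nat.one_le_iff_ne_zero.2 (Finsupp.mem_support_iff.1 hi)
      obtain ⟨β, rfl⟩ := exists_add_of_le hle
      have : β ∉ s := fun hb => hα' (Finset.mem_image_of_mem _ hb)
      have h4 := MvPolynomial.notMem_support_iff.1 this
      rw [coeff_pderiv] at h4
      have h5 : coeff (Finsupp.single i 1 + β) f = 0 := by
        rw [add_comm]
        rcases mul_eq_zero.1 h4 with h6 | h6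
        · exact h6
        · exfalso; have : (0:ℝ) < β i + 1 := by positivity
          linarith
      rw [h5]; simp
    · rw [coeff_X_mul', if_neg hi]; simp
  rw [h2, h3, Finset.sum_image (fun a _ b _ h => by simpa using h)]
  apply Finset.sum_congr rfl
  intro α _
  rw [coeff_X_mul, coeff_pderiv, add_comm (Finsupp.single i 1), mfac_add_single]
  ring

lemma fis_X_mul_left {n : ℕ} (i : Fin n) (f g : Pol n) : fis (X i * f) g = fis f (pderiv i g) := by
  rw [fis_comm, ← fis_pderiv_left, fis_comm]

lemma fis_homog {n d : ℕ} {f : Pol n} (hf : f.IsHomogeneous d) (g : Pol n) :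
    fis f g = ∑ α ∈ expo n d, mfac α * coeff α f * coeff α g := by
  apply fis_eq
  intro α hα
  rw [mem_expo]
  by_contra h
  exact (MvPolynomial.mem_support_iff.1 hα) (hf.coeff_eq_zero h)

/-- Bombieri embedding -/
noncomputable def emb (n d : ℕ) : Pol n →ₗ[ℝ] EuclideanSpace ℝ (expo n d) where
  toFun f := WithLp.toLp 2 fun α => Real.sqrt (mfac α.1 / (d ! : ℝ)) * coeff α.1 f
  map_add' f g := by ext α; simp [mul_add]
  map_smul' c f := by ext α; simp; ring

/-- Bombieri norm of the degree `d` part -/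
noncomputable def bom {n : ℕ} (d : ℕ) (f : Pol n) : ℝ := ‖emb n d f‖

lemma bom_nonneg {n : ℕ} (d : ℕ) (f : Pol n) : 0 ≤ bom d f := norm_nonneg _

lemma bom_sq {n : ℕ} (d : ℕ) (f : Pol n) :
    bom d f ^ 2 = ∑ α ∈ expo n d, mfac α / (d ! : ℝ) * coeff α f ^ 2 := by
  unfold bom
  rw [EuclideanSpace.norm_sq_eq, ← Finset.sum_coe_sort (expo n d)]
  apply Finset.sum_congr rfl
  intro α _
  simp only [emb, LinearMap.coe_mk, AddHom.coe_mk, norm_mul, Real.norm_eq_abs]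
  rw [mul_pow, sq_abs, sq_abs, Real.sq_sqrt]
  have := mfac_pos α.1
  positivity

lemma bom_add_le {n : ℕ} (d : ℕ) (f g : Pol n) : bom d (f + g) ≤ bom d f + bom d g := by
  unfold bom; rw [map_add]; exact norm_add_le _ _

lemma bom_smul {n : ℕ} (d : ℕ) (c : ℝ) (f : Pol n) : bom d (c • f) = |c| * bom d f := by
  unfold bom; rw [map_smul, norm_smul]; rfl

lemma bom_C_mul {n : ℕ} (d : ℕ) (c : ℝ) (f : Pol n) : bom d (C c * f) = |c| * bom d f := by
  rw [← smul_eq_C_mul, bom_smul]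

lemma bom_neg {n : ℕ} (d : ℕ) (f : Pol n) : bom d (-f) = bom d f := by
  unfold bom; rw [map_neg, norm_neg]

lemma bom_zero {n : ℕ} (d : ℕ) : bom d (0 : Pol n) = 0 := by
  unfold bom; rw [map_zero, norm_zero]

lemma bom_sub_le {n : ℕ} (d : ℕ) (f g : Pol n) : bom d (f - g) ≤ bom d f + bom d g := by
  rw [sub_eq_add_neg, ← bom_neg d g]; exact bom_add_le _ _ _

lemma bom_sum_le {n : ℕ} {ι : Type*} (d : ℕ) (s : Finset ι) (f : ι → Pol n) :
    bom d (∑ i ∈ s, f i) ≤ ∑ i ∈ s, bom d (f i) := by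
  unfold bom; rw [map_sum]; exact norm_sum_le _ _

lemma bom_congr {n : ℕ} {d : ℕ} {f g : Pol n} (h : ∀ α, α.degree = d → coeff α f = coeff α g) :
    bom d f = bom d g := by
  unfold bom
  congr 1
  ext α
  simp only [emb, LinearMap.coe_mk, AddHom.coe_mk]
  rw [h α.1 (mem_expo.1 α.2)]

lemma bom_homComp {n : ℕ} (d : ℕ) (f : Pol n) : bom d (homogeneousComponent d f) = bom d f := by
  apply bom_congr
  intro α hα
  rw [coeff_homogeneousComponent, if_pos hα]

lemma bom_homog_ne {n d e : ℕ} {f : Pol n} (hf : f.IsHomogeneous e) (h : d ≠ e) : bom d f = 0 := by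
  rw [← bom_zero (n := n) d]
  apply bom_congr
  intro α hα
  rw [hf.coeff_eq_zero (by omega)]; simp

lemma bom_sq_fis {n d : ℕ} {f : Pol n} (hf : f.IsHomogeneous d) : bom d f ^ 2 = fis f f / (d ! : ℝ) := by
  rw [bom_sq, fis_homog hf, Finset.sum_div]
  exact Finset.sum_congr rfl fun _ _ => by ring

/-- multi-index Vandermonde -/
lemma vandermonde {n : ℕ} (γ : Fin n →₀ ℕ) (d : ℕ) :
    ∑ p ∈ (antidiagonal γ).filter (fun p => p.1.degree = d), mfac γ / (mfac p.1 * mfac p.2)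
      = (γ.degree.choose d : ℝ) := by
  classical
  -- coefficient of `t^d` in `∏ (1+t)^{γ i}`
  have key : (∏ i, ((1 + Polynomial.X : Polynomial ℝ)) ^ (γ i)).coeff d = (γ.degree.choose d : ℝ) := by
    rw [Finset.prod_pow_eq_pow_sum, ← Finsupp.degree_eq_sum, Polynomial.coeff_one_add_X_pow]
  rw [← key]
  have h1 : ∀ i, (1 + Polynomial.X : Polynomial ℝ) ^ (γ i)
      = ∑ a ∈ range (γ i + 1), Polynomial.C ((γ i).choose a : ℝ) * Polynomial.X ^ a := by
    intro i
    rw [add_comm, add_pow]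
    apply Finset.sum_congr rfl
    intro a _
    simp [mul_comm]
  simp_rw [h1]
  rw [Finset.prod_univ_sum, Polynomial.finsetSum_coeff]
  have h2 : ∀ a : Fin n → ℕ, (∏ i, Polynomial.C ((γ i).choose (a i) : ℝ) * Polynomial.X ^ (a i)).coeff d
      = if (∑ i, a i) = d then ∏ i, ((γ i).choose (a i) : ℝ) else 0 := by
    intro a
    rw [Finset.prod_mul_distrib, Finset.prod_pow_eq_pow_sum, ← map_prod, Polynomial.coeff_C_mul,
      Polynomial.coeff_X_pow]
    simp [eq_comm]
  simp_rw [h2]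
  rw [← Finset.sum_filter]
  symm
  refine Finset.sum_bij' (fun a _ => (Finsupp.equivFunOnFinite.symm a, γ - Finsupp.equivFunOnFinite.symm a))
    (fun p _ => p.1) ?_ ?_ ?_ ?_ ?_
  · intro a ha
    simp only [mem_filter, Fintype.mem_piFinset, mem_range] at ha
    simp only [mem_filter, HasAntidiagonal.mem_antidiagonal]
    constructor
    · ext i
      have := ha.1 i
      simp; omega
    · rw [Finsupp.degree_eq_sum, ← ha.2]; rfl
  · intro p hp
    simp only [mem_filter, HasAntidiagonal.mem_antidiagonal] at hp
    simp only [mem_filter, Fintype.mem_piFinset, mem_range]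
    constructor
    · intro i
      have := DFunLike.congr_fun hp.1 i
      simp at this; omega
    · rw [← hp.2, Finsupp.degree_eq_sum]
  · intro a _; rfl
  · intro p hp
    simp only [mem_filter, HasAntidiagonal.mem_antidiagonal] at hp
    ext i
    · simp
    · have := DFunLike.congr_fun hp.1 i
      simp at this ⊢; omega
  · intro a ha
    simp only [mem_filter, Fintype.mem_piFinset, mem_range] at ha
    unfold mfac
    rw [← Finset.prod_mul_distrib, ← Finset.prod_div_distrib]
    apply Finset.prod_congr rfl
    intro i _
    have := ha.1 i
    rw [Nat.cast_choose ℝ (by omega : a i ≤ γ i)]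
    rfl

/-- Bombieri's inequality -/
lemma bom_mul_homog {n d e : ℕ} {f g : Pol n} (hf : f.IsHomogeneous d) (hg : g.IsHomogeneous e) :
    bom (d + e) (f * g) ≤ bom d f * bom e g := by
  classical
  apply le_of_sq_le_sq _ (mul_nonneg (bom_nonneg _ _) (bom_nonneg _ _))
  rw [mul_pow, bom_sq, bom_sq, bom_sq]
  set F : (Fin n →₀ ℕ) × (Fin n →₀ ℕ) → ℝ := fun p =>
    (mfac p.1 / (d ! : ℝ) * coeff p.1 f ^ 2) * (mfac p.2 / (e ! : ℝ) * coeff p.2 g ^ 2) with hF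
  have step : ∀ γ ∈ expo n (d + e), mfac γ / ((d + e)! : ℝ) * coeff γ (f * g) ^ 2
      ≤ ∑ p ∈ (antidiagonal γ).filter (fun p => p.1.degree = d), F p := by
    intro γ hγ
    rw [mem_expo] at hγ
    have h1 : coeff γ (f * g) = ∑ p ∈ (antidiagonal γ).filter (fun p => p.1.degree = d),
        coeff p.1 f * coeff p.2 g := by
      rw [coeff_mul, Finset.sum_filter]
      apply Finset.sum_congr rfl
      intro p _
      split_ifs with h
      · rfl
      · rw [hf.coeff_eq_zero h]; simp
    have h2 := Finset.sum_sq_le_sum_mul_sum_of_sq_le_mul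
      ((antidiagonal γ).filter (fun p => p.1.degree = d))
      (r := fun p => coeff p.1 f * coeff p.2 g) (f := F)
      (g := fun p => ((d ! : ℝ) * e !) / (mfac p.1 * mfac p.2)) (fun p _ => by
        have := mfac_pos p.1; have := mfac_pos p.2
        simp only [hF]; positivity) (fun p _ => by
        have := mfac_pos p.1; have := mfac_pos p.2; positivity) (fun p _ => by
        have := (mfac_pos p.1).ne'; have := (mfac_pos p.2).ne'
        simp only [hF]; apply le_of_eq; field_simp)
    rw [← h1] at h2
    have h3 : mfac γ / ((d + e)! : ℝ) * ∑ p ∈ (antidiagonal γ).filter (fun p => p.1.degree = d),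
        ((d ! : ℝ) * e !) / (mfac p.1 * mfac p.2) = 1 := by
      have h4 := vandermonde γ d
      rw [hγ, Nat.cast_add_choose] at h4
      have h5 : ∀ p : (Fin n →₀ ℕ) × (Fin n →₀ ℕ), mfac γ / ((d + e)! : ℝ) * (((d ! : ℝ) * e !) / (mfac p.1 * mfac p.2))
          = ((d ! : ℝ) * e !) / ((d + e)! : ℝ) * (mfac γ / (mfac p.1 * mfac p.2)) := by
        intro p; ring
      rw [Finset.mul_sum]
      simp_rw [h5]
      rw [← Finset.mul_sum, h4]
      have := Nat.factorial_ne_zero d; have := Nat.factorial_ne_zero e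
      have := Nat.factorial_ne_zero (d + e)
      field_simp
    have hpos : 0 ≤ mfac γ / ((d + e)! : ℝ) := by have := mfac_pos γ; positivity
    calc mfac γ / ((d + e)! : ℝ) * coeff γ (f * g) ^ 2
        ≤ mfac γ / ((d + e)! : ℝ) * _ := mul_le_mul_of_nonneg_left h2 hpos
      _ = (∑ p ∈ (antidiagonal γ).filter (fun p => p.1.degree = d), F p) *
          (mfac γ / ((d + e)! : ℝ) * ∑ p ∈ (antidiagonal γ).filter (fun p => p.1.degree = d),
        ((d ! : ℝ) * e !) / (mfac p.1 * mfac p.2)) := by ring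
      _ = _ := by rw [h3, mul_one]
  refine (Finset.sum_le_sum step).trans ?_
  rw [Finset.sum_mul_sum, ← Finset.sum_product', Finset.sum_sigma']
  have hnn : ∀ p, 0 ≤ F p := fun p => by
    have := mfac_pos p.1; have := mfac_pos p.2
    simp only [hF]; positivity
  have : ∑ x ∈ (expo n (d + e)).sigma fun γ => (antidiagonal γ).filter (fun p => p.1.degree = d), F x.2
      ≤ ∑ p ∈ expo n d ×ˢ expo n e, F p := by
    rw [← Finset.sum_image (f := F) (g := fun x : (Σ _ : (Fin n →₀ ℕ), (Fin n →₀ ℕ) × (Fin n →₀ ℕ)) => x.2)]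
    · apply Finset.sum_le_sum_of_subset_of_nonneg
      · intro p hp
        simp only [mem_image, mem_sigma, mem_filter, HasAntidiagonal.mem_antidiagonal, mem_expo] at hp
        obtain ⟨⟨γ, p'⟩, ⟨h1, h2, h3⟩, rfl⟩ := hp
        simp only [mem_product, mem_expo]
        refine ⟨h3, ?_⟩
        rw [← h2, map_add] at h1
        change p'.2.degree = e
        change p'.1.degree + p'.2.degree = d + e at h1
        change p'.1.degree = d at h3
        omega
      · intro p _ _; exact hnn p
    · rintro ⟨γ, p⟩ hx ⟨γ', p'⟩ hx' h
      simp only [coe_sigma, Set.mem_sigma_iff, coe_filter, Set.mem_ofPred_eq,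
        HasAntidiagonal.mem_antidiagonal] at hx hx' h
      subst h
      have : γ = γ' := hx.2.1.symm.trans hx'.2.1
      subst this
      rfl
  exact this

lemma homComp_mul {n : ℕ} (D : ℕ) (f g : Pol n) : homogeneousComponent D (f * g)
    = ∑ p ∈ antidiagonal D, homogeneousComponent p.1 f * homogeneousComponent p.2 g := by
  classical
  ext γ
  rw [coeff_homogeneousComponent, coeff_sum]
  simp_rw [coeff_mul, coeff_homogeneousComponent]
  rw [Finset.sum_comm]
  split_ifs with h
  · apply Finset.sum_congr rfl
    intro p hp
    rw [HasAntidiagonal.mem_antidiagonal] at hp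
    rw [Finset.sum_eq_single (p.1.degree, p.2.degree)]
    · simp
    · intro b _ hb
      split_ifs with h1 h2
      · exact absurd (Prod.ext h1.symm h2.symm) hb
      all_goals simp
    · intro hb
      exfalso; apply hb
      rw [HasAntidiagonal.mem_antidiagonal, ← h, ← hp, map_add]
  · symm
    apply Finset.sum_eq_zero
    intro p hp
    apply Finset.sum_eq_zero
    intro b hb
    rw [HasAntidiagonal.mem_antidiagonal] at hp hb
    split_ifs with h1 h2
    · exfalso; apply h; rw [← hp, map_add, h1, h2, hb]
    all_goals simp

lemma bom_mul {n : ℕ} (D : ℕ) (f g : Pol n) :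
    bom D (f * g) ≤ ∑ p ∈ antidiagonal D, bom p.1 f * bom p.2 g := by
  rw [← bom_homComp, homComp_mul]
  refine (bom_sum_le _ _ _).trans (Finset.sum_le_sum ?_)
  intro p hp
  rw [HasAntidiagonal.mem_antidiagonal] at hp
  rw [← hp, ← bom_homComp p.1 f, ← bom_homComp p.2 g]
  exact bom_mul_homog (homogeneousComponent_isHomogeneous _ _) (homogeneousComponent_isHomogeneous _ _)

lemma bom_pderiv {n : ℕ} (d : ℕ) (i : Fin n) (f : Pol n) :
    bom d (pderiv i f) ≤ (d + 1) * bom (d + 1) f := by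
  apply le_of_sq_le_sq _ (mul_nonneg (by positivity) (bom_nonneg _ _))
  rw [mul_pow, bom_sq, bom_sq, Finset.mul_sum]
  set F : (Fin n →₀ ℕ) → ℝ := fun β => ((d:ℝ) + 1) ^ 2 * (mfac β / ((d + 1)! : ℝ) * coeff β f ^ 2) with hF
  have h1 : ∀ α ∈ expo n d, mfac α / (d ! : ℝ) * coeff α (pderiv i f) ^ 2 ≤ F (α + Finsupp.single i 1) := by
    intro α hα
    rw [mem_expo] at hα
    simp only [hF]
    rw [coeff_pderiv, mfac_add_single, Nat.factorial_succ]
    have h2 : (α i : ℝ) ≤ d := by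
      have : α i ≤ d := by rw [← hα]; exact Finsupp.le_degree i α
      exact_mod_cast this
    have h3 := mfac_pos α
    set c := coeff (α + Finsupp.single i 1) f
    have h4 : ((d:ℝ) + 1) ^ 2 * ((α i + 1) * mfac α / (((d + 1) * d ! : ℕ) : ℝ) * c ^ 2)
        = (mfac α / (d ! : ℝ) * c ^ 2 * (α i + 1)) * (d + 1) := by
      push_cast
      field_simp
    rw [h4]
    have h5 : mfac α / (d ! : ℝ) * (c * (α i + 1)) ^ 2 = (mfac α / (d ! : ℝ) * c ^ 2 * (α i + 1)) * (α i + 1) := by ring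
    rw [h5]
    apply mul_le_mul_of_nonneg_left (by linarith)
    positivity
  refine (Finset.sum_le_sum h1).trans ?_
  rw [← Finset.sum_image (f := F) (g := fun α : Fin n →₀ ℕ => α + Finsupp.single i 1) (fun a _ b _ h => by simpa using h)]
  apply Finset.sum_le_sum_of_subset_of_nonneg
  · intro β hβ
    rw [mem_image] at hβ
    obtain ⟨α, hα, rfl⟩ := hβ
    rw [mem_expo] at hα ⊢
    rw [map_add, hα, Finsupp.degree_single]
  · intro β _ _
    have := mfac_pos β
    simp only [hF]; positivity

end NambuLin


namespace NambuLin

open MvPolynomial Finset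
open scoped Nat

section spectral
variable {V : Type*} [NormedAddCommGroup V] [InnerProductSpace ℝ V] [FiniteDimensional ℝ V]

lemma gap_abstract (T : V →ₗ[ℝ] V) (hT : T.IsSymmetric)
    (heig : ∀ (μ : ℝ) (v : V), v ≠ 0 → T v = μ • v → μ = 0 ∨ 2 ≤ μ) :
    (∀ w : V, ∃ w0 v : V, T w0 = 0 ∧ (∀ g, T g = 0 → inner ℝ v g = 0) ∧ w = w0 + T v) ∧
    (∀ f : V, (∀ g, T g = 0 → inner ℝ f g = 0) → 2 * inner ℝ f f ≤ inner ℝ (T f) f) := by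
  set b := hT.eigenvectorBasis rfl
  set l := hT.eigenvalues rfl
  have hb : ∀ i, T (b i) = l i • b i := fun i => by
    exact hT.apply_eigenvectorBasis rfl i
  have hl : ∀ i, l i = 0 ∨ 2 ≤ l i := fun i =>
    heig (l i) (b i) (b.orthonormal.ne_zero i) (hb i)
  constructor
  · intro w
    refine ⟨∑ i, (if l i = 0 then inner ℝ (b i) w else 0) • b i,
      ∑ i, ((l i)⁻¹ * inner ℝ (b i) w) • b i, ?_, ?_, ?_⟩
    · rw [map_sum]
      apply Finset.sum_eq_zero
      intro i _
      rw [map_smul, hb]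
      split_ifs with h
      · rw [h]; simp
      · simp
    · intro g hg
      rw [sum_inner]
      apply Finset.sum_eq_zero
      intro i _
      rw [real_inner_smul_left]
      by_cases h : l i = 0
      · rw [h]; simp
      · have h1 : inner ℝ (T (b i)) g = 0 := by rw [hT, hg, inner_zero_right]
        rw [hb, real_inner_smul_left] at h1
        rcases mul_eq_zero.1 h1 with h2 | h2
        · exact absurd h2 h
        · rw [h2, mul_zero]
    · rw [map_sum, ← Finset.sum_add_distrib]
      conv_lhs => rw [← b.sum_repr' w]
      apply Finset.sum_congr rfl
      intro i _
      rw [map_smul, hb]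
      by_cases h : l i = 0
      · simp [h]
      · rw [if_neg h, zero_smul, zero_add, smul_smul]
        congr 1
        field_simp
  · intro f hf
    have h1 : inner ℝ f f = ∑ i, inner ℝ f (b i) * inner ℝ (b i) f := (b.sum_inner_mul_inner f f).symm
    have h2 : inner ℝ (T f) f = ∑ i, inner ℝ (T f) (b i) * inner ℝ (b i) f :=
      (b.sum_inner_mul_inner (T f) f).symm
    rw [h1, h2, Finset.mul_sum]
    apply Finset.sum_le_sum
    intro i _
    rw [hT, hb, real_inner_smul_right, real_inner_comm f (b i)]
    rcases hl i with h | h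
    · have : inner ℝ f (b i) = 0 := hf _ (by rw [hb, h, zero_smul])
      rw [this]; simp
    · nlinarith [mul_self_nonneg (inner ℝ f (b i))]

end spectral

/-- inner product core given by the Fischer pairing on homogeneous polynomials -/
@[reducible] noncomputable def fisCore (n d : ℕ) : InnerProductSpace.Core ℝ (homogeneousSubmodule (Fin n) ℝ d) where
  inner f g := fis f.1 g.1
  conj_inner_symm f g := by simp [fis_comm]
  re_inner_nonneg f := by simpa using fis_self_nonneg f.1
  add_left f g h := by simp [fis_add_left]
  smul_left f g r := by simp [fis_smul_left]
  definite f h := Subtype.ext (fis_self_eq_zero h)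

lemma gap_pol {n d : ℕ} (T : Pol n →ₗ[ℝ] Pol n)
    (hT : ∀ f : Pol n, f.IsHomogeneous d → (T f).IsHomogeneous d)
    (hs : ∀ f g : Pol n, fis (T f) g = fis f (T g))
    (heig : ∀ (μ : ℝ) (f : Pol n), f.IsHomogeneous d → f ≠ 0 → T f = μ • f → μ = 0 ∨ 2 ≤ μ) :
    (∀ w : Pol n, w.IsHomogeneous d → ∃ w0 v : Pol n, w0.IsHomogeneous d ∧ v.IsHomogeneous d ∧
      T w0 = 0 ∧ (∀ g : Pol n, g.IsHomogeneous d → T g = 0 → fis v g = 0) ∧ w = w0 + T v) ∧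
    (∀ f : Pol n, f.IsHomogeneous d → (∀ g : Pol n, g.IsHomogeneous d → T g = 0 → fis f g = 0) →
      2 * fis f f ≤ fis (T f) f) := by
  let core := fisCore n d
  let : NormedAddCommGroup (homogeneousSubmodule (Fin n) ℝ d) := core.toNormedAddCommGroup
  let : InnerProductSpace ℝ (homogeneousSubmodule (Fin n) ℝ d) := InnerProductSpace.ofCore core.toCore
  have : FiniteDimensional ℝ (homogeneousSubmodule (Fin n) ℝ d) :=
    Module.Finite.iff_fg.2 (homogeneousSubmodule_fg (Fin n) ℝ d)
  let T' : homogeneousSubmodule (Fin n) ℝ d →ₗ[ℝ] homogeneousSubmodule (Fin n) ℝ d :=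
    T.restrict (fun f hf => hT f hf)
  have hin : ∀ f g : homogeneousSubmodule (Fin n) ℝ d, inner ℝ f g = fis f.1 g.1 := fun _ _ => rfl
  have hv : ∀ f, (T' f).1 = T f.1 := fun _ => rfl
  have hz : ∀ f, T' f = 0 ↔ T f.1 = 0 := fun f => by
    rw [← hv]; exact ⟨fun h => by rw [h]; rfl, fun h => Subtype.ext h⟩
  obtain ⟨h1, h2⟩ := gap_abstract T' (fun f g => by rw [hin, hin, hv, hv, hs])
    (fun μ v hv0 hvμ => heig μ v.1 v.2 (fun h => hv0 (Subtype.ext h)) (by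
      rw [← hv, hvμ]; rfl))
  constructor
  · intro w hw
    obtain ⟨w0, v, a, b, c⟩ := h1 ⟨w, hw⟩
    refine ⟨w0.1, v.1, w0.2, v.2, (hz _).1 a, ?_, ?_⟩
    · intro g hg hg0
      exact b ⟨g, hg⟩ ((hz _).2 hg0)
    · have := congrArg Subtype.val c
      exact this
  · intro f hf hf0
    exact h2 ⟨f, hf⟩ (fun g hg => hf0 g.1 g.2 ((hz g).1 hg))

end NambuLin


namespace NambuLin

open MvPolynomial Finset
open scoped Nat

/-- embedding of the `m` top indices and signs -/
structure Top (n m : ℕ) where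
  e : Fin m → Fin n
  inj : Function.Injective e
  s : Fin m → ℝ
  sq : ∀ i, s i * s i = 1

namespace Top

variable {n m : ℕ} (τ : Top n m)

/-- lower coefficient `A⁰_k = ε_k x_k` -/
noncomputable def A (k : Fin m) : Pol n := C (τ.s k) * X (τ.e k)

noncomputable def d (k : Fin m) : Derivation ℝ (Pol n) (Pol n) := pderiv (τ.e k)

/-- the vector field `X_kl` -/
noncomputable def XX (k l : Fin m) : Derivation ℝ (Pol n) (Pol n) := τ.A k • τ.d l - τ.A l • τ.d k

/-- Kronecker delta -/
noncomputable def dl (n : ℕ) {m : ℕ} (i j : Fin m) : Pol n := if i = j then 1 else 0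

/-- sign as polynomial -/
noncomputable def se (i : Fin m) : Pol n := C (τ.s i)

lemma se_sq (i : Fin m) : τ.se i * τ.se i = 1 := by
  unfold se; rw [← C_mul, τ.sq, C_1]

lemma dl_comm (i j : Fin m) : dl n i j = dl n j i := by simp [dl, eq_comm]

lemma dl_se (i j : Fin m) : dl n i j * (τ.se i - τ.se j) = 0 := by
  unfold dl; split_ifs with h
  · subst h; simp
  · simp

lemma XX_apply (k l : Fin m) (f : Pol n) : τ.XX k l f = τ.A k * τ.d l f - τ.A l * τ.d k f := by
  simp [XX]

lemma d_A (i j : Fin m) : τ.d i (τ.A j) = τ.se j * dl n i j := by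
  simp only [d, A, se, pderiv_C_mul, dl]
  rw [pderiv_X]
  simp only [Pi.single_apply, τ.inj.eq_iff]
  simp [eq_comm]

lemma d_se (i j : Fin m) : τ.d i (τ.se j) = 0 := by simp [d, se]

lemma d_comm (i j : Fin m) (f : Pol n) : τ.d i (τ.d j f) = τ.d j (τ.d i f) := by
  have : ⁅τ.d i, τ.d j⁆ = 0 := by
    apply MvPolynomial.derivation_ext
    intro p
    rw [Derivation.commutator_apply]
    simp only [d, pderiv_X, Pi.single_apply]
    split_ifs <;> simp
  have h := Derivation.congr_fun this f
  rw [Derivation.commutator_apply] at h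
  simpa [sub_eq_zero] using h

lemma XX_anti (k l : Fin m) : τ.XX k l = - τ.XX l k := by unfold XX; simp

lemma XX_anti' (k l : Fin m) (f : Pol n) : τ.XX k l f = - τ.XX l k f := by rw [XX_anti]; simp

lemma XX_self (k : Fin m) : τ.XX k k = 0 := by unfold XX; simp

lemma XX_A (k l i : Fin m) : τ.XX k l (τ.A i) = τ.se i * (dl n l i * τ.A k - dl n k i * τ.A l) := by
  rw [XX_apply, d_A, d_A]; ring

lemma XX_se (k l i : Fin m) : τ.XX k l (τ.se i) = 0 := by
  rw [XX_apply, d_se, d_se]; ring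

lemma XX_se_mul (k l i : Fin m) (f : Pol n) : τ.XX k l (τ.se i * f) = τ.se i * τ.XX k l f := by
  rw [Derivation.leibniz, XX_se]; simp

lemma d_XX (i k l : Fin m) (f : Pol n) : τ.d i (τ.XX k l f) =
    τ.se k * dl n i k * τ.d l f - τ.se l * dl n i l * τ.d k f + τ.XX k l (τ.d i f) := by
  rw [XX_apply, XX_apply, map_sub, Derivation.leibniz, Derivation.leibniz, d_A, d_A, τ.d_comm i l, τ.d_comm i k]
  simp only [smul_eq_mul]; ring

lemma XX_XX (k l i j : Fin m) (f : Pol n) : τ.XX k l (τ.XX i j f) =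
    τ.XX k l (τ.A i) * τ.d j f - τ.XX k l (τ.A j) * τ.d i f
    + τ.A i * τ.XX k l (τ.d j f) - τ.A j * τ.XX k l (τ.d i f) := by
  rw [τ.XX_apply i j, map_sub, Derivation.leibniz, Derivation.leibniz]
  simp only [smul_eq_mul]; ring

/-- structure constants applied to a family -/
noncomputable def br (b : Fin m → Fin m → Pol n) (i j k l : Fin m) : Pol n :=
  τ.se i * dl n i k * b l j + τ.se i * dl n i l * b j k - τ.se j * dl n j k * b l i
    - τ.se j * dl n j l * b i k

lemma comm (i j k l : Fin m) (f : Pol n) : τ.XX i j (τ.XX k l f) - τ.XX k l (τ.XX i j f)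
    = τ.br (fun a b => τ.XX a b f) i j k l := by
  rw [XX_XX, XX_XX]
  simp only [XX_A, br]
  simp only [XX_apply, dl_comm (n := n) k i, dl_comm (n := n) l i, dl_comm (n := n) k j, dl_comm (n := n) l j,
    τ.d_comm l i, τ.d_comm k i, τ.d_comm l j, τ.d_comm k j]
  have h1 := τ.dl_se i k
  have h2 := τ.dl_se i l
  have h3 := τ.dl_se j k
  have h4 := τ.dl_se j l
  linear_combination (τ.A j * τ.d l f) * h1 - τ.A j * τ.d k f * h2 - τ.A i * τ.d l f * h3 + τ.A i * τ.d k f * h4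

/-- Plücker type identity -/
lemma cyc (i j k l : Fin m) (f : Pol n) :
    τ.XX k l (τ.XX i j f) + τ.XX l j (τ.XX i k f) + τ.XX j k (τ.XX i l f)
    = τ.se i * (dl n l i * τ.XX k j f + dl n k i * τ.XX j l f + dl n j i * τ.XX l k f) := by
  rw [XX_XX, XX_XX, XX_XX]
  simp only [XX_A]
  simp only [XX_apply, dl_comm (n := n) k i, dl_comm (n := n) l i, dl_comm (n := n) j i,
    dl_comm (n := n) k j, dl_comm (n := n) l j, dl_comm (n := n) l k,
    τ.d_comm l i, τ.d_comm k i, τ.d_comm j i, τ.d_comm l j, τ.d_comm k j, τ.d_comm l k]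
  have h1 := τ.dl_se j k
  have h2 := τ.dl_se j l
  have h3 := τ.dl_se k l
  linear_combination (τ.d i f * τ.A l) * h1 + (- τ.d i f * τ.A k) * h2 + τ.d i f * τ.A j * h3

/-- Casimir operator -/
noncomputable def Cas : Pol n →ₗ[ℝ] Pol n :=
  (-(1/2 : ℝ)) • ∑ k, ∑ l, (τ.s k * τ.s l) • ((τ.XX k l : Pol n →ₗ[ℝ] Pol n) ∘ₗ (τ.XX k l : Pol n →ₗ[ℝ] Pol n))

lemma Cas_apply (f : Pol n) : τ.Cas f = C (-(1/2 : ℝ)) * ∑ k, ∑ l, τ.se k * τ.se l * τ.XX k l (τ.XX k l f) := by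
  simp only [Cas, LinearMap.smul_apply, LinearMap.sum_apply, LinearMap.comp_apply, smul_eq_C_mul,
    Derivation.coeFn_coe, se, C_mul]

lemma fis_XX (k l : Fin m) (f g : Pol n) :
    fis (τ.XX k l f) g = - (τ.s k * τ.s l) * fis f (τ.XX k l g) := by
  simp only [XX_apply, A, d]
  rw [fis_sub_left, fis_sub_right, mul_assoc, mul_assoc, mul_assoc, mul_assoc, fis_C_mul_left, fis_C_mul_left, fis_C_mul_right, fis_C_mul_right,
    fis_X_mul_left, fis_X_mul_left, fis_pderiv_left, fis_pderiv_left]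
  have h1 := τ.sq k
  have h2 := τ.sq l
  set a := fis f (X (τ.e k) * (pderiv (τ.e l)) g)
  set b := fis f (X (τ.e l) * (pderiv (τ.e k)) g)
  linear_combination τ.s l * a * h1 - τ.s k * b * h2

lemma fis_XX_XX (k l : Fin m) (f g : Pol n) :
    fis (τ.XX k l (τ.XX k l f)) g = - (τ.s k * τ.s l) * fis (τ.XX k l f) (τ.XX k l g) := τ.fis_XX k l _ _

lemma fis_Cas (f g : Pol n) : fis (τ.Cas f) g = (1/2) * ∑ k, ∑ l, fis (τ.XX k l f) (τ.XX k l g) := by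
  rw [Cas_apply, fis_C_mul_left]
  simp_rw [fis_sum_left]
  rw [Finset.mul_sum, Finset.mul_sum]
  apply Finset.sum_congr rfl; intro k _
  rw [Finset.mul_sum, Finset.mul_sum]
  apply Finset.sum_congr rfl; intro l _
  rw [mul_assoc, se, se, fis_C_mul_left, fis_C_mul_left, fis_XX_XX]
  have h1 := τ.sq k
  have h2 := τ.sq l
  generalize fis (τ.XX k l f) (τ.XX k l g) = a
  generalize τ.s k = x at *
  generalize τ.s l = y at *
  linear_combination (1/2) * a * (y * y) * h1 + (1/2) * a * h2

lemma Cas_symm (f g : Pol n) : fis (τ.Cas f) g = fis f (τ.Cas g) := by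
  rw [fis_Cas, fis_comm f, fis_Cas]
  have h : ∀ k l, fis (τ.XX k l f) (τ.XX k l g) = fis (τ.XX k l g) (τ.XX k l f) := fun k l => fis_comm _ _
  simp_rw [h]

lemma XX_of_Cas {f : Pol n} (h : τ.Cas f = 0) (k l : Fin m) : τ.XX k l f = 0 := by
  have h1 := τ.fis_Cas f f
  rw [h, fis_zero_left] at h1
  have h2 : ∑ k, ∑ l, fis (τ.XX k l f) (τ.XX k l f) = 0 := by linarith
  rw [Finset.sum_eq_zero_iff_of_nonneg (fun k _ => Finset.sum_nonneg fun l _ => fis_self_nonneg _)] at h2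
  have h3 := h2 k (mem_univ _)
  rw [Finset.sum_eq_zero_iff_of_nonneg (fun l _ => fis_self_nonneg _)] at h3
  exact fis_self_eq_zero (h3 l (mem_univ _))

lemma Cas_of_XX {f : Pol n} (h : ∀ k l, τ.XX k l f = 0) : τ.Cas f = 0 := by
  rw [Cas_apply]; simp [h]

/-- Laplacian -/
noncomputable def Lap (f : Pol n) : Pol n := ∑ i, τ.se i * τ.d i (τ.d i f)

/-- Euler operator in the top variables -/
noncomputable def Eu (f : Pol n) : Pol n := ∑ i, X (τ.e i) * τ.d i f

lemma XX_Lap (k l : Fin m) (f : Pol n) : τ.Lap (τ.XX k l f) = τ.XX k l (τ.Lap f) := by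
  unfold Lap
  rw [map_sum]
  have : ∀ i, τ.se i * τ.d i (τ.d i (τ.XX k l f)) = τ.XX k l (τ.se i * τ.d i (τ.d i f))
      + 2 * (dl n i k * τ.d k (τ.d l f)) - 2 * (dl n i l * τ.d k (τ.d l f)) := by
    intro i
    rw [XX_se_mul, d_XX, map_add, d_XX, map_sub, Derivation.leibniz, Derivation.leibniz,
      Derivation.leibniz, Derivation.leibniz, d_se, d_se]
    have e1 : τ.d i (dl n i k) = 0 := by unfold dl; split_ifs <;> simp [d]
    have e2 : τ.d i (dl n i l) = 0 := by unfold dl; split_ifs <;> simp [d]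
    rw [e1, e2]
    simp only [smul_eq_mul]
    have h1 := τ.se_sq i
    have h5 : dl n i k * τ.d i (τ.d l f) = dl n i k * τ.d k (τ.d l f) := by
      unfold dl; split_ifs with h
      · rw [h]
      · simp
    have h6 : dl n i l * τ.d i (τ.d k f) = dl n i l * τ.d k (τ.d l f) := by
      unfold dl; split_ifs with h
      · rw [h, τ.d_comm]
      · simp
    have h7 := τ.dl_se i k
    have h8 := τ.dl_se i l
    have h5' : dl n i k * τ.d l (τ.d i f) = dl n i k * τ.d k (τ.d l f) := by
      rw [τ.d_comm l i, h5]
    have h6' : dl n i l * τ.d k (τ.d i f) = dl n i l * τ.d k (τ.d l f) := by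
      rw [τ.d_comm k i, h6]
    have h9 : τ.se i * τ.se k * dl n i k = dl n i k := by
      linear_combination h1 * dl n i k - τ.se i * h7
    have h10 : τ.se i * τ.se l * dl n i l = dl n i l := by
      linear_combination h1 * dl n i l - τ.se i * h8
    linear_combination τ.d i (τ.d l f) * h9 + h5 - τ.d i (τ.d k f) * h10 - h6 + τ.d l (τ.d i f) * h9 + h5'
      - τ.d k (τ.d i f) * h10 - h6'
  simp_rw [this]
  rw [Finset.sum_sub_distrib, Finset.sum_add_distrib, ← Finset.mul_sum, ← Finset.mul_sum, ← Finset.sum_mul,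
    ← Finset.sum_mul]
  simp [dl]

end Top

end NambuLin


namespace NambuLin

open MvPolynomial Finset
open scoped Nat

lemma pderiv_homog_zero {n : ℕ} {f : Pol n} (hf : f.IsHomogeneous 0) (i : Fin n) : pderiv i f = 0 := by
  have h := hf.totalDegree_le
  rw [Nat.le_zero, totalDegree_eq_zero_iff_eq_C] at h
  rw [h, pderiv_C]

lemma homog_X_mul_pderiv {n d : ℕ} {f : Pol n} (hf : f.IsHomogeneous d) (i j : Fin n) :
    (X i * pderiv j f).IsHomogeneous d := by
  rcases d with _ | d
  · rw [pderiv_homog_zero hf]; simpa using isHomogeneous_zero _ _ _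
  · have := (isHomogeneous_X ℝ i).mul (hf.pderiv (i := j))
    rwa [Nat.add_sub_cancel, add_comm] at this

lemma coeff_X_mul_pderiv {n : ℕ} (f : Pol n) (i : Fin n) (α : Fin n →₀ ℕ) :
    coeff α (X i * pderiv i f) = α i * coeff α f := by
  classical
  rw [coeff_X_mul']
  split_ifs with h
  · rw [coeff_pderiv]
    have h1 : Finsupp.single i 1 ≤ α := by
      rw [Finsupp.single_le_iff]; exact Nat.one_le_iff_ne_zero.2 (Finsupp.mem_support_iff.1 h)
    rw [tsub_add_cancel_of_le h1]
    have h2 : ((α - Finsupp.single i 1 : Fin n →₀ ℕ) i : ℝ) + 1 = α i := by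
      have : (α - Finsupp.single i 1 : Fin n →₀ ℕ) i + 1 = α i := by
        rw [← Finsupp.single_eq_same (a := i) (b := 1), ← Finsupp.add_apply, Finsupp.single_eq_same, tsub_add_cancel_of_le h1]
      exact_mod_cast this
    rw [h2]; ring
  · rw [Finsupp.notMem_support_iff.1 h]; simp

namespace Top

variable {n m : ℕ} (τ : Top n m)

lemma XX_homog {d : ℕ} {f : Pol n} (hf : f.IsHomogeneous d) (k l : Fin m) : (τ.XX k l f).IsHomogeneous d := by
  rw [XX_apply]
  unfold A Top.d
  rw [mul_assoc, mul_assoc]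
  exact ((homog_X_mul_pderiv hf _ _).C_mul _).sub ((homog_X_mul_pderiv hf _ _).C_mul _)

lemma se_homog {d : ℕ} {f : Pol n} (hf : f.IsHomogeneous d) (k : Fin m) : (τ.se k * f).IsHomogeneous d :=
  hf.C_mul _

lemma Cas_homog {d : ℕ} {f : Pol n} (hf : f.IsHomogeneous d) : (τ.Cas f).IsHomogeneous d := by
  rw [Cas_apply]
  apply IsHomogeneous.C_mul
  refine IsHomogeneous.sum _ _ _ fun k _ => IsHomogeneous.sum _ _ _ fun l _ => ?_
  rw [mul_assoc]
  exact τ.se_homog (τ.se_homog (τ.XX_homog (τ.XX_homog hf _ _) _ _) _) _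

lemma Cas_formula {f : Pol n} (hL : τ.Lap f = 0) :
    τ.Cas f = τ.Eu (τ.Eu f) + C ((m : ℝ) - 2) * τ.Eu f := by
  have h1 : ∀ k l, τ.se k * τ.se l * τ.XX k l (τ.XX k l f) =
      2 * (dl n k l * (X (τ.e k) * τ.d k f)) - X (τ.e l) * τ.d l f - X (τ.e k) * τ.d k f
      + (τ.se k * X (τ.e k) ^ 2) * (τ.se l * τ.d l (τ.d l f))
      + (τ.se l * X (τ.e l) ^ 2) * (τ.se k * τ.d k (τ.d k f))
      - 2 * (X (τ.e k) * X (τ.e l) * τ.d k (τ.d l f)) := by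
    intro k l
    rw [XX_XX]
    simp only [XX_A]
    simp only [XX_apply, τ.d_comm l k, dl_comm (n := n) l k]
    have e1 : dl n k k = 1 := by simp [dl]
    have e2 : dl n l l = 1 := by simp [dl]
    rw [e1, e2]
    change τ.se k * τ.se l * (τ.se k * (dl n k l * (τ.se k * X (τ.e k)) - 1 * (τ.se l * X (τ.e l))) * _ -
      τ.se l * (1 * (τ.se k * X (τ.e k)) - dl n k l * (τ.se l * X (τ.e l))) * _ +
      (τ.se k * X (τ.e k)) * ((τ.se k * X (τ.e k)) * _ - (τ.se l * X (τ.e l)) * _)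
      - (τ.se l * X (τ.e l)) * ((τ.se k * X (τ.e k)) * _ - (τ.se l * X (τ.e l)) * _)) = _
    have h1 := τ.se_sq k
    have h2 := τ.se_sq l
    have h3 := τ.dl_se k l
    have h4 : τ.se k * τ.se l * dl n k l = dl n k l := by
      linear_combination h1 * dl n k l - τ.se k * h3
    have h5 : dl n k l * (X (τ.e l) * τ.d k f) = dl n k l * (X (τ.e k) * τ.d k f) := by
      unfold dl; split_ifs with h
      · rw [h]
      · simp
    have h6 : dl n k l * (X (τ.e k) * τ.d l f) = dl n k l * (X (τ.e k) * τ.d k f) := by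
      unfold dl; split_ifs with h
      · rw [h]
      · simp
    generalize dl n k l = δ at *
    generalize τ.se k = a at *
    generalize τ.se l = b at *
    generalize τ.d k f = fk at *
    generalize τ.d l f = fl at *
    generalize (X (τ.e l) : Pol n) = xl at *
    generalize (X (τ.e k) : Pol n) = xk at *
    generalize τ.d k fk = fkk
    generalize τ.d l fl = fll
    generalize τ.d k fl = fkl
    have h12 : a * a * (b * b) = 1 := by rw [h1, h2, one_mul]
    linear_combination (xk * fl * a * a) * h4 + δ * xk * fl * h1 + h6 - (xl * fl + xk * fk + 2 * xk * xl * fkl) * h12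
      + xl * fk * b * b * h4 + δ * xl * fk * h2 + h5 + a * b * xk ^ 2 * fll * h1 + a * b * xl ^ 2 * fkk * h2
  have hEE : τ.Eu (τ.Eu f) = ∑ k, ∑ l, (dl n k l * (X (τ.e k) * τ.d k f) + X (τ.e k) * X (τ.e l) * τ.d k (τ.d l f)) := by
    unfold Eu
    apply Finset.sum_congr rfl; intro k _
    rw [map_sum, Finset.mul_sum]
    apply Finset.sum_congr rfl; intro l _
    rw [Derivation.leibniz]
    have : τ.d k (X (τ.e l)) = dl n k l := by
      simp only [d, dl]
      rw [pderiv_X]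
      simp only [Pi.single_apply, τ.inj.eq_iff]
      simp [eq_comm]
    rw [this]
    have h5 : dl n k l * (X (τ.e k) * τ.d l f) = dl n k l * (X (τ.e k) * τ.d k f) := by
      unfold dl; split_ifs with h
      · rw [h]
      · simp
    simp only [smul_eq_mul]
    linear_combination h5
  have hs1 : ∑ k, ∑ l, τ.se k * τ.se l * τ.XX k l (τ.XX k l f)
      = 4 * τ.Eu f - 2 * τ.Eu (τ.Eu f) - 2 * (m : Pol n) * τ.Eu f := by
    have a1 : ∀ k : Fin m, ∑ l, dl n k l * (X (τ.e k) * τ.d k f) = X (τ.e k) * τ.d k f := by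
      intro k; rw [← Finset.sum_mul]; simp [dl]
    have hL' : ∑ l, τ.se l * τ.d l (τ.d l f) = 0 := hL
    have hEu : ∑ k, X (τ.e k) * τ.d k f = τ.Eu f := rfl
    rw [hEE]
    simp_rw [h1]
    simp only [Finset.sum_sub_distrib, Finset.sum_add_distrib, ← Finset.mul_sum, a1, hL', ← Finset.sum_mul, hEu,
      Finset.sum_const, Finset.card_univ, Fintype.card_fin, nsmul_eq_mul]
    have hEu' : ∑ x, X (τ.e x) * ((m : Pol n) * τ.d x f) = m * τ.Eu f := by
      rw [← hEu, Finset.mul_sum]; exact Finset.sum_congr rfl fun _ _ => by ring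
    rw [hEu']
    ring
  rw [Cas_apply, hs1]
  have : (C (-(1/2:ℝ)) : Pol n) * 2 = -1 := by
    have : (2 : Pol n) = C 2 := (map_ofNat C 2).symm
    rw [this, ← C_mul]; norm_num
  have hm : (C ((m:ℝ) - 2) : Pol n) = m - 2 := by rw [C_sub, map_natCast, map_ofNat]
  rw [hm]
  linear_combination (2 * τ.Eu f - τ.Eu (τ.Eu f) - m * τ.Eu f) * this

lemma coeff_Eu (f : Pol n) (α : Fin n →₀ ℕ) : coeff α (τ.Eu f) = ((∑ i, α (τ.e i) : ℕ) : ℝ) * coeff α f := by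
  unfold Eu d
  rw [coeff_sum]
  simp_rw [coeff_X_mul_pderiv]
  rw [← Finset.sum_mul]; push_cast; rfl

lemma Lap_smul (c : ℝ) (f : Pol n) : τ.Lap (c • f) = c • τ.Lap f := by
  unfold Lap; rw [Finset.smul_sum]; simp

lemma Lap_Cas (f : Pol n) : τ.Cas (τ.Lap f) = τ.Lap (τ.Cas f) := by
  rw [Cas_apply, Cas_apply]
  simp_rw [← XX_Lap]
  rw [← smul_eq_C_mul, ← smul_eq_C_mul, Lap_smul]
  congr 1
  have hadd : ∀ (ι : Type) (s : Finset ι) (g : ι → Pol n), τ.Lap (∑ i ∈ s, g i) = ∑ i ∈ s, τ.Lap (g i) := by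
    intro ι s g
    unfold Lap
    rw [Finset.sum_comm]
    apply Finset.sum_congr rfl; intro i _
    rw [map_sum, map_sum, Finset.mul_sum]
  rw [hadd]
  apply Finset.sum_congr rfl; intro k _
  rw [hadd]
  apply Finset.sum_congr rfl; intro l _
  rw [se, se, ← C_mul, ← smul_eq_C_mul, ← smul_eq_C_mul, Lap_smul]

lemma Cas_eig (hm : 3 ≤ m) (d : ℕ) : ∀ (μ : ℝ) (f : Pol n), f.IsHomogeneous d → f ≠ 0 → τ.Cas f = μ • f →
    μ = 0 ∨ 2 ≤ μ := by
  induction d using Nat.strong_induction_on with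
  | _ d ih =>
    intro μ f hf hf0 he
    by_cases hL : τ.Lap f = 0
    · rw [τ.Cas_formula hL] at he
      obtain ⟨α, hα⟩ := MvPolynomial.ne_zero_iff.1 hf0
      have h := congrArg (coeff α) he
      rw [coeff_add, coeff_C_mul, coeff_Eu, coeff_Eu, coeff_smul, smul_eq_mul] at h
      set E := ∑ i, α (τ.e i)
      have h2 : μ = (E:ℝ) * (E + (m - 2)) := by
        apply mul_right_cancel₀ hα
        rw [← h]; ring
      rcases Nat.eq_zero_or_pos E with h0 | h0
      · left; rw [h2, h0]; simp
      · right
        rw [h2]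
        have h3 : (1:ℝ) ≤ E := by exact_mod_cast h0
        have h4 : (3:ℝ) ≤ m := by exact_mod_cast hm
        nlinarith
    · have hd : 2 ≤ d := by
        by_contra hd
        apply hL
        unfold Lap
        apply Finset.sum_eq_zero; intro i _
        have : τ.d i (τ.d i f) = 0 := by
          apply pderiv_homog_zero
          have := hf.pderiv (i := τ.e i)
          rwa [show d - 1 = 0 by omega] at this
        rw [this, mul_zero]
      refine ih (d - 1 - 1) (by omega) μ (τ.Lap f) ?_ hL ?_
      · unfold Lap
        exact IsHomogeneous.sum _ _ _ fun i _ => τ.se_homog (hf.pderiv.pderiv) _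
      · rw [Lap_Cas, he, Lap_smul]

lemma Cas_gap (hm : 3 ≤ m) (d : ℕ) :
    (∀ w : Pol n, w.IsHomogeneous d → ∃ w0 v : Pol n, w0.IsHomogeneous d ∧ v.IsHomogeneous d ∧
      τ.Cas w0 = 0 ∧ (∀ g : Pol n, g.IsHomogeneous d → τ.Cas g = 0 → fis v g = 0) ∧ w = w0 + τ.Cas v) ∧
    (∀ f : Pol n, f.IsHomogeneous d → (∀ g : Pol n, g.IsHomogeneous d → τ.Cas g = 0 → fis f g = 0) →
      2 * fis f f ≤ fis (τ.Cas f) f) :=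
  gap_pol τ.Cas (fun _ h => τ.Cas_homog h) τ.Cas_symm (τ.Cas_eig hm d)

lemma fis_zero_of_ker {f g : Pol n} (h : τ.Cas g = 0) (k l : Fin m) : fis (τ.XX k l f) g = 0 := by
  rw [fis_XX, XX_of_Cas τ h, fis_zero_right, mul_zero]

lemma fis_Cas_ker {f g : Pol n} (h : τ.Cas g = 0) : fis (τ.Cas f) g = 0 := by
  rw [Cas_symm, h, fis_zero_right]

/-- orthogonality to the kernel of the Casimir in degree `d` -/
def Perp (d : ℕ) (f : Pol n) : Prop := ∀ g : Pol n, g.IsHomogeneous d → τ.Cas g = 0 → fis f g = 0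

lemma sum_dl1 (i : Fin m) (F : Fin m → Fin m → Pol n) :
    ∑ k, ∑ l, τ.se k * τ.se l * (τ.se i * dl n i k * F k l) = ∑ l, τ.se l * F i l := by
  rw [Finset.sum_comm]
  apply Finset.sum_congr rfl; intro l _
  rw [Finset.sum_eq_single i]
  · have h := τ.se_sq i
    simp only [dl, if_true]
    linear_combination τ.se l * F i l * h
  · intro k _ hk; simp [dl, hk.symm]
  · simp

lemma sum_dl2 (i : Fin m) (F : Fin m → Fin m → Pol n) :
    ∑ k, ∑ l, τ.se k * τ.se l * (τ.se i * dl n i l * F k l) = ∑ k, τ.se k * F k i := by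
  apply Finset.sum_congr rfl; intro l _
  rw [Finset.sum_eq_single i]
  · have h := τ.se_sq i
    simp only [dl, if_true]
    linear_combination τ.se l * F l i * h
  · intro k _ hk; simp [dl, hk.symm]
  · simp

lemma XX_dl (k l i j : Fin m) (f : Pol n) : τ.XX k l (dl n i j * f) = dl n i j * τ.XX k l f := by
  unfold dl; split_ifs <;> simp

/-- cocycle condition -/
def Coc (b : Fin m → Fin m → Pol n) : Prop :=
  ∀ i j k l, τ.XX i j (b k l) - τ.XX k l (b i j) = τ.br b i j k l

/-- the codifferential of a family -/
noncomputable def cod (b : Fin m → Fin m → Pol n) : Pol n :=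
  C (-(1/2 : ℝ)) * ∑ k, ∑ l, τ.se k * τ.se l * τ.XX k l (b k l)

lemma Cas_coc {b : Fin m → Fin m → Pol n} (hb : τ.Coc b) (i j : Fin m) :
    τ.Cas (b i j) = τ.XX i j (τ.cod b) := by
  rw [Cas_apply, cod, ← smul_eq_C_mul, ← smul_eq_C_mul, Derivation.map_smul]
  congr 1
  rw [map_sum]
  simp_rw [map_sum]
  have h1 : ∀ k l, τ.se k * τ.se l * τ.XX k l (τ.XX k l (b i j)) =
      τ.XX i j (τ.se k * τ.se l * τ.XX k l (b k l))
      - (τ.se k * τ.se l * (τ.se i * dl n i k * τ.XX l j (b k l))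
       + τ.se k * τ.se l * (τ.se i * dl n i l * τ.XX j k (b k l))
       - τ.se k * τ.se l * (τ.se j * dl n j k * τ.XX l i (b k l))
       - τ.se k * τ.se l * (τ.se j * dl n j l * τ.XX i k (b k l))
       + τ.se k * τ.se l * (τ.se i * dl n i k * τ.XX k l (b l j))
       + τ.se k * τ.se l * (τ.se i * dl n i l * τ.XX k l (b j k))
       - τ.se k * τ.se l * (τ.se j * dl n j k * τ.XX k l (b l i))
       - τ.se k * τ.se l * (τ.se j * dl n j l * τ.XX k l (b i k))) := by
    intro k l
    have h2 : τ.XX k l (b i j) = τ.XX i j (b k l) - τ.br b i j k l := by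
      rw [← hb i j k l]; ring
    have h3 := τ.comm i j k l (b k l)
    have h4 : τ.XX k l (τ.br b i j k l) = τ.se i * dl n i k * τ.XX k l (b l j) + τ.se i * dl n i l * τ.XX k l (b j k)
       - τ.se j * dl n j k * τ.XX k l (b l i) - τ.se j * dl n j l * τ.XX k l (b i k) := by
      unfold br
      simp only [map_sub, map_add, mul_assoc, XX_se_mul, XX_dl]
    rw [h2, map_sub, h4, mul_assoc (τ.se k) (τ.se l) (τ.XX k l (b k l)), XX_se_mul, XX_se_mul]
    unfold br at h3
    linear_combination -(τ.se k * τ.se l) * h3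
  simp_rw [h1]
  simp only [Finset.sum_sub_distrib, Finset.sum_add_distrib]
  simp only [τ.sum_dl1 i (fun k l => τ.XX l j (b k l)), τ.sum_dl2 i (fun k l => τ.XX j k (b k l)),
    τ.sum_dl1 j (fun k l => τ.XX l i (b k l)), τ.sum_dl2 j (fun k l => τ.XX i k (b k l)),
    τ.sum_dl1 i (fun k l => τ.XX k l (b l j)), τ.sum_dl2 i (fun k l => τ.XX k l (b j k)),
    τ.sum_dl1 j (fun k l => τ.XX k l (b l i)), τ.sum_dl2 j (fun k l => τ.XX k l (b i k))]
  ring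

lemma Coc_XX (f : Pol n) : τ.Coc (fun k l => τ.XX k l f) := fun i j k l => τ.comm i j k l f

lemma Cas_XX (i j : Fin m) (f : Pol n) : τ.Cas (τ.XX i j f) = τ.XX i j (τ.Cas f) := by
  rw [τ.Cas_coc (τ.Coc_XX f), τ.Cas_apply f]; rfl

/-- the operator `S` -/
noncomputable def S (a : Fin m → Pol n) (j : Fin m) : Pol n := ∑ i, τ.se i * τ.XX i j (a i)

/-- the operator `T = 1 + S` -/
noncomputable def T (a : Fin m → Pol n) (j : Fin m) : Pol n := a j + τ.S a j

/-- the closedness condition `Y` -/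
def Y (a : Fin m → Pol n) : Prop := ∀ i j k, τ.XX k i (a j) + τ.XX i j (a k) + τ.XX j k (a i) = 0

lemma T_Y (a : Fin m → Pol n) : τ.Y (τ.T a) := by
  intro i j k
  unfold T S
  simp only [map_add, map_sum, XX_se_mul]
  have h : ∀ p, τ.se p * τ.XX k i (τ.XX p j (a p)) + τ.se p * τ.XX i j (τ.XX p k (a p))
      + τ.se p * τ.XX j k (τ.XX p i (a p)) = dl n i p * τ.XX k j (a p) + dl n k p * τ.XX j i (a p)
        + dl n j p * τ.XX i k (a p) := by
    intro p
    have h1 := τ.cyc p j k i (a p)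
    have h2 := τ.se_sq p
    linear_combination τ.se p * h1 + (dl n i p * τ.XX k j (a p) + dl n k p * τ.XX j i (a p)
        + dl n j p * τ.XX i k (a p)) * h2
  have h' : ∑ p, (τ.se p * τ.XX k i (τ.XX p j (a p)) + τ.se p * τ.XX i j (τ.XX p k (a p))
      + τ.se p * τ.XX j k (τ.XX p i (a p))) = τ.XX k j (a i) + τ.XX j i (a k) + τ.XX i k (a j) := by
    simp_rw [h]
    simp only [Finset.sum_add_distrib, dl, ite_mul, one_mul, zero_mul, Finset.sum_ite_eq, Finset.mem_univ, if_true]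
  simp only [Finset.sum_add_distrib] at h'
  rw [τ.XX_anti' k j, τ.XX_anti' j i, τ.XX_anti' i k] at h'
  linear_combination h'

lemma S_sq {a : Fin m → Pol n} (ha : τ.Y a) (j : Fin m) :
    τ.S (τ.S a) j + C ((m : ℝ) - 2) * τ.S a j = τ.Cas (a j) := by
  have h1 : τ.Cas (a j) = ∑ k, ∑ i, τ.se k * τ.se i * τ.XX i k (τ.XX k j (a i)) := by
    rw [Cas_apply]
    have e1 : ∀ k i, τ.se k * τ.se i * τ.XX k i (τ.XX k i (a j)) =
        - (τ.se k * τ.se i * τ.XX i k (τ.XX k j (a i))) - (τ.se k * τ.se i * τ.XX k i (τ.XX i j (a k))) := by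
      intro k i
      have h := ha i j k
      have h2 : τ.XX k i (a j) = τ.XX k j (a i) - τ.XX i j (a k) := by
        rw [τ.XX_anti' k j]; linear_combination h
      rw [h2, map_sub, τ.XX_anti' i k]; ring
    simp_rw [e1]
    simp only [Finset.sum_sub_distrib, Finset.sum_neg_distrib]
    have e2 : ∑ k, ∑ i, τ.se k * τ.se i * τ.XX k i (τ.XX i j (a k))
        = ∑ k, ∑ i, τ.se k * τ.se i * τ.XX i k (τ.XX k j (a i)) := by
      rw [Finset.sum_comm]
      exact Finset.sum_congr rfl fun k _ => Finset.sum_congr rfl fun i _ => by ring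
    rw [e2]
    have : (C (-(1/2:ℝ)) : Pol n) * 2 = -1 := by
      have : (2 : Pol n) = C 2 := (map_ofNat C 2).symm
      rw [this, ← C_mul]; norm_num
    linear_combination -(∑ k, ∑ i, τ.se k * τ.se i * τ.XX i k (τ.XX k j (a i))) * this
  have h2 : τ.S (τ.S a) j = ∑ k, ∑ i, τ.se k * τ.se i * τ.XX k j (τ.XX i k (a i)) := by
    unfold S
    apply Finset.sum_congr rfl; intro k _
    rw [map_sum, Finset.mul_sum]
    apply Finset.sum_congr rfl; intro i _
    rw [XX_se_mul]; ring
  have h3 : ∀ k i, τ.se k * τ.se i * τ.XX i k (τ.XX k j (a i)) = τ.se k * τ.se i * τ.XX k j (τ.XX i k (a i))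
      + τ.se k * τ.se i * (τ.se k * dl n k i * τ.XX j k (a i)) - τ.se i * τ.XX j i (a i)
      - τ.se k * τ.se i * (τ.se j * dl n j k * τ.XX i k (a i)) := by
    intro k i
    have h := τ.comm i k k j (a i)
    unfold br at h
    beta_reduce at h
    rw [XX_self] at h
    have e1 : dl n k k = 1 := by simp [dl]
    rw [e1] at h
    simp only [Derivation.coe_zero, Pi.zero_apply, mul_zero, add_zero, mul_one] at h
    have e2 := τ.dl_se k i
    have e3 := τ.dl_se k j
    have e4 := τ.se_sq k
    rw [dl_comm i k] at h
    rw [dl_comm j k]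
    linear_combination τ.se k * τ.se i * h - τ.se k * τ.se i * τ.XX j k (a i) * e2 - τ.se i * τ.XX j i (a i) * e4
      - τ.se k * τ.se i * τ.XX i k (a i) * e3
  have h4 : ∑ k, ∑ i, τ.se k * τ.se i * (τ.se k * dl n k i * τ.XX j k (a i)) = - τ.S a j := by
    unfold S
    rw [← Finset.sum_neg_distrib]
    apply Finset.sum_congr rfl; intro k _
    rw [Finset.sum_eq_single k]
    · have := τ.se_sq k
      rw [τ.XX_anti' j k]
      simp only [dl, if_true]
      linear_combination -(τ.se k) * τ.XX k j (a k) * this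
    · intro i _ hi; simp [dl, hi.symm]
    · simp
  have h5 : ∑ i, τ.se i * τ.XX j i (a i) = - τ.S a j := by
    unfold S
    rw [← Finset.sum_neg_distrib]
    apply Finset.sum_congr rfl; intro k _
    rw [τ.XX_anti' j k]; ring
  have h6 : ∑ k, ∑ i, τ.se k * τ.se i * (τ.se j * dl n j k * τ.XX i k (a i)) = τ.S a j :=
    τ.sum_dl1 j (fun k i => τ.XX i k (a i))
  rw [h1]
  simp_rw [h3]
  simp only [Finset.sum_sub_distrib, Finset.sum_add_distrib]
  rw [h4, h5, h6, ← h2]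
  simp only [Finset.sum_const, Finset.card_univ, Fintype.card_fin, nsmul_eq_mul]
  have hm : (C ((m:ℝ) - 2) : Pol n) = m - 2 := by rw [C_sub, map_natCast, map_ofNat]
  rw [hm]; ring

lemma S_adj (a b : Fin m → Pol n) : ∑ j, fis (τ.S a j) (b j) = ∑ j, fis (a j) (τ.S b j) := by
  unfold S
  simp_rw [fis_sum_left, fis_sum_right]
  rw [Finset.sum_comm]
  apply Finset.sum_congr rfl; intro i _
  apply Finset.sum_congr rfl; intro j _
  rw [se, se, fis_C_mul_left, fis_C_mul_right, fis_XX, τ.XX_anti' j i, fis_neg_right]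
  have h := τ.sq i
  generalize fis (a i) (τ.XX i j (b j)) = x
  linear_combination -(τ.s j * x) * h

end Top

end NambuLin


namespace NambuLin

open MvPolynomial Finset
open scoped Nat

namespace Top

variable {n m : ℕ} (τ : Top n m)

lemma fs_nonneg (a : Fin m → Pol n) : 0 ≤ ∑ j, fis (a j) (a j) :=
  Finset.sum_nonneg fun _ _ => fis_self_nonneg _

lemma S_homog {d : ℕ} {a : Fin m → Pol n} (ha : ∀ j, (a j).IsHomogeneous d) (j : Fin m) :
    (τ.S a j).IsHomogeneous d :=
  IsHomogeneous.sum _ _ _ fun i _ => τ.se_homog (τ.XX_homog (ha i) _ _) _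

lemma T_homog {d : ℕ} {a : Fin m → Pol n} (ha : ∀ j, (a j).IsHomogeneous d) (j : Fin m) :
    (τ.T a j).IsHomogeneous d := (ha j).add (τ.S_homog ha j)

lemma S_add (a b : Fin m → Pol n) (j : Fin m) : τ.S (fun i => a i + b i) j = τ.S a j + τ.S b j := by
  unfold S; simp only [map_add, mul_add, Finset.sum_add_distrib]

lemma T_add (a b : Fin m → Pol n) (j : Fin m) : τ.T (fun i => a i + b i) j = τ.T a j + τ.T b j := by
  unfold T; rw [S_add]; ring

lemma T_smul (c : ℝ) (a : Fin m → Pol n) (j : Fin m) : τ.T (fun i => c • a i) j = c • τ.T a j := by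
  unfold T S; simp only [Derivation.map_smul, smul_add, Finset.smul_sum, mul_smul_comm]

lemma T_sq_id {a : Fin m → Pol n} (ha : τ.Y a) :
    ∑ j, fis (τ.T a j) (τ.T a j) = ∑ j, fis (τ.Cas (a j)) (a j) + ((m:ℝ) - 3) * ∑ j, fis (a j) (a j)
      - ((m:ℝ) - 4) * ∑ j, fis (τ.T a j) (a j) := by
  have h1 : ∑ j, fis (τ.S a j) (τ.S a j) = ∑ j, fis (τ.Cas (a j)) (a j)
      - ((m:ℝ) - 2) * ∑ j, fis (τ.S a j) (a j) := by
    rw [← τ.S_adj (τ.S a) a, Finset.mul_sum, ← Finset.sum_sub_distrib]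
    apply Finset.sum_congr rfl; intro j _
    rw [← τ.S_sq ha j, fis_add_left, fis_C_mul_left]
    ring
  have h2 : ∑ j, fis (τ.T a j) (τ.T a j) = ∑ j, fis (a j) (a j) + 2 * ∑ j, fis (τ.S a j) (a j)
      + ∑ j, fis (τ.S a j) (τ.S a j) := by
    rw [Finset.mul_sum, ← Finset.sum_add_distrib, ← Finset.sum_add_distrib]
    apply Finset.sum_congr rfl; intro j _
    rw [T, fis_add_left, fis_add_right, fis_add_right, fis_comm (a j) (τ.S a j)]
    ring
  have h3 : ∑ j, fis (τ.T a j) (a j) = ∑ j, fis (a j) (a j) + ∑ j, fis (τ.S a j) (a j) := by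
    rw [← Finset.sum_add_distrib]
    apply Finset.sum_congr rfl; intro j _
    rw [T, fis_add_left]
  rw [h2, h1, h3]; ring

lemma T_bound_perp (hm : 3 ≤ m) {d : ℕ} {a : Fin m → Pol n} (ha : τ.Y a) (hd : ∀ j, (a j).IsHomogeneous d)
    (hp : ∀ j, τ.Perp d (a j)) :
    ∑ j, fis (a j) (a j) ≤ ∑ j, fis (τ.T a j) (τ.T a j) := by
  have h1 := τ.T_sq_id ha
  have h2 : 2 * ∑ j, fis (a j) (a j) ≤ ∑ j, fis (τ.Cas (a j)) (a j) := by
    rw [Finset.mul_sum]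
    exact Finset.sum_le_sum fun j _ => (τ.Cas_gap hm d).2 (a j) (hd j) (hp j)
  have h3 : 0 ≤ ∑ j, fis (τ.T a j) (τ.T a j) + ∑ j, fis (a j) (a j) - 2 * ∑ j, fis (τ.T a j) (a j) := by
    have := fs_nonneg (fun j => τ.T a j - a j)
    simp only [fis_sub_left, fis_sub_right, Finset.sum_sub_distrib] at this
    simp only [fun j => fis_comm (a j) (τ.T a j)] at this
    linarith
  have h4 : 0 ≤ ∑ j, fis (τ.T a j) (τ.T a j) + ∑ j, fis (a j) (a j) + 2 * ∑ j, fis (τ.T a j) (a j) := by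
    have := fs_nonneg (fun j => τ.T a j + a j)
    simp only [fis_add_left, fis_add_right, Finset.sum_add_distrib] at this
    simp only [fun j => fis_comm (a j) (τ.T a j)] at this
    linarith
  have h5 := fs_nonneg a
  generalize ∑ j, fis (τ.T a j) (τ.T a j) = t at *
  generalize ∑ j, fis (a j) (a j) = s at *
  generalize ∑ j, fis (τ.T a j) (a j) = p at *
  generalize ∑ j, fis (τ.Cas (a j)) (a j) = c at *
  rcases Nat.lt_or_ge m 4 with h | h
  · obtain rfl : m = 3 := by omega
    norm_num at h1
    linarith
  · have hm4 : (4:ℝ) ≤ m := by exact_mod_cast h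
    nlinarith [mul_nonneg (sub_nonneg.2 hm4) h3]

lemma T_bound (hm : 3 ≤ m) {d : ℕ} {a : Fin m → Pol n} (ha : τ.Y a) (hd : ∀ j, (a j).IsHomogeneous d) :
    ∑ j, fis (a j) (a j) ≤ ∑ j, fis (τ.T a j) (τ.T a j) := by
  choose a0 v h1 h2 h3 h4 h5 using fun j => (τ.Cas_gap hm d).1 (a j) (hd j)
  have hX0 : ∀ j k l, τ.XX k l (a0 j) = 0 := fun j k l => τ.XX_of_Cas (h3 j) k l
  have hY : τ.Y (fun j => τ.Cas (v j)) := by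
    intro i j k
    have := ha i j k
    rw [h5 i, h5 j, h5 k] at this
    simpa [hX0] using this
  have hT0 : ∀ j, τ.T a0 j = a0 j := by intro j; unfold T S; simp [hX0]
  have hTa : ∀ j, τ.T a j = a0 j + τ.T (fun j => τ.Cas (v j)) j := by
    intro j
    have : a = fun i => a0 i + τ.Cas (v i) := funext h5
    rw [← hT0 j]
    conv_lhs => rw [this]
    exact τ.T_add _ _ j
  have hb := τ.T_bound_perp hm hY (fun j => τ.Cas_homog (h2 j)) (fun j g _ hg => τ.fis_Cas_ker hg)
  have e1 : ∀ j, fis (a j) (a j) = fis (a0 j) (a0 j) + fis (τ.Cas (v j)) (τ.Cas (v j)) := by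
    intro j
    conv_lhs => rw [h5 j]
    rw [fis_add_left, fis_add_right, fis_add_right, fis_comm (a0 j) (τ.Cas _), τ.fis_Cas_ker (h3 j)]
    ring
  have e2 : ∀ j, fis (τ.T a j) (τ.T a j) = fis (a0 j) (a0 j)
      + fis (τ.T (fun j => τ.Cas (v j)) j) (τ.T (fun j => τ.Cas (v j)) j) := by
    intro j
    rw [hTa j]
    have : fis (τ.T (fun j => τ.Cas (v j)) j) (a0 j) = 0 := by
      rw [T, S, fis_add_left, fis_sum_left, τ.fis_Cas_ker (h3 j), zero_add]
      apply Finset.sum_eq_zero; intro i _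
      rw [se, fis_C_mul_left, τ.fis_zero_of_ker (h3 j), mul_zero]
    rw [fis_add_left, fis_add_right, fis_add_right, fis_comm (a0 j) (τ.T _ j), this]
    ring
  simp_rw [e1, e2]
  rw [Finset.sum_add_distrib, Finset.sum_add_distrib]
  linarith

/-- the submodule of closed homogeneous families -/
noncomputable def Yd (d : ℕ) : Submodule ℝ (Fin m → homogeneousSubmodule (Fin n) ℝ d) where
  carrier := {a | τ.Y (fun j => (a j : Pol n))}
  add_mem' := by
    intro a b ha hb i j k
    have h1 := ha i j k
    have h2 := hb i j k
    simp only [Pi.add_apply, Submodule.coe_add, map_add]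
    linear_combination h1 + h2
  zero_mem' := by intro i j k; simp
  smul_mem' := by
    intro c a ha i j k
    have h1 := ha i j k
    simp only [Pi.smul_apply, Submodule.coe_smul, Derivation.map_smul]
    rw [← smul_add, ← smul_add, h1, smul_zero]

noncomputable def Tlin (d : ℕ) : τ.Yd d →ₗ[ℝ] τ.Yd d where
  toFun a := ⟨fun j => ⟨τ.T (fun j => (a.1 j : Pol n)) j, τ.T_homog (fun j => (a.1 j).2) j⟩, τ.T_Y _⟩
  map_add' := by
    intro a b
    apply Subtype.ext; funext j; apply Subtype.ext
    exact τ.T_add _ _ j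
  map_smul' := by
    intro c a
    apply Subtype.ext; funext j; apply Subtype.ext
    exact τ.T_smul _ _ j

instance finHom (n d : ℕ) : FiniteDimensional ℝ (homogeneousSubmodule (Fin n) ℝ d) :=
  Module.Finite.iff_fg.2 (homogeneousSubmodule_fg (Fin n) ℝ d)

lemma T_surj (hm : 3 ≤ m) {d : ℕ} {a : Fin m → Pol n} (ha : τ.Y a) (hd : ∀ j, (a j).IsHomogeneous d) :
    ∃ z : Fin m → Pol n, τ.Y z ∧ (∀ j, (z j).IsHomogeneous d) ∧ ∀ j, τ.T z j = a j := by
  have hinj : Function.Injective (τ.Tlin d) := by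
    rw [injective_iff_map_eq_zero]
    intro z hz
    have h0 : ∀ j, τ.T (fun j => (z.1 j : Pol n)) j = 0 := by
      intro j
      have := congrArg (fun w : τ.Yd d => (w.1 j : Pol n)) hz
      simpa [Tlin] using this
    have hb := τ.T_bound hm z.2 (fun j => (z.1 j).2)
    simp only [h0, fis_zero_left, Finset.sum_const_zero] at hb
    have := (Finset.sum_eq_zero_iff_of_nonneg (fun j _ => fis_self_nonneg _)).1
      (le_antisymm hb (fs_nonneg _))
    apply Subtype.ext; funext j; apply Subtype.ext
    exact fis_self_eq_zero (this j (mem_univ j))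
  have hfd : FiniteDimensional ℝ (Fin m → homogeneousSubmodule (Fin n) ℝ d) := inferInstance
  have hfd2 : FiniteDimensional ℝ (τ.Yd d) := inferInstance
  have hsur : Function.Surjective (τ.Tlin d) := 
    (@LinearMap.injective_iff_surjective ℝ (τ.Yd d) _ _ _ _ (τ.Tlin d)).1 hinj
  obtain ⟨z, hz⟩ := hsur ⟨fun j => ⟨a j, hd j⟩, ha⟩
  refine ⟨fun j => z.1 j, z.2, fun j => (z.1 j).2, fun j => ?_⟩
  have := congrArg (fun w : τ.Yd d => (w.1 j : Pol n)) hz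
  simpa [Tlin] using this

lemma A_ne (k : Fin m) : τ.A k ≠ 0 := by
  unfold A
  have : τ.s k ≠ 0 := fun h => by have := τ.sq k; rw [h] at this; simp at this
  exact mul_ne_zero (by simpa using this) (X_ne_zero _)

lemma Coc_of (b : Fin m → Fin m → Pol n) (hanti : ∀ i j, b i j = - b j i)
    (hD : ∀ i j k, τ.A k * b i j + τ.A i * b j k + τ.A j * b k i = 0)
    (hJ : ∀ i j k, k ≠ i → k ≠ j → τ.XX k i (b k j) - τ.XX k j (b k i) = - (τ.se k * b i j)) : τ.Coc b := by
  have hself : ∀ i, b i i = 0 := fun i => by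
    have := hanti i i
    exact self_eq_neg.1 this
  intro i j k l
  unfold br dl
  by_cases hij : i = j
  · subst hij; simp [τ.XX_self, hself]
  by_cases hkl : k = l
  · subst hkl; simp [τ.XX_self, hself]; rw [hanti j k, hanti i k]; split_ifs <;> simp
  by_cases hik : i = k
  · subst hik
    have h := hJ j l i hij hkl
    simp only [if_true, hkl, Ne.symm hij, hself, if_false]
    rw [h, hanti l j]; ring
  by_cases hil : i = l
  · subst hil
    have h := hJ j k i hij hik
    simp only [if_true, hik, Ne.symm hij, hself, if_false]
    rw [hanti k i, map_neg, τ.XX_anti' k i]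
    linear_combination -h
  by_cases hjk : j = k
  · subst hjk
    have h := hJ i l j (Ne.symm hij) hkl
    simp only [if_true, hkl, hij, hil, hself, if_false]
    rw [hanti i j, map_neg, τ.XX_anti' i j]
    rw [hanti i l] at h
    linear_combination -h
  by_cases hjl : j = l
  · subst hjl
    have h := hJ i k j (Ne.symm hij) (Ne.symm hkl)
    simp only [if_true, hik, hij, hjk, hself, if_false]
    rw [hanti k j, hanti i j, map_neg, map_neg, τ.XX_anti' i j, τ.XX_anti' k j]
    linear_combination h
  simp only [hik, hil, hjk, hjl, if_false, mul_zero, zero_mul, add_zero, sub_zero]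
  have e1 := congrArg (τ.XX k l) (hD i j k)
  simp only [map_add, Derivation.leibniz, smul_eq_mul, map_zero, XX_A, dl, hik, hil, hjk, hjl, hkl,
    Ne.symm hik, Ne.symm hil, Ne.symm hjk, Ne.symm hjl, Ne.symm hkl, if_true, if_false] at e1
  have e2 := hJ j l k (Ne.symm hjk) hkl
  have e3 := hJ l i k hkl (Ne.symm hik)
  have e5 := hD i j l
  have eop : τ.A k * τ.XX i j (b k l) + τ.A i * τ.XX j k (b k l) + τ.A j * τ.XX k i (b k l) = 0 := by
    simp only [XX_apply]; ring
  rw [hanti k j, map_neg, τ.XX_anti' k j] at e2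
  apply mul_left_cancel₀ (τ.A_ne k)
  linear_combination eop - e1 + τ.A i * e2 + τ.A j * e3 - τ.se k * e5

lemma Coc_ker (hm : 3 ≤ m) (b : Fin m → Fin m → Pol n)
    (hanti : ∀ i j, b i j = - b j i)
    (hJ : ∀ i j k, k ≠ i → k ≠ j → τ.XX k i (b k j) - τ.XX k j (b k i) = - (τ.se k * b i j))
    (h0 : ∀ i j, τ.Cas (b i j) = 0) (i j : Fin m) : b i j = 0 := by
  by_cases hij : i = j
  · subst hij; exact self_eq_neg.1 (hanti i i)
  obtain ⟨k, hk⟩ : ∃ k : Fin m, k ≠ i ∧ k ≠ j := by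
    have : ({i, j} : Finset (Fin m)).card < (univ : Finset (Fin m)).card := by
      rw [Finset.card_univ, Fintype.card_fin]
      exact lt_of_le_of_lt Finset.card_le_two (by omega)
    obtain ⟨k, -, hk⟩ := Finset.exists_mem_notMem_of_card_lt_card this
    exact ⟨k, by simpa using hk⟩
  have h := hJ i j k hk.1 hk.2
  rw [τ.XX_of_Cas (h0 _ _), τ.XX_of_Cas (h0 _ _), sub_zero] at h
  have h2 := τ.se_sq k
  linear_combination τ.se k * h - b i j * h2

lemma y_solve (hm : 3 ≤ m) {d : ℕ} (b : Fin m → Fin m → Pol n) (hb : ∀ i j, (b i j).IsHomogeneous d)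
    (hanti : ∀ i j, b i j = - b j i)
    (hD : ∀ i j k, τ.A k * b i j + τ.A i * b j k + τ.A j * b k i = 0)
    (hJ : ∀ i j k, k ≠ i → k ≠ j → τ.XX k i (b k j) - τ.XX k j (b k i) = - (τ.se k * b i j)) :
    ∃ v : Pol n, v.IsHomogeneous d ∧ τ.Perp d v ∧ ∀ k l, b k l = τ.XX k l v := by
  have hc := τ.Coc_of b hanti hD hJ
  have hcod : (τ.cod b).IsHomogeneous d := by
    unfold cod
    apply IsHomogeneous.C_mul
    refine IsHomogeneous.sum _ _ _ fun k _ => IsHomogeneous.sum _ _ _ fun l _ => ?_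
    rw [mul_assoc]
    exact τ.se_homog (τ.se_homog (τ.XX_homog (hb _ _) _ _) _) _
  obtain ⟨w0, v, h1, h2, h3, h4, h5⟩ := (τ.Cas_gap hm d).1 _ hcod
  refine ⟨v, h2, h4, fun k l => ?_⟩
  have := τ.Coc_ker hm (fun i j => b i j - τ.XX i j v) (fun i j => by rw [hanti i j, τ.XX_anti' i j]; ring)
    (fun i j k hi hj => by
      have e1 := hJ i j k hi hj
      have e2 := τ.comm k i k j v
      unfold br dl at e2
      simp only [if_true, hi, hj, Ne.symm hi, τ.XX_self, if_false] at e2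
      rw [τ.XX_anti' j i] at e2
      simp only [map_sub, Derivation.coe_zero, Pi.zero_apply] at e2 ⊢
      linear_combination e1 - e2)
    (fun i j => by
      rw [map_sub, τ.Cas_coc hc, h5, map_add, τ.XX_of_Cas h3, τ.Cas_XX]; ring) k l
  linear_combination this

lemma y_bound (hm : 3 ≤ m) {d : ℕ} {v : Pol n} (hv : v.IsHomogeneous d) (hp : τ.Perp d v) :
    4 * fis v v ≤ ∑ k, ∑ l, fis (τ.XX k l v) (τ.XX k l v) := by
  have h := (τ.Cas_gap hm d).2 v hv hp
  rw [fis_Cas] at h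
  linarith

/-- orthogonal projection away from the kernel -/
lemma y_proj (hm : 3 ≤ m) {d : ℕ} {v : Pol n} (hv : v.IsHomogeneous d) :
    ∃ w : Pol n, w.IsHomogeneous d ∧ τ.Perp d w ∧ ∀ k l, τ.XX k l w = τ.XX k l v := by
  obtain ⟨w0, u, h1, h2, h3, h4, h5⟩ := (τ.Cas_gap hm d).1 v hv
  refine ⟨τ.Cas u, τ.Cas_homog h2, fun g _ hg => τ.fis_Cas_ker hg, fun k l => ?_⟩
  rw [h5, map_add, τ.XX_of_Cas h3, zero_add]

end Top

end NambuLin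


namespace NambuLin

open MvPolynomial Finset
open scoped Nat

/-- tensors, given by components -/
abbrev Ten (R : Type*) (n q : ℕ) := (Fin q → Fin n) → R

section ten
variable {R : Type*} [CommRing R] {n q : ℕ}

/-- the action of a matrix on a tensor -/
def act (A : Matrix (Fin n) (Fin n) R) (w : Ten R n q) : Ten R n q :=
  fun j => ∑ i : Fin q → Fin n, (∏ a, A (j a) (i a)) * w i

lemma act_one (w : Ten R n q) : act 1 w = w := by
  funext j
  unfold act
  rw [Finset.sum_eq_single j]
  · simp
  · intro i _ hij
    obtain ⟨a, ha⟩ := Function.ne_iff.1 hij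
    have h0 : (1 : Matrix (Fin n) (Fin n) R) (j a) (i a) = 0 := Matrix.one_apply_ne (Ne.symm ha)
    rw [Finset.prod_eq_zero (mem_univ a) h0, zero_mul]
  · simp

lemma act_mul (A B : Matrix (Fin n) (Fin n) R) (w : Ten R n q) : act (A * B) w = act A (act B w) := by
  funext j
  unfold act
  simp_rw [Matrix.mul_apply, Finset.prod_univ_sum, Finset.mul_sum, Finset.sum_mul]
  rw [Finset.sum_comm]
  simp only [Fintype.piFinset_univ]
  apply Finset.sum_congr rfl; intro i _
  apply Finset.sum_congr rfl; intro k _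
  rw [Finset.prod_mul_distrib]; ring

lemma act_add (A : Matrix (Fin n) (Fin n) R) (w v : Ten R n q) : act A (w + v) = act A w + act A v := by
  funext j; simp [act, mul_add, Finset.sum_add_distrib]

lemma act_zero (A : Matrix (Fin n) (Fin n) R) : act A (0 : Ten R n q) = 0 := by
  funext j; simp [act]

lemma act_smul (A : Matrix (Fin n) (Fin n) R) (c : R) (w : Ten R n q) : act A (c • w) = c • act A w := by
  funext j; simp [act, Finset.mul_sum, mul_left_comm]

lemma act_sum {ι : Type*} (s : Finset ι) (A : Matrix (Fin n) (Fin n) R) (w : ι → Ten R n q) :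
    act A (∑ i ∈ s, w i) = ∑ i ∈ s, act A (w i) := by
  classical
  induction s using Finset.induction_on with
  | empty => simp [act_zero]
  | insert a s ha ih => rw [Finset.sum_insert ha, Finset.sum_insert ha, act_add, ih]

/-- alternating tensors -/
def IsAlt (w : Ten R n q) : Prop := ∀ (j : Fin q → Fin n) (σ : Equiv.Perm (Fin q)),
  w (j ∘ σ) = ((Equiv.Perm.sign σ : ℤ) : R) * w j

lemma IsAlt.add {w v : Ten R n q} (hw : IsAlt w) (hv : IsAlt v) : IsAlt (w + v) := by
  intro j σ; simp only [Pi.add_apply]; rw [hw, hv]; ring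

lemma IsAlt.sub {w v : Ten R n q} (hw : IsAlt w) (hv : IsAlt v) : IsAlt (w - v) := by
  intro j σ; simp only [Pi.sub_apply]; rw [hw, hv]; ring

lemma IsAlt.zero : IsAlt (0 : Ten R n q) := by intro j σ; simp

lemma IsAlt.smul {w : Ten R n q} (hw : IsAlt w) (c : R) : IsAlt (c • w) := by
  intro j σ; simp only [Pi.smul_apply, smul_eq_mul]; rw [hw]; ring

lemma IsAlt.sum {ι : Type*} (s : Finset ι) {w : ι → Ten R n q} (hw : ∀ i ∈ s, IsAlt (w i)) :
    IsAlt (∑ i ∈ s, w i) := by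
  intro j σ
  simp only [Finset.sum_apply, Finset.mul_sum]
  exact Finset.sum_congr rfl fun i hi => hw i hi j σ

lemma IsAlt.act {w : Ten R n q} (hw : IsAlt w) (A : Matrix (Fin n) (Fin n) R) : IsAlt (act A w) := by
  intro j σ
  unfold NambuLin.act
  rw [Finset.mul_sum]
  rw [← (Equiv.arrowCongr σ.symm (Equiv.refl (Fin n))).sum_comp]
  apply Finset.sum_congr rfl; intro i _
  have : (Equiv.arrowCongr σ.symm (Equiv.refl (Fin n))) i = i ∘ σ := by
    funext a; simp [Equiv.arrowCongr]
  rw [this, hw]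
  have h2 : ∏ a, A ((j ∘ σ) a) ((i ∘ σ) a) = ∏ a, A (j a) (i a) :=
    Equiv.prod_comp σ (fun a => A (j a) (i a))
  rw [h2]; ring

lemma IsAlt.eq_zero [IsDomain R] [CharZero R] {w : Ten R n q} (hw : IsAlt w) {j : Fin q → Fin n}
    (hj : ¬ Function.Injective j) : w j = 0 := by
  simp only [Function.Injective, not_forall] at hj
  obtain ⟨a, b, hab, hne⟩ := hj
  have h := hw j (Equiv.swap a b)
  have h2 : j ∘ Equiv.swap a b = j := by
    funext c
    simp only [Function.comp]
    rcases eq_or_ne c a with rfl | hca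
    · rw [Equiv.swap_apply_left, hab]
    rcases eq_or_ne c b with rfl | hcb
    · rw [Equiv.swap_apply_right, hab]
    rw [Equiv.swap_apply_of_ne_of_ne hca hcb]
  rw [h2, Equiv.Perm.sign_swap hne] at h
  simp at h
  exact self_eq_neg.1 h

/-- decomposable tensors -/
def dt (E : Matrix (Fin n) (Fin q) R) : Ten R n q := fun j => (E.submatrix j id).det

lemma dt_alt (E : Matrix (Fin n) (Fin q) R) : IsAlt (dt E) := by
  intro j σ
  unfold dt
  rw [← Matrix.det_permute σ (E.submatrix j id)]
  rfl

lemma act_dt (A : Matrix (Fin n) (Fin n) R) (E : Matrix (Fin n) (Fin q) R) : act A (dt E) = dt (A * E) := by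
  funext j
  unfold act dt
  have h := (Matrix.detRowAlternating (R := R) (n := Fin q)).toMultilinearMap.map_sum
    (fun a (l : Fin n) => A (j a) l • E l)
  have h1 : ((A * E).submatrix j id).det =
      (Matrix.detRowAlternating (R := R) (n := Fin q)).toMultilinearMap (fun a => ∑ l, A (j a) l • E l) := by
    change Matrix.det _ = Matrix.det _
    congr 1
    ext a b
    simp only [Matrix.submatrix_apply, Matrix.mul_apply, id]
    rw [Finset.sum_apply]
    rfl
  rw [h1, h]
  apply Finset.sum_congr rfl; intro i _
  rw [MultilinearMap.map_smul_univ]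
  rfl

lemma det_updateRow_lin {ι : Type*} (M : Matrix (Fin q) (Fin q) R) (p : Fin q) (s : Finset ι) (c : ι → R)
    (v : ι → Fin q → R) : (M.updateRow p (∑ b ∈ s, c b • v b)).det = ∑ b ∈ s, c b * (M.updateRow p (v b)).det := by
  classical
  induction s using Finset.induction_on with
  | empty =>
    rw [Finset.sum_empty, Finset.sum_empty]
    exact Matrix.det_eq_zero_of_row_eq_zero p (fun j => by simp)
  | insert a s ha ih =>
    rw [Finset.sum_insert ha, Finset.sum_insert ha, Matrix.det_updateRow_add, Matrix.det_updateRow_smul, ih]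

/-- Plücker exchange relation -/
lemma dt_plucker (E : Matrix (Fin n) (Fin q) R) (i j : Fin q → Fin n) (p : Fin q) :
    dt E i * dt E j = ∑ b, dt E (Function.update i p (j b)) * dt E (Function.update j b (i p)) := by
  have h := Matrix.mulVec_cramer (E.submatrix j id).transpose (E (i p))
  have e1 : ∀ b, Matrix.cramer (E.submatrix j id).transpose (E (i p)) b = dt E (Function.update j b (i p)) := by
    intro b
    rw [Matrix.cramer_apply, dt, ← Matrix.det_transpose]
    congr 1
    ext a c
    simp only [Matrix.transpose_apply, Matrix.updateCol_apply, Matrix.submatrix_apply, id, Function.update_apply]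
    split_ifs <;> rfl
  have e2 : dt E j • E (i p) = ∑ b, dt E (Function.update j b (i p)) • E (j b) := by
    funext c
    have := congrFun h c
    simp only [Matrix.mulVec, dotProduct, Matrix.transpose_apply, Matrix.submatrix_apply, id, e1,
      Matrix.det_transpose, Pi.smul_apply, smul_eq_mul] at this
    simp only [Pi.smul_apply, smul_eq_mul, Finset.sum_apply]
    rw [dt, ← this]
    exact Finset.sum_congr rfl fun b _ => mul_comm _ _
  have e3 : ∀ b, dt E (Function.update i p (j b)) =
      (Matrix.updateRow (E.submatrix i id) p (E (j b))).det := by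
    intro b
    unfold dt
    congr 1
    ext a c
    simp only [Matrix.updateRow_apply, Matrix.submatrix_apply, id, Function.update_apply]
    split_ifs <;> rfl
  have e4 : (E.submatrix i id) = Matrix.updateRow (E.submatrix i id) p (E (i p)) := by
    ext a c
    simp only [Matrix.updateRow_apply, Matrix.submatrix_apply, id]
    split_ifs with h
    · rw [h]
    · rfl
  calc dt E i * dt E j = dt E j * (Matrix.updateRow (E.submatrix i id) p (E (i p))).det := by
        rw [← e4, mul_comm]; rfl
    _ = (Matrix.updateRow (E.submatrix i id) p (dt E j • E (i p))).det := by
        rw [Matrix.det_updateRow_smul]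
    _ = _ := by
        rw [e2]
        refine (det_updateRow_lin _ p univ _ (fun b => E (j b))).trans ?_
        exact Finset.sum_congr rfl fun b _ => by rw [e3, mul_comm]

end ten

end NambuLin


namespace NambuLin

open MvPolynomial Finset
open scoped Nat

section coef
variable {R : Type*} [CommRing R] {n q : ℕ}

lemma sgn_swap {w : Ten R n q} (hw : IsAlt w) {f : Fin (q+1) → Fin n} {i k : Fin (q+1)} (hik : i ≠ k)
    (hf : f i = f k) :
    (-1 : R) ^ (k : ℕ) * w (f ∘ k.succAbove) = - ((-1) ^ (i : ℕ) * w (f ∘ i.succAbove)) := by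
  let ρ : Equiv.Perm (Fin (q+1)) := k.cycleRange * Equiv.swap i k * (i.cycleRange)⁻¹
  have hρ0 : ρ 0 = 0 := by
    simp only [ρ, Equiv.Perm.mul_apply]
    have : (i.cycleRange)⁻¹ 0 = i := Fin.cycleRange_symm_zero i
    rw [this, Equiv.swap_apply_left, Fin.cycleRange_self]
  obtain ⟨⟨p, σ⟩, hσ⟩ := Equiv.Perm.decomposeFin.symm.surjective ρ
  have hp : p = 0 := by
    rw [← hρ0, ← hσ, Equiv.Perm.decomposeFin_symm_apply_zero]
  subst hp
  have hsucc : ∀ x : Fin q, ρ x.succ = (σ x).succ := by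
    intro x; rw [← hσ, Equiv.Perm.decomposeFin_symm_apply_succ]; simp
  have hsign : Equiv.Perm.sign σ = - ((-1) ^ (k : ℕ) * (-1) ^ (i : ℕ)) := by
    have h1 : Equiv.Perm.sign ρ = Equiv.Perm.sign σ := by
      rw [← hσ, Equiv.Perm.decomposeFin.symm_sign]; simp
    rw [← h1]
    simp only [ρ, Equiv.Perm.sign_mul, Equiv.Perm.sign_inv, Fin.sign_cycleRange, Equiv.Perm.sign_swap hik]
    simp
  have hfs : ∀ x, f (Equiv.swap i k x) = f x := by
    intro x
    rcases eq_or_ne x i with rfl | h1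
    · rw [Equiv.swap_apply_left, hf]
    rcases eq_or_ne x k with rfl | h2
    · rw [Equiv.swap_apply_right, hf]
    rw [Equiv.swap_apply_of_ne_of_ne h1 h2]
  have hcomp : f ∘ i.succAbove = (f ∘ k.succAbove) ∘ σ := by
    funext x
    simp only [Function.comp]
    rw [← Fin.cycleRange_symm_succ k, ← hsucc x, ← Fin.cycleRange_symm_succ i]
    simp only [ρ, Equiv.Perm.mul_apply]
    rw [Equiv.symm_apply_apply, hfs]
    rfl
  rw [hcomp, hw, hsign]
  have hk : ((-1 : R) ^ (i : ℕ)) * (-1) ^ (i : ℕ) = 1 := by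
    rw [← mul_pow]; simp
  push_cast
  linear_combination - (-1 : R) ^ (k : ℕ) * w (f ∘ k.succAbove) * hk

variable (e : Fin (q+1) → Fin n)

/-- top coefficients of a tensor -/
def Ac (k : Fin (q+1)) (w : Ten R n q) : R := (-1) ^ (k : ℕ) * w (e ∘ k.succAbove)

/-- components of the contracted vector fields -/
def Bc (k i : Fin (q+1)) (p : Fin n) (w : Ten R n q) : R :=
  if k = i then 0 else (-1) ^ (k : ℕ) * w (Function.update e i p ∘ k.succAbove)

lemma update_comp_succAbove (f : Fin (q+1) → Fin n) (k : Fin (q+1)) (p : Fin n) :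
    Function.update f k p ∘ k.succAbove = f ∘ k.succAbove := by
  funext x
  simp [Function.comp, Function.update_of_ne (Fin.succAbove_ne k x)]

lemma Bc_anti {w : Ten R n q} (hw : IsAlt w) (k i : Fin (q+1)) (p : Fin n) : Bc e k i p w = - Bc e i k p w := by
  unfold Bc
  by_cases h : k = i
  · simp [h]
  rw [if_neg h, if_neg (Ne.symm h)]
  have := sgn_swap hw (f := Function.update (Function.update e i p) k p) (Ne.symm h) (by simp [Function.update_apply])
  rw [update_comp_succAbove, Function.update_comm (Ne.symm h), update_comp_succAbove] at this
  exact this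

lemma Bc_i (w : Ten R n q) {k i : Fin (q+1)} (h : k ≠ i) : Bc e k i (e i) w = Ac e k w := by
  unfold Bc Ac; rw [if_neg h, Function.update_eq_self]

lemma Bc_k {w : Ten R n q} (hw : IsAlt w) {k i : Fin (q+1)} (h : k ≠ i) : Bc e k i (e k) w = - Ac e i w := by
  rw [Bc_anti e hw, Bc_i e w h.symm]

lemma Bc_l [IsDomain R] [CharZero R] {w : Ten R n q} (hw : IsAlt w) {k i l : Fin (q+1)} (hk : l ≠ k) (hi : l ≠ i) :
    Bc e k i (e l) w = 0 := by
  unfold Bc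
  split_ifs with h
  · rfl
  rw [hw.eq_zero, mul_zero]
  intro hinj
  obtain ⟨a, ha⟩ := Fin.exists_succAbove_eq hk
  obtain ⟨b, hb⟩ := Fin.exists_succAbove_eq (Ne.symm h)
  have : a = b := hinj (by simp [ha, hb, Function.update_of_ne hi])
  subst this
  exact hi (ha.symm.trans hb)

/-- an alternating tensor is determined by its top coefficients -/
lemma ten_ext0 [IsDomain R] [CharZero R] {w : Ten R n q} (hw : IsAlt w)
    (hA : ∀ k, Ac e k w = 0) (hB : ∀ k i p, p ∉ Set.range e → Bc e k i p w = 0)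
    (h2 : ∀ j : Fin q → Fin n, ∀ a b, a ≠ b → j a ∉ Set.range e → j b ∉ Set.range e → w j = 0) : w = 0 := by
  have hA' : ∀ k : Fin (q+1), w (e ∘ k.succAbove) = 0 := by
    intro k
    have := hA k
    unfold Ac at this
    exact (mul_eq_zero.1 this).resolve_left (by simp)
  have hB' : ∀ (k i : Fin (q+1)) p, k ≠ i → p ∉ Set.range e → w (Function.update e i p ∘ k.succAbove) = 0 := by
    intro k i p hki hp
    have := hB k i p hp
    unfold Bc at this
    rw [if_neg hki] at this
    exact (mul_eq_zero.1 this).resolve_left (by simp)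
  have key : ∀ (g : Fin q → Fin (q+1)), Function.Injective g → ∀ k, (∀ a, g a ≠ k) →
      ∃ σ : Equiv.Perm (Fin q), g = k.succAbove ∘ σ := by
    intro g hg k hk
    choose s hs using fun a => Fin.exists_succAbove_eq (hk a)
    have hsi : Function.Injective s := fun a b hab => hg (by rw [← hs a, ← hs b, hab])
    exact ⟨Equiv.ofBijective s (Finite.injective_iff_bijective.1 hsi), funext fun a => (hs a).symm⟩
  funext j
  by_cases hj : Function.Injective j
  swap
  · exact hw.eq_zero hj
  by_cases hall : ∀ a, j a ∈ Set.range e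
  · choose g hg using hall
    have hgi : Function.Injective g := fun a b hab => hj (by rw [← hg a, ← hg b, hab])
    obtain ⟨k, hk⟩ : ∃ k, ∀ a, g a ≠ k := by
      by_contra hcon
      push Not at hcon
      have := Fintype.card_le_of_surjective g hcon
      simp at this
    obtain ⟨σ, hσ⟩ := key g hgi k hk
    have : j = (e ∘ k.succAbove) ∘ σ := by
      funext a; rw [← hg a, hσ]; rfl
    rw [this, hw, hA']; simp
  · push Not at hall
    obtain ⟨a, ha⟩ := hall
    by_cases hb : ∃ b, b ≠ a ∧ j b ∉ Set.range e
    · obtain ⟨b, hba, hb⟩ := hb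
      exact h2 j b a hba hb ha
    push Not at hb
    have hex : ∀ b, ∃ l, b ≠ a → e l = j b := by
      intro b
      by_cases hba : b = a
      · exact ⟨0, fun h => absurd hba h⟩
      · obtain ⟨l, hl⟩ := hb b hba
        exact ⟨l, fun _ => hl⟩
    choose g0 hg0 using hex
    -- two missing indices
    have hcard : ((univ.erase a).image g0).card ≤ q - 1 := by
      refine Finset.card_image_le.trans ?_
      rw [Finset.card_erase_of_mem (mem_univ _), Finset.card_univ, Fintype.card_fin]
    have hq : 0 < q := a.pos
    have hcompl : 1 < (((univ.erase a).image g0)ᶜ).card := by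
      rw [Finset.card_compl, Fintype.card_fin]; omega
    obtain ⟨i, hi, k, hk, hik⟩ := Finset.one_lt_card.1 hcompl
    simp only [mem_compl, mem_image, mem_erase, mem_univ, and_true, not_exists, not_and] at hi hk
    let g := Function.update g0 a i
    have hga : g a = i := by simp [g]
    have hgb : ∀ b, b ≠ a → g b = g0 b := fun b hb => by simp [g, hb]
    have hgi : Function.Injective g := by
      intro b c hbc
      by_cases hb' : b = a
      · by_cases hc' : c = a
        · rw [hb', hc']
        · rw [hb', hga, hgb c hc'] at hbc
          exact absurd hbc.symm (hi c hc')
      · by_cases hc' : c = a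
        · rw [hc', hga, hgb b hb'] at hbc
          exact absurd hbc (hi b hb')
        · rw [hgb b hb', hgb c hc'] at hbc
          exact hj (by rw [← hg0 b hb', ← hg0 c hc', hbc])
    have hgk : ∀ b, g b ≠ k := by
      intro b
      by_cases hb' : b = a
      · rw [hb', hga]; exact hik
      · rw [hgb b hb']; exact hk b hb'
    obtain ⟨σ, hσ⟩ := key g hgi k hgk
    have : j = (Function.update e i (j a) ∘ k.succAbove) ∘ σ := by
      funext b
      have h1 : ((Function.update e i (j a) ∘ k.succAbove) ∘ σ) b = Function.update e i (j a) (g b) := by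
        rw [hσ]; rfl
      rw [h1]
      by_cases hb' : b = a
      · rw [hb', hga]; simp
      · rw [hgb b hb', Function.update_of_ne (hi b hb'), hg0 b hb']
    rw [this, hw, hB' k i _ (Ne.symm hik) ha]; simp

end coef

section toT
variable {n q : ℕ}

/-- the coordinate matrix of a multi-index -/
def eI {R : Type*} [CommRing R] (t : Fin q → Fin n) : Matrix (Fin n) (Fin q) R := fun i b => if i = t b then 1 else 0

/-- the tensor of a multivector -/
noncomputable def toT (w : MultiVec n q) : Ten ℝ n q := ∑ I : Idx n q, w I • dt (eI (I.1.orderEmbOfFin I.2))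

lemma toT_alt (w : MultiVec n q) : IsAlt (toT w) := IsAlt.sum _ fun _ _ => (dt_alt _).smul _

lemma act_toT (A : Matrix (Fin n) (Fin n) ℝ) (w : MultiVec n q) (J : Idx n q) :
    act A (toT w) (J.1.orderEmbOfFin J.2) = extPow n q A w J := by
  unfold toT extPow
  rw [act_sum, Finset.sum_apply]
  apply Finset.sum_congr rfl; intro I _
  rw [act_smul, act_dt, Pi.smul_apply, smul_eq_mul, mul_comm]
  congr 1
  unfold dt
  congr 1
  ext a b
  simp [Matrix.mul_apply, eI]

lemma extPow_one (w : MultiVec n q) : extPow n q 1 w = w := by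
  funext J
  unfold extPow
  rw [Finset.sum_eq_single J]
  · rw [Matrix.submatrix_one _ (J.1.orderEmbOfFin J.2).injective]; simp
  · intro I _ hIJ
    have : ∃ a, J.1.orderEmbOfFin J.2 a ∉ I.1 := by
      by_contra hcon
      push Not at hcon
      apply hIJ
      apply Subtype.ext
      symm
      apply Finset.eq_of_subset_of_card_le
      · intro x hx
        have : x ∈ Set.range (J.1.orderEmbOfFin J.2) := by
          rw [Finset.range_orderEmbOfFin]; exact hx
        obtain ⟨a, rfl⟩ := this
        exact hcon a
      · rw [I.2, J.2]
    obtain ⟨a, ha⟩ := this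
    rw [Matrix.det_eq_zero_of_row_eq_zero a, zero_mul]
    intro b
    rw [Matrix.submatrix_apply, Matrix.one_apply_ne]
    intro h
    exact ha (h ▸ Finset.orderEmbOfFin_mem I.1 I.2 b)
  · simp

lemma toT_sorted (w : MultiVec n q) (J : Idx n q) : toT w (J.1.orderEmbOfFin J.2) = w J := by
  have := act_toT 1 w J
  rw [act_one, extPow_one] at this
  exact this

lemma alt_ext {w v : Ten ℝ n q} (hw : IsAlt w) (hv : IsAlt v)
    (h : ∀ J : Idx n q, w (J.1.orderEmbOfFin J.2) = v (J.1.orderEmbOfFin J.2)) : w = v := by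
  funext j
  by_cases hj : Function.Injective j
  swap
  · rw [hw.eq_zero hj, hv.eq_zero hj]
  let J : Idx n q := ⟨univ.image j, by rw [Finset.card_image_of_injective _ hj]; simp⟩
  have hex : ∀ a, ∃ b, J.1.orderEmbOfFin J.2 b = j a := by
    intro a
    have : j a ∈ Set.range (J.1.orderEmbOfFin J.2) := by
      rw [Finset.range_orderEmbOfFin]; simp [J]
    exact this
  choose s hs using hex
  have hsi : Function.Injective s := fun a b hab => hj (by rw [← hs a, ← hs b, hab])
  have hjs : j = (J.1.orderEmbOfFin J.2) ∘ (Equiv.ofBijective s (Finite.injective_iff_bijective.1 hsi)) :=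
    funext fun a => (hs a).symm
  rw [hjs, hw, hv, h J]

lemma toT_extPow (A : Matrix (Fin n) (Fin n) ℝ) (w : MultiVec n q) : toT (extPow n q A w) = act A (toT w) :=
  alt_ext (toT_alt _) ((toT_alt _).act A) fun J => by rw [toT_sorted, act_toT]

lemma toT_smul_single (w : MultiVec n q) (I : Idx n q) (h : ∀ J, J ≠ I → w J = 0) :
    toT w = w I • dt (eI (I.1.orderEmbOfFin I.2)) := by
  unfold toT
  rw [Finset.sum_eq_single I]
  · intro J _ hJ; rw [h J hJ, zero_smul]
  · simp

end toT

end NambuLin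


namespace NambuLin

open MvPolynomial Finset
open scoped Nat

lemma dt_eI_self {R : Type*} [CommRing R] {n q : ℕ} {t : Fin q → Fin n} (ht : Function.Injective t) :
    dt (eI (R := R) t) t = 1 := by
  unfold dt
  have : (eI (R := R) t).submatrix t id = 1 := by
    ext a b
    simp [eI, Matrix.one_apply, ht.eq_iff]
  rw [this, Matrix.det_one]

lemma dt_eI_zero {R : Type*} [CommRing R] {n q : ℕ} {t j : Fin q → Fin n} (a : Fin q) (h : ∀ b, j a ≠ t b) :
    dt (eI (R := R) t) j = 0 := by
  unfold dt
  apply Matrix.det_eq_zero_of_row_eq_zero a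
  intro b
  simp [eI, h b]

namespace Top

variable {n q : ℕ} (τ : Top n (q+1))

/-- the model tensor -/
noncomputable def P0 : Ten (Pol n) n q := ∑ k : Fin (q+1), ((-1) ^ (k : ℕ) * τ.A k) • dt (eI (τ.e ∘ k.succAbove))

lemma P0_alt : IsAlt τ.P0 := IsAlt.sum _ fun _ _ => (dt_alt _).smul _

lemma Ac_P0 (k : Fin (q+1)) : Ac τ.e k τ.P0 = τ.A k := by
  unfold Ac P0
  rw [Finset.sum_apply, Finset.sum_eq_single k]
  · rw [Pi.smul_apply, dt_eI_self (τ.inj.comp Fin.succAbove_right_injective), smul_eq_mul, mul_one, ← mul_assoc,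
      ← mul_pow]
    simp
  · intro l _ hl
    obtain ⟨a, ha⟩ := Fin.exists_succAbove_eq hl
    rw [Pi.smul_apply, dt_eI_zero a, smul_zero]
    intro b hb
    simp only [Function.comp, ha] at hb
    exact Fin.succAbove_ne l b (τ.inj hb).symm
  · simp

lemma P0_nontop {j : Fin q → Fin n} (a : Fin q) (h : j a ∉ Set.range τ.e) : τ.P0 j = 0 := by
  unfold P0
  rw [Finset.sum_apply]
  apply Finset.sum_eq_zero; intro k _
  rw [Pi.smul_apply, dt_eI_zero a, smul_zero]
  intro b hb
  exact h ⟨_, hb.symm⟩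

lemma P0_homog (j : Fin q → Fin n) : (τ.P0 j).IsHomogeneous 1 := by
  unfold P0
  rw [Finset.sum_apply]
  apply IsHomogeneous.sum; intro k _
  rw [Pi.smul_apply, smul_eq_mul]
  have h1 : ((-1 : Pol n) ^ (k : ℕ)) = C ((-1) ^ (k:ℕ)) := by simp
  have h2 : dt (eI (R := Pol n) (τ.e ∘ k.succAbove)) j = C (dt (eI (R := ℝ) (τ.e ∘ k.succAbove)) j) := by
    unfold dt
    rw [RingHom.map_det]
    congr 1
    ext a b
    simp only [eI, RingHom.mapMatrix_apply, Matrix.map_apply, Matrix.submatrix_apply]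
    split_ifs <;> simp
  rw [h1, h2, A]
  have h := ((((isHomogeneous_X ℝ (τ.e k)).C_mul (τ.s k)).C_mul ((-1) ^ (k:ℕ))).C_mul
    (dt (eI (R := ℝ) (τ.e ∘ k.succAbove)) j))
  convert h using 1; ring

lemma Bc_P0 {k i : Fin (q+1)} (h : k ≠ i) (l : Fin n) : Bc τ.e k i l τ.P0 =
    (if l = τ.e i then τ.A k else 0) - (if l = τ.e k then τ.A i else 0) := by
  by_cases hl : l ∈ Set.range τ.e
  · obtain ⟨l, rfl⟩ := hl
    simp only [τ.inj.eq_iff]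
    by_cases hi : l = i
    · subst hi
      rw [Bc_i _ _ h, Ac_P0]; simp [h.symm]
    by_cases hk : l = k
    · subst hk
      rw [Bc_k _ τ.P0_alt h, Ac_P0]; simp [h]
    rw [Bc_l _ τ.P0_alt hk hi]; simp [hi, hk]
  · have h1 : l ≠ τ.e i := fun h => hl ⟨i, h.symm⟩
    have h2 : l ≠ τ.e k := fun h => hl ⟨k, h.symm⟩
    rw [if_neg h1, if_neg h2, Bc, if_neg h]
    obtain ⟨a, ha⟩ := Fin.exists_succAbove_eq h.symm
    rw [τ.P0_nontop a, mul_zero, sub_zero]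
    simpa [ha] using hl

lemma sum_Bc_P0 (k i : Fin (q+1)) (f : Pol n) : ∑ l, Bc τ.e k i l τ.P0 * pderiv l f = τ.XX k i f := by
  by_cases h : k = i
  · subst h; simp [Bc, XX_self]
  · simp_rw [τ.Bc_P0 h, sub_mul, Finset.sum_sub_distrib, ite_mul, zero_mul]
    simp [XX_apply, d]

lemma update_comp_succAbove' (f : Fin (q+1) → Fin n) (k : Fin (q+1)) (a : Fin q) (p : Fin n) :
    Function.update (f ∘ k.succAbove) a p = Function.update f (k.succAbove a) p ∘ k.succAbove := by
  rw [Function.update_comp_eq_of_injective _ Fin.succAbove_right_injective]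

/-- the Lie derivative of the model tensor -/
noncomputable def LZ (Z : Fin n → Pol n) : Ten (Pol n) n q := fun j =>
  ∑ i, Z i * pderiv i (τ.P0 j) - ∑ a, ∑ l, pderiv l (Z (j a)) * τ.P0 (Function.update j a l)

lemma LZ_alt (Z : Fin n → Pol n) : IsAlt (τ.LZ Z) := by
  intro j σ
  unfold LZ
  have h1 : ∀ i, Z i * pderiv i (τ.P0 (j ∘ σ)) = ((Equiv.Perm.sign σ : ℤ) : Pol n) * (Z i * pderiv i (τ.P0 j)) := by
    intro i
    rw [τ.P0_alt, Derivation.leibniz, Derivation.map_intCast]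
    simp only [smul_eq_mul]; ring
  have h2 : ∑ a, ∑ l, pderiv l (Z ((j ∘ σ) a)) * τ.P0 (Function.update (j ∘ σ) a l) =
      ((Equiv.Perm.sign σ : ℤ) : Pol n) * ∑ a, ∑ l, pderiv l (Z (j a)) * τ.P0 (Function.update j a l) := by
    rw [← Equiv.sum_comp σ (fun a => ∑ l, pderiv l (Z (j a)) * τ.P0 (Function.update j a l)), Finset.mul_sum]
    apply Finset.sum_congr rfl; intro a _
    rw [Finset.mul_sum]
    apply Finset.sum_congr rfl; intro l _
    have : Function.update (j ∘ σ) a l = Function.update j (σ a) l ∘ σ := by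
      rw [Function.update_comp_eq_of_injective _ σ.injective]
    rw [this, τ.P0_alt]
    simp only [Function.comp]; ring
  rw [h2]
  simp_rw [h1]
  rw [← Finset.mul_sum]; ring

lemma Ac_LZ (Z : Fin n → Pol n) (k : Fin (q+1)) :
    Ac τ.e k (τ.LZ Z) = τ.T (fun i => τ.se i * Z (τ.e i)) k := by
  have h1 : (-1 : Pol n) ^ (k : ℕ) * ∑ i, Z i * pderiv i (τ.P0 (τ.e ∘ k.succAbove)) = τ.se k * Z (τ.e k) := by
    have e1 : ∀ i, (-1 : Pol n) ^ (k : ℕ) * (Z i * pderiv i (τ.P0 (τ.e ∘ k.succAbove))) = Z i * pderiv i (τ.A k) := by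
      intro i
      rw [← τ.Ac_P0 k, Ac, Derivation.leibniz]
      have : pderiv i ((-1 : Pol n) ^ (k : ℕ)) = 0 := by
        have : ((-1 : Pol n) ^ (k : ℕ)) = C ((-1) ^ (k:ℕ)) := by simp
        rw [this, pderiv_C]
      rw [this]; simp only [smul_eq_mul]; ring
    rw [Finset.mul_sum]
    simp_rw [e1, A, pderiv_C_mul, pderiv_X, Pi.single_apply]
    rw [Finset.sum_eq_single (τ.e k)]
    · simp [se]; ring
    · intro b _ hb; simp [Ne.symm hb]
    · simp
  have h2 : (-1 : Pol n) ^ (k : ℕ) * ∑ a, ∑ l, pderiv l (Z ((τ.e ∘ k.succAbove) a)) *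
      τ.P0 (Function.update (τ.e ∘ k.succAbove) a l) = ∑ i, τ.XX k i (Z (τ.e i)) := by
    rw [Fin.sum_univ_succAbove _ k, XX_self, Finset.mul_sum]
    simp only [Derivation.coe_zero, Pi.zero_apply, zero_add]
    apply Finset.sum_congr rfl; intro a _
    rw [← τ.sum_Bc_P0, Finset.mul_sum]
    apply Finset.sum_congr rfl; intro l _
    rw [Bc, if_neg (Fin.succAbove_ne k a).symm, update_comp_succAbove']
    simp only [Function.comp]; ring
  unfold Ac LZ
  rw [mul_sub, h1, h2, T, S, sub_eq_add_neg, ← Finset.sum_neg_distrib]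
  congr 1
  apply Finset.sum_congr rfl; intro i _
  have h3 := τ.se_sq i
  rw [XX_se_mul, ← mul_assoc, h3, one_mul, ← τ.XX_anti']

lemma Bc_LZ (Z : Fin n → Pol n) (k i : Fin (q+1)) {p : Fin n} (hp : p ∉ Set.range τ.e) :
    Bc τ.e k i p (τ.LZ Z) = - τ.XX k i (Z p) := by
  by_cases h : k = i
  · subst h; simp [Bc, XX_self]
  obtain ⟨a, rfl⟩ := Fin.exists_succAbove_eq (Ne.symm h)
  rw [Bc, if_neg h, ← update_comp_succAbove']
  unfold LZ
  have h0 : τ.P0 (Function.update (τ.e ∘ k.succAbove) a p) = 0 := τ.P0_nontop a (by simpa using hp)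
  have h1 : ∀ b, b ≠ a → ∀ l, τ.P0 (Function.update (Function.update (τ.e ∘ k.succAbove) a p) b l) = 0 := by
    intro b hb l
    exact τ.P0_nontop a (by rw [Function.update_of_ne hb.symm]; simpa using hp)
  rw [h0, Finset.sum_eq_single (a := a) (s := univ)
    (f := fun a_1 => ∑ l, pderiv l (Z (Function.update (τ.e ∘ k.succAbove) a p a_1)) *
      τ.P0 (Function.update (Function.update (τ.e ∘ k.succAbove) a p) a_1 l))]
  · rw [← τ.sum_Bc_P0]
    simp only [map_zero, mul_zero, Finset.sum_const_zero, zero_sub, Function.update_self, Function.update_idem]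
    rw [mul_neg, Finset.mul_sum]
    congr 1
    apply Finset.sum_congr rfl; intro l _
    rw [Bc, if_neg h, ← update_comp_succAbove']; ring
  · intro b _ hb
    apply Finset.sum_eq_zero; intro l _
    rw [h1 b hb, mul_zero]
  · simp

lemma LZ_two (Z : Fin n → Pol n) {j : Fin q → Fin n} {a b : Fin q} (hab : a ≠ b) (ha : j a ∉ Set.range τ.e)
    (hb : j b ∉ Set.range τ.e) : τ.LZ Z j = 0 := by
  unfold LZ
  rw [τ.P0_nontop a ha]
  simp only [map_zero, mul_zero, Finset.sum_const_zero, zero_sub, neg_eq_zero]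
  apply Finset.sum_eq_zero; intro c _
  apply Finset.sum_eq_zero; intro l _
  by_cases hc : c = a
  · rw [τ.P0_nontop b (by rw [Function.update_of_ne (by rw [hc]; exact hab.symm)]; exact hb), mul_zero]
  · rw [τ.P0_nontop a (by rw [Function.update_of_ne (Ne.symm hc)]; exact ha), mul_zero]

end Top

end NambuLin


namespace NambuLin

open MvPolynomial Finset
open scoped Nat Topology

/-- polynomials vanishing to order `k` at the origin -/
noncomputable abbrev Ord (n k : ℕ) : Ideal (Pol n) := idealOfVars (Fin n) ℝ ^ k

section ord
variable {n : ℕ}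

lemma wt_one (α : Fin n →₀ ℕ) : Finsupp.weight 1 α = α.degree := by
  rw [Finsupp.degree_eq_weight_one]; rfl

lemma mem_ord {k : ℕ} {f : Pol n} : f ∈ Ord n k ↔ ∀ α, α.degree < k → coeff α f = 0 :=
  mem_pow_idealOfVars_iff' k f

lemma ord_mono {k l : ℕ} (h : k ≤ l) {f : Pol n} (hf : f ∈ Ord n l) : f ∈ Ord n k :=
  Ideal.pow_le_pow_right h hf

lemma ord_mul {k l : ℕ} {f g : Pol n} (hf : f ∈ Ord n k) (hg : g ∈ Ord n l) : f * g ∈ Ord n (k + l) := by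
  unfold Ord; rw [pow_add]; exact Ideal.mul_mem_mul hf hg

lemma ord_mul' {k l m : ℕ} (h : m ≤ k + l) {f g : Pol n} (hf : f ∈ Ord n k) (hg : g ∈ Ord n l) :
    f * g ∈ Ord n m := ord_mono h (ord_mul hf hg)

lemma ord_zero_mem (f : Pol n) : f ∈ Ord n 0 := by simp [Ord]

lemma ord_homog {k d : ℕ} (h : k ≤ d) {f : Pol n} (hf : f.IsHomogeneous d) : f ∈ Ord n k := by
  rw [mem_ord]
  intro α hα
  by_contra hc
  have := hf hc
  rw [wt_one] at this
  omega

lemma ord_homog_zero {d : ℕ} {f : Pol n} (hf : f.IsHomogeneous d) (h : f ∈ Ord n (d+1)) : f = 0 := by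
  ext α
  by_contra hc
  have h1 := hf hc
  rw [wt_one] at h1
  exact hc (mem_ord.1 h α (by omega))

lemma ord_pderiv {k : ℕ} (i : Fin n) {f : Pol n} (hf : f ∈ Ord n (k+1)) : pderiv i f ∈ Ord n k := by
  rw [mem_ord] at *
  intro α hα
  rw [coeff_pderiv, hf, zero_mul]
  rw [map_add]
  simpa using hα

lemma ord_pderiv' {k l : ℕ} (h : l ≤ k - 1) (i : Fin n) {f : Pol n} (hf : f ∈ Ord n k) : pderiv i f ∈ Ord n l := by
  cases k with
  | zero => simp at h; subst h; exact ord_zero_mem _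
  | succ k => exact ord_mono h (ord_pderiv i hf)

lemma ord_sub_homComp {k : ℕ} {f : Pol n} (hf : f ∈ Ord n k) : f - homogeneousComponent k f ∈ Ord n (k+1) := by
  rw [mem_ord] at *
  intro α hα
  rw [coeff_sub, coeff_homogeneousComponent]
  split_ifs with h
  · ring
  · rw [hf α (by omega)]; ring

lemma homComp_ord {k d : ℕ} (h : d < k) {f : Pol n} (hf : f ∈ Ord n k) : homogeneousComponent d f = 0 := by
  ext α
  rw [coeff_homogeneousComponent]
  split_ifs with h1
  · rw [mem_ord.1 hf α (by omega)]; simp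
  · simp

lemma bom_ord {k d : ℕ} (h : d < k) {f : Pol n} (hf : f ∈ Ord n k) : bom d f = 0 := by
  rw [← bom_homComp, homComp_ord h hf, bom_zero]

open Asymptotics Filter

lemma isBigO_pow_mono {k l : ℕ} (h : k ≤ l) : (fun x : Fin n → ℝ => ‖x‖ ^ l) =O[𝓝 0] (fun x => ‖x‖ ^ k) := by
  apply IsBigO.of_bound 1
  filter_upwards [Metric.ball_mem_nhds (0 : Fin n → ℝ) one_pos] with x hx
  simp only [Metric.mem_ball, dist_zero_right] at hx
  rw [one_mul, norm_pow, norm_pow, norm_norm]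
  exact pow_le_pow_of_le_one (norm_nonneg _) hx.le h

lemma eval_isBigO {k : ℕ} {f : Pol n} (hf : f ∈ Ord n k) :
    (fun x => eval x f) =O[𝓝 0] (fun x : Fin n → ℝ => ‖x‖ ^ k) := by
  have : (fun x => eval x f) = fun x => ∑ α ∈ f.support, coeff α f * ∏ i, x i ^ α i := by
    funext x; rw [eval_eq']
  rw [this]
  apply IsBigO.fun_sum
  intro α hα
  apply IsBigO.const_mul_left
  have hd : k ≤ α.degree := (mem_pow_idealOfVars_iff k f).1 hf α hα
  refine IsBigO.trans ?_ (isBigO_pow_mono hd)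
  apply IsBigO.of_bound 1
  filter_upwards with x
  rw [one_mul, norm_prod, norm_pow, norm_norm, Finsupp.degree_eq_sum, ← Finset.prod_pow_eq_pow_sum]
  apply Finset.prod_le_prod
  · intros; positivity
  · intro i _
    rw [norm_pow]
    exact pow_le_pow_left₀ (norm_nonneg _) (norm_le_pi_norm x i) _

lemma eval_smul_homog {d : ℕ} {g : Pol n} (hg : g.IsHomogeneous d) (t : ℝ) (x : Fin n → ℝ) :
    eval (t • x) g = t ^ d * eval x g := by
  rw [eval_eq', eval_eq', Finset.mul_sum]
  apply Finset.sum_congr rfl; intro α hα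
  have := hg (mem_support_iff.1 hα)
  rw [wt_one, Finsupp.degree_eq_sum] at this
  simp only [Pi.smul_apply, smul_eq_mul, mul_pow, Finset.prod_mul_distrib, Finset.prod_pow_eq_pow_sum, this]
  ring

lemma homog_zero_of_isBigO {k : ℕ} {g : Pol n} (hg : g.IsHomogeneous k)
    (h : (fun x => eval x g) =O[𝓝 0] (fun x : Fin n → ℝ => ‖x‖ ^ (k+1))) : g = 0 := by
  apply MvPolynomial.funext
  intro x
  rw [map_zero]
  obtain ⟨c, hc⟩ := h.bound
  have ht : Tendsto (fun t : ℝ => t • x) (𝓝[>] 0) (𝓝 0) := by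
    have : Tendsto (fun t : ℝ => t • x) (𝓝 0) (𝓝 ((0:ℝ) • x)) :=
      (continuous_id.smul continuous_const).tendsto _
    rw [zero_smul] at this
    exact this.mono_left nhdsWithin_le_nhds
  have h1 := ht.eventually hc
  have h2 : ∀ᶠ t : ℝ in 𝓝[>] 0, |eval x g| ≤ t * (c * ‖x‖ ^ (k+1)) := by
    filter_upwards [h1, self_mem_nhdsWithin] with t ht (hpos : 0 < t)
    rw [eval_smul_homog hg, norm_smul] at ht
    simp only [Real.norm_eq_abs, norm_pow, abs_mul, abs_pow, abs_of_pos hpos, mul_pow, abs_norm] at ht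
    have h3 : t ^ k * |eval x g| ≤ t ^ k * (t * (c * ‖x‖ ^ (k+1))) := by
      calc _ ≤ _ := ht
        _ = _ := by ring
    exact le_of_mul_le_mul_left h3 (by positivity)
  have h3 : Tendsto (fun t : ℝ => t * (c * ‖x‖ ^ (k+1))) (𝓝[>] 0) (𝓝 (0 * (c * ‖x‖ ^ (k+1)))) :=
    ((continuous_id.mul continuous_const).tendsto _).mono_left nhdsWithin_le_nhds
  rw [zero_mul] at h3
  have := ge_of_tendsto h3 h2
  exact abs_eq_zero.1 (le_antisymm this (abs_nonneg _))

lemma ord_of_isBigO {k : ℕ} {f : Pol n}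
    (h : (fun x => eval x f) =O[𝓝 0] (fun x : Fin n → ℝ => ‖x‖ ^ k)) : f ∈ Ord n k := by
  induction k with
  | zero => exact ord_zero_mem f
  | succ k ih =>
    have h1 := ih (h.trans (isBigO_pow_mono (Nat.le_succ k)))
    have h2 := ord_sub_homComp h1
    have h3 : homogeneousComponent k f = 0 := by
      apply homog_zero_of_isBigO (homogeneousComponent_isHomogeneous k f)
      have := h.sub (eval_isBigO h2)
      refine this.congr_left fun x => ?_
      rw [map_sub]; ring
    rwa [h3, sub_zero] at h2

end ord

section analytic
open Asymptotics Filter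
variable {E F : Type*} [NormedAddCommGroup E] [NormedSpace ℝ E] [NormedAddCommGroup F] [NormedSpace ℝ F]

lemma series_vanish {f : E → F} {p : FormalMultilinearSeries ℝ E F} (hp : HasFPowerSeriesAt f p 0) {k : ℕ}
    (h : f =O[𝓝 0] (fun x => ‖x‖ ^ k)) : ∀ d < k, ∀ y, p d (fun _ => y) = 0 := by
  intro d
  induction d using Nat.strong_induction_on with
  | _ d ih =>
  intro hd
  have psum : p.partialSum (d + 1) = fun y => p d fun _ => y := by
    funext z
    refine Finset.sum_eq_single _ (fun b hb hnb => ?_) fun hn => ?_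
    · have := Finset.mem_range_succ_iff.mp hb
      exact ih b (this.lt_of_ne hnb) (by omega) z
    · exact False.elim (hn (Finset.mem_range.mpr (lt_add_one d)))
  have h1 := hp.isBigO_sub_partialSum_pow (d+1)
  simp only [psum, zero_add] at h1
  have h2 : f =O[𝓝 0] (fun x => ‖x‖ ^ (d+1)) := by
    refine h.trans ?_
    apply IsBigO.of_bound 1
    filter_upwards [Metric.ball_mem_nhds (0 : E) one_pos] with x hx
    simp only [Metric.mem_ball, dist_zero_right] at hx
    rw [one_mul, norm_pow, norm_pow, norm_norm]
    exact pow_le_pow_of_le_one (norm_nonneg _) hx.le hd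
  have h3 := h2.sub h1
  have h4 : (fun y => p d fun _ => y) =O[𝓝 0] fun y => ‖y‖ ^ (d + 1) := by
    refine h3.congr_left fun x => ?_
    abel
  exact h4.continuousMultilinearMap_apply_eq_zero

lemma fderiv_isBigO [CompleteSpace F] {f : E → F} (hf : AnalyticAt ℝ f 0) {k : ℕ}
    (h : f =O[𝓝 0] (fun x => ‖x‖ ^ (k+1))) : (fderiv ℝ f) =O[𝓝 0] (fun x => ‖x‖ ^ k) := by
  obtain ⟨p, hp⟩ := hf
  have hv := series_vanish hp h
  obtain ⟨r, hr⟩ := hp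
  let p' : FormalMultilinearSeries ℝ E F := fun d => if d ≤ k then 0 else p d
  have hrad : p.radius ≤ p'.radius := by
    apply ENNReal.le_of_forall_nnreal_lt
    intro s hs
    obtain ⟨C, hC, hle⟩ := p.norm_mul_pow_le_of_lt_radius hs
    apply p'.le_radius_of_bound C
    intro d
    refine le_trans ?_ (hle d)
    simp only [p']
    split_ifs
    · simp; positivity
    · exact le_rfl
  have hp' : HasFPowerSeriesOnBall f p' 0 r := by
    refine ⟨hr.r_le.trans hrad, hr.r_pos, fun {y} hy => ?_⟩
    have := hr.hasSum hy
    convert this using 1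
    funext d
    simp only [p']
    split_ifs with hd
    · rw [hv d (by omega)]; simp
    · rfl
  have hd := hp'.fderiv
  have hb := hd.hasFPowerSeriesAt.isBigO_sub_partialSum_pow k
  refine hb.congr_left fun x => ?_
  rw [zero_add, FormalMultilinearSeries.partialSum, Finset.sum_eq_zero, sub_zero]
  intro d hdk
  rw [Finset.mem_range] at hdk
  rw [FormalMultilinearSeries.derivSeries_eq_zero]
  · simp
  · simp [p', Nat.succ_le_of_lt hdk]

lemma analytic_flat {f : E → F} (hf : AnalyticAt ℝ f 0) (h : ∀ k : ℕ, f =O[𝓝 0] (fun x => ‖x‖ ^ k)) :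
    ∀ᶠ x in 𝓝 0, f x = 0 := by
  obtain ⟨p, hp⟩ := hf
  have h0 : ∀ d y, p d (fun _ => y) = 0 := fun d => series_vanish hp (h (d+1)) d (Nat.lt_succ_self d)
  obtain ⟨r, hr⟩ := hp
  filter_upwards [Metric.eball_mem_nhds (0 : E) hr.r_pos] with y hy
  have := hr.hasSum (y := y) hy
  simp only [h0, zero_add] at this
  exact (this.unique hasSum_zero)

end analytic

end NambuLin


namespace NambuLin

open MvPolynomial Finset
open scoped Nat Topology ContDiff

section nam
variable {n q : ℕ}

/-- contracted vector fields of a tensor -/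
def vX (e : Fin (q+1) → Fin n) (m i : Fin (q+1)) (w : Ten ℝ n q) : Fin n → ℝ := fun s => Bc e m i s w

lemma tangent (e : Fin (q+1) → Fin n) {M : Matrix (Fin n) (Fin n) ℝ} (hM : IsUnit M) {w : Ten ℝ n q}
    {E : Matrix (Fin n) (Fin q) ℝ} (hw : act M w = dt E) {r : Fin n} (hr : E r = 0) (m i : Fin (q+1)) :
    M.mulVec (vX e m i w) r = 0 := by
  have hdet := (Matrix.isUnit_iff_isUnit_det M).1 hM
  have hw' : w = dt (M⁻¹ * E) := by
    rw [← act_dt, ← hw, ← act_mul, Matrix.nonsing_inv_mul _ hdet, act_one]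
  by_cases h : m = i
  · subst h; simp [vX, Bc, Matrix.mulVec, dotProduct]
  obtain ⟨a, rfl⟩ := Fin.exists_succAbove_eq (Ne.symm h)
  set G := M⁻¹ * E with hG
  have hMG : M * G = E := by rw [hG, ← Matrix.mul_assoc, Matrix.mul_nonsing_inv _ hdet, Matrix.one_mul]
  have e3 : ∀ s, Bc e m (m.succAbove a) s w = (-1) ^ (m : ℕ) *
      (Matrix.updateRow (G.submatrix (e ∘ m.succAbove) id) a (G s)).det := by
    intro s
    rw [Bc, if_neg h, ← Top.update_comp_succAbove', hw']
    unfold dt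
    congr 2
    ext b c
    simp only [Matrix.updateRow_apply, Matrix.submatrix_apply, id, Function.update_apply]
    split_ifs <;> rfl
  have := det_updateRow_lin (G.submatrix (e ∘ m.succAbove) id) a univ (fun s => M r s) (fun s => G s)
  have hz : ∑ s, M r s • G s = 0 := by
    rw [← hr, ← hMG]
    funext c
    simp [Matrix.mul_apply]
  rw [hz] at this
  have h0 : ((G.submatrix (e ∘ m.succAbove) id).updateRow a 0).det = 0 :=
    Matrix.det_eq_zero_of_row_eq_zero a (fun c => by simp)
  rw [h0] at this
  simp only [Matrix.mulVec, dotProduct, vX, e3]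
  calc _ = (-1) ^ (m : ℕ) * ∑ s, M r s * ((G.submatrix (e ∘ m.succAbove) id).updateRow a (G s)).det := by
        rw [Finset.mul_sum]; exact Finset.sum_congr rfl fun s _ => by ring
    _ = 0 := by rw [← this, mul_zero]

lemma lin_zero (e : Fin (q+1) → Fin n) {M : Matrix (Fin n) (Fin n) ℝ} (hM : IsUnit M) {w : Ten ℝ n q}
    {t : Fin q → Fin n} (ht : Function.Injective t) (hw : act M w = dt (eI t)) (m : Fin (q+1)) (hA : Ac e m w ≠ 0) {v : Fin n → ℝ}
    (hv : ∀ r, r ∉ Set.range t → M.mulVec v r = 0) (hv2 : ∀ l, l ≠ m → v (e l) = 0) : v = 0 := by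
  have hdet := (Matrix.isUnit_iff_isUnit_det M).1 hM
  have hw' : w = dt (M⁻¹ * eI (R := ℝ) t) := by
    rw [← act_dt, ← hw, ← act_mul, Matrix.nonsing_inv_mul _ hdet, act_one]
  set G : Matrix (Fin n) (Fin q) ℝ := M⁻¹ * eI (R := ℝ) t with hG
  let c : Fin q → ℝ := fun b => M.mulVec v (t b)
  have h1 : M.mulVec v = (eI t : Matrix (Fin n) (Fin q) ℝ).mulVec c := by
    funext r
    by_cases hr : r ∈ Set.range t
    · obtain ⟨b, rfl⟩ := hr
      simp [Matrix.mulVec, dotProduct, eI, c, ht.eq_iff]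
    · rw [hv r hr]
      simp only [Matrix.mulVec, dotProduct, eI]
      rw [Finset.sum_eq_zero]
      intro b _
      rw [if_neg (fun h => hr ⟨b, h.symm⟩), zero_mul]
  have h2 : v = G.mulVec c := by
    rw [hG, ← Matrix.mulVec_mulVec, ← h1, Matrix.mulVec_mulVec, Matrix.nonsing_inv_mul _ hdet, Matrix.one_mulVec]
  have h3 : (G.submatrix (e ∘ m.succAbove) id).mulVec c = 0 := by
    funext a
    have := hv2 (m.succAbove a) (Fin.succAbove_ne m a)
    rw [h2] at this
    exact this
  have h4 : (G.submatrix (e ∘ m.succAbove) id).det ≠ 0 := by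
    intro h
    apply hA
    rw [Ac, hw', dt, h, mul_zero]
  have h5 : c = 0 := Matrix.eq_zero_of_mulVec_eq_zero h4 h3
  rw [h2, h5, Matrix.mulVec_zero]

/-- the vector `A [X, Y] - (X A) Y + (Y A) X` -/
noncomputable def brk (A : (Fin n → ℝ) → ℝ) (X Y : (Fin n → ℝ) → Fin n → ℝ) (x : Fin n → ℝ) : Fin n → ℝ :=
  A x • (fderiv ℝ Y x (X x) - fderiv ℝ X x (Y x)) - fderiv ℝ A x (X x) • Y x + fderiv ℝ A x (Y x) • X x

lemma brk_kill {A : (Fin n → ℝ) → ℝ} {X Y : (Fin n → ℝ) → Fin n → ℝ} {x : Fin n → ℝ}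
    (hX : DifferentiableAt ℝ X x) (hY : DifferentiableAt ℝ Y x) {g : (Fin n → ℝ) → ℝ} (hg : ContDiffAt ℝ 2 g x)
    (h1 : ∀ᶠ y in 𝓝 x, fderiv ℝ g y (X y) = 0) (h2 : ∀ᶠ y in 𝓝 x, fderiv ℝ g y (Y y) = 0) :
    fderiv ℝ g x (brk A X Y x) = 0 := by
  have hdg : DifferentiableAt ℝ (fderiv ℝ g) x :=
    (hg.fderiv_right (m := 1) (by norm_num)).differentiableAt one_ne_zero
  have hs := hg.isSymmSndFDerivAt (by simp)
  have key : ∀ {X : (Fin n → ℝ) → Fin n → ℝ} (hX : DifferentiableAt ℝ X x)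
      (h1 : ∀ᶠ y in 𝓝 x, fderiv ℝ g y (X y) = 0) (v : Fin n → ℝ),
      fderiv ℝ (fderiv ℝ g) x v (X x) + fderiv ℝ g x (fderiv ℝ X x v) = 0 := by
    intro X hX h1 v
    have h3 : fderiv ℝ (fun y => fderiv ℝ g y (X y)) x = 0 := by
      have : (fun y => fderiv ℝ g y (X y)) =ᶠ[𝓝 x] fun _ => 0 := h1
      rw [this.fderiv_eq]; simp
    have h4 := fderiv_clm_apply hdg hX
    rw [h3] at h4
    have := congrArg (fun L => L v) h4
    simp at this
    rw [add_comm]; exact this.symm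
  have k1 := key hX h1 (Y x)
  have k2 := key hY h2 (X x)
  have k3 := hs (X x) (Y x)
  have e1 := h1.self_of_nhds
  have e2 := h2.self_of_nhds
  unfold brk
  simp only [map_add, map_sub, map_smul, e1, e2, smul_zero, add_zero, sub_zero, smul_eq_mul]
  have : fderiv ℝ g x (fderiv ℝ Y x (X x)) - fderiv ℝ g x (fderiv ℝ X x (Y x)) = 0 := by linarith
  rw [this]; ring

/-- `R` has a local Nambu chart at `x` -/
def NamAt (t : Fin q → Fin n) (R : (Fin n → ℝ) → Ten ℝ n q) (x : Fin n → ℝ) : Prop :=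
  ∃ Φ : (Fin n → ℝ) → (Fin n → ℝ), ContDiffAt ℝ 2 Φ x ∧
    ∀ᶠ y in 𝓝 x, IsUnit (jac Φ y) ∧ act (jac Φ y) (R y) = dt (eI t)

lemma NamAt.dt {t : Fin q → Fin n} {R : (Fin n → ℝ) → Ten ℝ n q} {x : Fin n → ℝ} (h : NamAt t R x) :
    ∃ E, R x = dt E := by
  obtain ⟨Φ, -, h⟩ := h
  obtain ⟨hM, hw⟩ := h.self_of_nhds
  have hdet := (Matrix.isUnit_iff_isUnit_det _).1 hM
  refine ⟨(jac Φ x)⁻¹ * eI (R := ℝ) t, ?_⟩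
  rw [← act_dt, ← hw, ← act_mul, Matrix.nonsing_inv_mul _ hdet, act_one]

lemma jac_mulVec {Φ : (Fin n → ℝ) → (Fin n → ℝ)} {x : Fin n → ℝ} (hΦ : DifferentiableAt ℝ Φ x) (v : Fin n → ℝ)
    (r : Fin n) : (jac Φ x).mulVec v r = fderiv ℝ (fun y => Φ y r) x v := by
  rw [fderiv_apply (𝕜 := ℝ) (hΦ := hΦ)]
  have : v = ∑ j, v j • (Pi.single j 1 : Fin n → ℝ) := by
    funext i
    simp [Finset.sum_apply, Pi.single_apply]
  conv_rhs => rw [this]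
  simp only [Matrix.mulVec, dotProduct, jac, Matrix.of_apply, map_sum, map_smul, ContinuousLinearMap.comp_apply,
    ContinuousLinearMap.proj_apply, smul_eq_mul]
  exact Finset.sum_congr rfl fun j _ => mul_comm _ _

lemma diff_Bc (e : Fin (q+1) → Fin n) {R : (Fin n → ℝ) → Ten ℝ n q} {x : Fin n → ℝ} (hd : DifferentiableAt ℝ R x)
    (m i : Fin (q+1)) (s : Fin n) : DifferentiableAt ℝ (fun y => Bc e m i s (R y)) x := by
  unfold Bc
  split_ifs
  · exact differentiableAt_const _
  · exact (differentiableAt_const _).mul (differentiableAt_pi.1 hd _)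

lemma diff_vX (e : Fin (q+1) → Fin n) {R : (Fin n → ℝ) → Ten ℝ n q} {x : Fin n → ℝ} (hd : DifferentiableAt ℝ R x)
    (m i : Fin (q+1)) : DifferentiableAt ℝ (fun y => vX e m i (R y)) x :=
  differentiableAt_pi.2 fun s => diff_Bc e hd m i s

lemma diff_Ac (e : Fin (q+1) → Fin n) {R : (Fin n → ℝ) → Ten ℝ n q} {x : Fin n → ℝ} (hd : DifferentiableAt ℝ R x)
    (m : Fin (q+1)) : DifferentiableAt ℝ (fun y => Ac e m (R y)) x :=
  (differentiableAt_const _).mul (differentiableAt_pi.1 hd _)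

lemma brk_apply {A : (Fin n → ℝ) → ℝ} {X Y : (Fin n → ℝ) → Fin n → ℝ} {x : Fin n → ℝ}
    (hX : DifferentiableAt ℝ X x) (hY : DifferentiableAt ℝ Y x) (l : Fin n) : brk A X Y x l =
      A x * (fderiv ℝ (fun y => Y y l) x (X x) - fderiv ℝ (fun y => X y l) x (Y x))
        - fderiv ℝ A x (X x) * Y x l + fderiv ℝ A x (Y x) * X x l := by
  rw [fderiv_apply (𝕜 := ℝ) (hΦ := hX), fderiv_apply (𝕜 := ℝ) (hΦ := hY)]
  simp [brk]

lemma brk_zero (e : Fin (q+1) → Fin n) {t : Fin q → Fin n} (ht : Function.Injective t)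
    {R : (Fin n → ℝ) → Ten ℝ n q} (hR : ∀ x, IsAlt (R x)) {x : Fin n → ℝ}
    (hd : DifferentiableAt ℝ R x) (h : NamAt t R x) (m i j : Fin (q+1)) (hA : Ac e m (R x) ≠ 0) :
    brk (fun y => Ac e m (R y)) (fun y => vX e m i (R y)) (fun y => vX e m j (R y)) x = 0 := by
  obtain ⟨Φ, hΦ, hN⟩ := h
  have hdΦ : ∀ᶠ y in 𝓝 x, DifferentiableAt ℝ Φ y := by
    filter_upwards [hΦ.eventually (by simp)] with y hy
    exact hy.differentiableAt two_ne_zero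
  refine lin_zero e hN.self_of_nhds.1 ht hN.self_of_nhds.2 m hA ?_ ?_
  · intro r hr
    rw [jac_mulVec hdΦ.self_of_nhds]
    have hk : ∀ i, ∀ᶠ y in 𝓝 x, fderiv ℝ (fun z => Φ z r) y (vX e m i (R y)) = 0 := by
      intro i
      filter_upwards [hN, hdΦ] with y hy hdy
      rw [← jac_mulVec hdy]
      apply tangent e hy.1 hy.2
      funext b
      simp only [eI, Pi.zero_apply]
      rw [if_neg (fun h => hr ⟨b, h.symm⟩)]
    exact brk_kill (diff_vX e hd m i) (diff_vX e hd m j) (contDiffAt_pi.1 hΦ r) (hk i) (hk j)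
  · intro l hl
    rw [brk_apply (diff_vX e hd m i) (diff_vX e hd m j)]
    have hc : ∀ i y, vX e m i (R y) (e l) = if l = i then Ac e m (R y) else 0 := by
      intro i y
      unfold vX
      split_ifs with h
      · subst h; exact Bc_i e _ (Ne.symm hl)
      · by_cases hmi : m = i
        · simp [Bc, hmi]
        · exact Bc_l e (hR y) hl h
    simp only [hc]
    by_cases h1 : l = i <;> by_cases h2 : l = j
    · simp only [if_pos h1, if_pos h2]
      rw [← h1, ← h2]; ring
    · simp only [if_pos h1, if_neg h2]; simp; ring
    · simp only [if_neg h1, if_pos h2]; simp; ring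
    · simp only [if_neg h1, if_neg h2]; simp

end nam

end NambuLin


namespace NambuLin

open MvPolynomial Finset
open scoped Nat Topology ContDiff

section app
open Asymptotics Filter
variable {n : ℕ}

/-- `f` agrees with the polynomial `g` (of order at least `c`) up to relative order `k` -/
def App (c k : ℕ) (f : (Fin n → ℝ) → ℝ) (g : Pol n) : Prop :=
  g ∈ Ord n c ∧ (fun x => f x - eval x g) =O[𝓝 0] (fun x : Fin n → ℝ => ‖x‖ ^ (c + k))

variable {c c' k : ℕ} {f f' : (Fin n → ℝ) → ℝ} {g g' : Pol n}

lemma App.isBigO (h : App c k f g) : f =O[𝓝 0] (fun x : Fin n → ℝ => ‖x‖ ^ c) := by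
  have := (h.2.trans (isBigO_pow_mono (Nat.le_add_right c k))).add (eval_isBigO h.1)
  exact this.congr_left fun x => by ring

lemma App.mul (h : App c k f g) (h' : App c' k f' g') : App (c + c') k (fun x => f x * f' x) (g * g') := by
  refine ⟨ord_mul h.1 h'.1, ?_⟩
  have h1 := (h.2.mul h'.isBigO).congr_right (fun x => by
    show _ = ‖x‖ ^ (c + c' + k)
    rw [← pow_add]; congr 1; omega)
  have h2 := ((eval_isBigO h.1).mul h'.2).congr_right (fun x => by
    show _ = ‖x‖ ^ (c + c' + k)
    rw [← pow_add]; congr 1; omega)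
  refine (h1.add h2).congr_left fun x => ?_
  rw [map_mul]; ring

lemma App.add (h : App c k f g) (h' : App c k f' g') : App c k (fun x => f x + f' x) (g + g') := by
  refine ⟨add_mem h.1 h'.1, (h.2.add h'.2).congr_left fun x => ?_⟩
  rw [map_add]; ring

lemma App.sub (h : App c k f g) (h' : App c k f' g') : App c k (fun x => f x - f' x) (g - g') := by
  refine ⟨sub_mem h.1 h'.1, (h.2.sub h'.2).congr_left fun x => ?_⟩
  rw [map_sub]; ring

lemma App.zero : App c k (fun _ => (0:ℝ)) (0 : Pol n) := by
  refine ⟨zero_mem _, ?_⟩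
  simp only [map_zero, sub_zero]
  exact isBigO_zero _ _

lemma App.sum {ι : Type*} (s : Finset ι) {f : ι → (Fin n → ℝ) → ℝ} {g : ι → Pol n} (h : ∀ i ∈ s, App c k (f i) (g i)) :
    App c k (fun x => ∑ i ∈ s, f i x) (∑ i ∈ s, g i) := by
  classical
  induction s using Finset.induction_on with
  | empty => simpa using App.zero
  | insert a s ha ih =>
    simp only [Finset.sum_insert ha]
    exact (h a (Finset.mem_insert_self _ _)).add (ih fun i hi => h i (Finset.mem_insert_of_mem hi))

lemma App.const_mul (h : App c k f g) (r : ℝ) : App c k (fun x => r * f x) (C r * g) := by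
  refine ⟨Ideal.mul_mem_left _ _ h.1, (h.2.const_mul_left r).congr_left fun x => ?_⟩
  simp; ring

lemma App.ord (h : App c k f g) (hf : ∀ᶠ x in 𝓝 0, f x = 0) : g ∈ Ord n (c + k) := by
  apply ord_of_isBigO
  have h1 : f =O[𝓝 0] (fun x : Fin n → ℝ => ‖x‖ ^ (c + k)) := by
    have : f =ᶠ[𝓝 0] fun _ => 0 := hf
    exact this.trans_isBigO (isBigO_zero _ _)
  exact (h1.sub h.2).congr_left fun x => by ring

lemma eval_pderiv_fderiv (g : Pol n) (x : Fin n → ℝ) : DifferentiableAt ℝ (fun y => eval y g) x ∧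
    ∀ r, fderiv ℝ (fun y => eval y g) x (Pi.single r 1) = eval x (pderiv r g) := by
  induction g using MvPolynomial.induction_on with
  | C a => simp
  | add p q hp hq =>
    simp only [map_add]
    refine ⟨hp.1.add hq.1, fun r => ?_⟩
    rw [fderiv_fun_add hp.1 hq.1]
    simp [hp.2, hq.2]
  | mul_X p i hp =>
    have hX : HasFDerivAt (fun y : Fin n → ℝ => y i) (ContinuousLinearMap.proj i : ((Fin n → ℝ) →L[ℝ] ℝ)) x :=
      hasFDerivAt_apply i x
    simp only [map_mul, eval_X]
    refine ⟨hp.1.mul hX.differentiableAt, fun r => ?_⟩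
    rw [fderiv_fun_mul hp.1 hX.differentiableAt, hX.fderiv]
    simp only [Derivation.leibniz, pderiv_X, ContinuousLinearMap.add_apply, ContinuousLinearMap.smul_apply,
      hp.2, ContinuousLinearMap.proj_apply, smul_eq_mul, map_add, map_mul, eval_X]
    congr 1
    simp only [Pi.single_apply]
    by_cases h : i = r
    · simp [h]
    · simp [h, Ne.symm h]

lemma eval_analytic (g : Pol n) (x : Fin n → ℝ) : AnalyticAt ℝ (fun y => eval y g) x := by
  induction g using MvPolynomial.induction_on with
  | C a => simpa using analyticAt_const
  | add p q hp hq =>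
    simp only [map_add]
    exact hp.add hq
  | mul_X p i hp =>
    simp only [map_mul, eval_X]
    exact hp.mul ((ContinuousLinearMap.proj i : ((Fin n → ℝ) →L[ℝ] ℝ)).analyticAt x)

lemma App.pderiv (h : App 1 k f g) (hf : AnalyticAt ℝ f 0) (r : Fin n) :
    App 0 k (fun x => fderiv ℝ f x (Pi.single r 1)) (MvPolynomial.pderiv r g) := by
  refine ⟨ord_zero_mem _, ?_⟩
  have h1 := h.2
  rw [add_comm] at h1
  have h2 := fderiv_isBigO (hf.sub (eval_analytic g 0)) h1
  rw [zero_add]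
  have h3 : (fun x => (fderiv ℝ (f - fun y => eval y g) x) (Pi.single r 1)) =O[𝓝 0]
      fun x : Fin n → ℝ => ‖x‖ ^ k := by
    refine IsBigO.trans ?_ h2
    apply IsBigO.of_bound ‖(Pi.single r 1 : Fin n → ℝ)‖
    filter_upwards with x
    rw [mul_comm]
    exact ContinuousLinearMap.le_opNorm _ _
  refine h3.congr' ?_ EventuallyEq.rfl
  filter_upwards [hf.eventually_analyticAt] with x hx
  rw [fderiv_sub hx.differentiableAt (eval_pderiv_fderiv g x).1]
  simp [(eval_pderiv_fderiv g x).2]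

lemma fderiv_sum (f : (Fin n → ℝ) → ℝ) (x v : Fin n → ℝ) :
    fderiv ℝ f x v = ∑ r, v r * fderiv ℝ f x (Pi.single r 1) := by
  have : v = ∑ j, v j • (Pi.single j 1 : Fin n → ℝ) := by
    funext i
    simp [Finset.sum_apply, Pi.single_apply]
  conv_lhs => rw [this]
  simp

/-- directional derivative of polynomials -/
noncomputable def Dv (v : Fin n → Pol n) (f : Pol n) : Pol n := ∑ r, v r * MvPolynomial.pderiv r f

lemma App.Dv {v : (Fin n → ℝ) → Fin n → ℝ} {V : Fin n → Pol n} (hv : ∀ r, App 1 k (fun x => v x r) (V r))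
    (h : App 1 k f g) (hf : AnalyticAt ℝ f 0) : App 1 k (fun x => fderiv ℝ f x (v x)) (Dv V g) := by
  have : (fun x => fderiv ℝ f x (v x)) = fun x => ∑ r, v x r * fderiv ℝ f x (Pi.single r 1) :=
    funext fun x => fderiv_sum f x (v x)
  rw [this]
  exact App.sum _ fun r _ => (hv r).mul (h.pderiv hf r)

lemma Dv_add_left (v w : Fin n → Pol n) (f : Pol n) : NambuLin.Dv (v + w) f = NambuLin.Dv v f + NambuLin.Dv w f := by
  simp [NambuLin.Dv, add_mul, Finset.sum_add_distrib]

lemma Dv_add_right (v : Fin n → Pol n) (f g : Pol n) : NambuLin.Dv v (f + g) = NambuLin.Dv v f + NambuLin.Dv v g := by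
  simp [NambuLin.Dv, mul_add, Finset.sum_add_distrib]

lemma Dv_neg_right (v : Fin n → Pol n) (f : Pol n) : NambuLin.Dv v (-f) = - NambuLin.Dv v f := by
  simp [NambuLin.Dv]

lemma Dv_ord {v : Fin n → Pol n} {f : Pol n} {a b c : ℕ} (hv : ∀ r, v r ∈ Ord n a) (hf : f ∈ Ord n b)
    (h : c ≤ a + (b - 1)) : NambuLin.Dv v f ∈ Ord n c :=
  sum_mem fun r _ => ord_mul' h (hv r) (ord_pderiv' le_rfl r hf)

lemma three {d0 d1 : ℕ} (h : d0 ≠ d1) {f g r : Pol n} (hf : f.IsHomogeneous d0) (hg : g.IsHomogeneous d1)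
    (hr : r ∈ Ord n (d1+1)) (hs : f + g + r ∈ Ord n (d1+1)) : g = 0 := by
  have h1 := homComp_ord (Nat.lt_succ_self d1) hs
  rw [map_add, map_add, homComp_ord (Nat.lt_succ_self d1) hr,
    homogeneousComponent_of_mem (by exact hf), homogeneousComponent_of_mem (by exact hg)] at h1
  simpa [h.symm] using h1

lemma ord_cancel {A A0 w : Pol n} (h0 : A0.IsHomogeneous 1) (hne : A0 ≠ 0) (hA : A - A0 ∈ Ord n 2) {k : ℕ}
    (h : A * w ∈ Ord n (k+1)) : w ∈ Ord n k := by
  suffices ∀ l ≤ k, w ∈ Ord n l from this k le_rfl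
  intro l
  induction l with
  | zero => intro _; exact ord_zero_mem _
  | succ l ih =>
    intro hl
    have h1 := ih (by omega)
    have h2 := ord_sub_homComp h1
    have h3 : A0 * homogeneousComponent l w ∈ Ord n (l+2) := by
      have e : A0 * homogeneousComponent l w = A * w - (A - A0) * w - A0 * (w - homogeneousComponent l w) := by ring
      rw [e]
      refine sub_mem (sub_mem (ord_mono (by omega) h) ?_) ?_
      · exact ord_mul' (by omega) hA h1
      · exact ord_mul' (by omega) (ord_homog le_rfl h0) h2
    have h4 : A0 * homogeneousComponent l w = 0 := by
      apply ord_homog_zero (h0.mul (homogeneousComponent_isHomogeneous l w))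
      exact ord_mono (by omega) h3
    have h5 := (mul_eq_zero.1 h4).resolve_left hne
    rwa [h5, sub_zero] at h2

end app

end NambuLin


namespace NambuLin

open MvPolynomial Finset
open scoped Nat Topology ContDiff

section cyc
open Asymptotics Filter
variable {n q : ℕ}

/-- `R` is a Nambu tensor which agrees with the model plus `κ` to the first nontrivial order -/
structure Cyc (τ : Top n (q+1)) (t : Fin q → Fin n) (R : (Fin n → ℝ) → Ten ℝ n q) (κ : Ten (Pol n) n q) (N : ℕ) : Prop where
  ht : Function.Injective t
  hN : 2 ≤ N
  alt : ∀ x, IsAlt (R x)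
  an : AnalyticAt ℝ R 0
  nam : ∀ᶠ x in 𝓝 0, R x ≠ 0 → NamAt t R x
  kalt : IsAlt κ
  khom : ∀ j, (κ j).IsHomogeneous N
  app : ∀ j, App 1 N (fun x => R x j) (τ.P0 j + κ j)

lemma hom_neg {f : Pol n} {d : ℕ} (h : f.IsHomogeneous d) : (-f).IsHomogeneous d := by
  exact (homogeneousSubmodule (Fin n) ℝ d).neg_mem h

lemma hom_sub {f g : Pol n} {d : ℕ} (h : f.IsHomogeneous d) (h' : g.IsHomogeneous d) : (f-g).IsHomogeneous d := by
  exact (homogeneousSubmodule (Fin n) ℝ d).sub_mem h h'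

lemma hom_mul' {f g : Pol n} {a b d : ℕ} (h : f.IsHomogeneous a) (h' : g.IsHomogeneous b) (hd : a + b = d) :
    (f*g).IsHomogeneous d := hd ▸ h.mul h'

variable {τ : Top n (q+1)} {t : Fin q → Fin n} {R : (Fin n → ℝ) → Ten ℝ n q} {κ : Ten (Pol n) n q} {N : ℕ}

lemma Cyc.plucker_lin (h : Cyc τ t R κ N) (I J : Fin q → Fin n) (p : Fin q) :
    τ.P0 I * κ J + κ I * τ.P0 J = ∑ b, (τ.P0 (Function.update I p (J b)) * κ (Function.update J b (I p))
      + κ (Function.update I p (J b)) * τ.P0 (Function.update J b (I p))) := by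
  have hN := h.hN
  have happ : App 2 N (fun x => R x I * R x J - ∑ b, R x (Function.update I p (J b)) * R x (Function.update J b (I p)))
      ((τ.P0 I + κ I) * (τ.P0 J + κ J) - ∑ b, (τ.P0 (Function.update I p (J b)) + κ (Function.update I p (J b)))
        * (τ.P0 (Function.update J b (I p)) + κ (Function.update J b (I p)))) :=
    ((h.app I).mul (h.app J)).sub (App.sum _ fun b _ => (h.app _).mul (h.app _))
  have hz : ∀ᶠ x in 𝓝 0, R x I * R x J - ∑ b, R x (Function.update I p (J b)) * R x (Function.update J b (I p)) = 0 := by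
    filter_upwards [h.nam] with x hx
    by_cases h0 : R x = 0
    · simp [h0]
    · obtain ⟨E, hE⟩ := (hx h0).dt
      rw [hE, ← dt_plucker, sub_self]
  have ho := happ.ord hz
  rw [← sub_eq_zero]
  have hP := fun j => τ.P0_homog j
  have hk := h.khom
  refine three (d0 := 2) (d1 := N+1) (by omega)
    (f := τ.P0 I * τ.P0 J - ∑ b, τ.P0 (Function.update I p (J b)) * τ.P0 (Function.update J b (I p)))
    (r := κ I * κ J - ∑ b, κ (Function.update I p (J b)) * κ (Function.update J b (I p)))
    ?_ ?_ ?_ ?_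
  · exact hom_sub (hom_mul' (hP _) (hP _) rfl) (IsHomogeneous.sum _ _ _ fun b _ => hom_mul' (hP _) (hP _) rfl)
  · exact hom_sub ((hom_mul' (hP _) (hk _) (by omega)).add (hom_mul' (hk _) (hP _) rfl))
      (IsHomogeneous.sum _ _ _ fun b _ => (hom_mul' (hP _) (hk _) (by omega)).add (hom_mul' (hk _) (hP _) rfl))
  · exact sub_mem (ord_mul' (by omega) (ord_homog le_rfl (hk _)) (ord_homog le_rfl (hk _)))
      (sum_mem fun b _ => ord_mul' (by omega) (ord_homog le_rfl (hk _)) (ord_homog le_rfl (hk _)))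
  · have e : N + 1 + 1 = 2 + N := by omega
    rw [e]
    convert ho using 1
    simp only [add_mul, mul_add, Finset.sum_add_distrib]
    ring

lemma exists_two_free {e : Fin (q+1) → Fin n} (he : Function.Injective e) {J : Fin q → Fin n} {a b : Fin q} (hab : a ≠ b)
    (ha : J a ∉ Set.range e) (hb : J b ∉ Set.range e) :
    ∃ k i, k ≠ i ∧ e k ∉ Set.range J ∧ e i ∉ Set.range J := by
  classical
  let S := (univ : Finset (Fin (q+1))).filter (fun k => e k ∈ Set.range J)
  have h1 : S.card ≤ ((univ.erase a).erase b).card := by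
    have h2 : S.image e ⊆ ((univ.erase a).erase b).image J := by
      intro x hx
      simp only [S, mem_image, mem_filter, mem_univ, true_and] at hx
      obtain ⟨k, ⟨c, hc⟩, rfl⟩ := hx
      refine mem_image.2 ⟨c, ?_, hc⟩
      simp only [mem_erase, mem_univ, and_true]
      constructor
      · rintro rfl; exact hb ⟨k, hc.symm⟩
      · rintro rfl; exact ha ⟨k, hc.symm⟩
    rw [← card_image_of_injective S he]
    exact (card_le_card h2).trans card_image_le
  rw [card_erase_of_mem (by simp [hab.symm]), card_erase_of_mem (by simp)] at h1
  simp only [card_univ, Fintype.card_fin] at h1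
  have h3 : 1 < Sᶜ.card := by
    rw [card_compl, Fintype.card_fin]
    have := a.2; omega
  obtain ⟨k, hk, i, hi, hki⟩ := one_lt_card.1 h3
  refine ⟨k, i, hki, ?_, ?_⟩
  · simpa [S] using hk
  · simpa [S] using hi

lemma P0_ne (τ : Top n (q+1)) (k : Fin (q+1)) : τ.P0 (τ.e ∘ k.succAbove) ≠ 0 := by
  intro h
  have := τ.Ac_P0 k
  rw [Ac, h, mul_zero] at this
  exact τ.A_ne k this.symm

/-- replacing a slot by another top element already present gives zero -/
lemma alt_dup {w : Ten (Pol n) n q} (hw : IsAlt w) (e : Fin (q+1) → Fin n) {k l : Fin (q+1)} {p : Fin q} (hlk : l ≠ k)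
    (hl : l ≠ k.succAbove p) : w (Function.update (e ∘ k.succAbove) p (e l)) = 0 := by
  apply hw.eq_zero
  intro hinj
  obtain ⟨c, rfl⟩ := Fin.exists_succAbove_eq hlk
  have hcp : c ≠ p := fun h => hl (by rw [h])
  apply hcp
  apply hinj
  simp [Function.update_of_ne hcp]

lemma Cyc.two (h : Cyc τ t R κ N) {J : Fin q → Fin n} {a b : Fin q} (hab : a ≠ b)
    (ha : J a ∉ Set.range τ.e) (hb : J b ∉ Set.range τ.e) : κ J = 0 := by
  obtain ⟨k, i, hki, hk, hi⟩ := exists_two_free τ.inj hab ha hb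
  obtain ⟨p, hp⟩ := Fin.exists_succAbove_eq (Ne.symm hki)
  have hpl := h.plucker_lin (τ.e ∘ k.succAbove) J p
  rw [τ.P0_nontop a ha, mul_zero, add_zero, Finset.sum_eq_zero] at hpl
  · exact (mul_eq_zero.1 hpl).resolve_left (P0_ne τ k)
  · intro c _
    have h1 : τ.P0 (Function.update (τ.e ∘ k.succAbove) p (J c)) = 0 := by
      by_cases hc : J c ∈ Set.range τ.e
      · obtain ⟨l, hl⟩ := hc
        rw [← hl]
        apply alt_dup τ.P0_alt
        · rintro rfl; exact hk ⟨c, hl.symm⟩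
        · rw [hp]; rintro rfl; exact hi ⟨c, hl.symm⟩
      · exact τ.P0_nontop p (by simpa using hc)
    have h2 : τ.P0 (Function.update J c ((τ.e ∘ k.succAbove) p)) = 0 := by
      by_cases hc : c = a
      · exact τ.P0_nontop b (by rw [Function.update_of_ne (by rw [hc]; exact hab.symm)]; exact hb)
      · exact τ.P0_nontop a (by rw [Function.update_of_ne (Ne.symm hc)]; exact ha)
    rw [h1, h2]; ring

lemma neg_one_sq_pow (k : ℕ) : ((-1 : Pol n) ^ k) * (-1) ^ k = 1 := by
  rw [← mul_pow]; simp

lemma Cyc.D3 (h : Cyc τ t R κ N) {i j k : Fin (q+1)} (hij : i ≠ j) (hik : i ≠ k) (hjk : j ≠ k) {p : Fin n}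
    (hp : p ∉ Set.range τ.e) :
    τ.A k * Bc τ.e i j p κ = - τ.A j * Bc τ.e k i p κ + τ.A i * Bc τ.e k j p κ := by
  obtain ⟨r, hr⟩ := Fin.exists_succAbove_eq hik
  obtain ⟨bj, hbj⟩ := Fin.exists_succAbove_eq hij.symm
  obtain ⟨bk, hbk⟩ := Fin.exists_succAbove_eq hik.symm
  have hne : bj ≠ bk := by rintro rfl; exact hjk (hbj.symm.trans hbk)
  set J := Function.update τ.e j p ∘ i.succAbove with hJ
  have hJj : J bj = p := by simp [hJ, hbj]
  have hJk : J bk = τ.e k := by simp [hJ, hbk, Function.update_of_ne hjk.symm]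
  have hIr : (τ.e ∘ k.succAbove) r = τ.e i := by simp [hr]
  have hpl := h.plucker_lin (τ.e ∘ k.succAbove) J r
  rw [τ.P0_nontop (j := J) bj (by rw [hJj]; exact hp), mul_zero, add_zero, hIr] at hpl
  rw [Fintype.sum_eq_add bj bk hne] at hpl
  · have c1 : τ.P0 (Function.update (τ.e ∘ k.succAbove) r (J bj)) = 0 :=
      τ.P0_nontop r (by simpa [hJj] using hp)
    have c2 : τ.P0 (Function.update J bk (τ.e i)) = 0 :=
      τ.P0_nontop bj (by rw [Function.update_of_ne hne, hJj]; exact hp)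
    have c3 : τ.P0 (Function.update J bj (τ.e i)) = - ((-1) ^ (i:ℕ) * τ.A j) := by
      have := Bc_k τ.e τ.P0_alt hij
      rw [Bc, if_neg hij, τ.Ac_P0] at this
      rw [hJ, Top.update_comp_succAbove', hbj, Function.update_idem]
      linear_combination (-1) ^ (i:ℕ) * this - τ.P0 (Function.update τ.e j (τ.e i) ∘ i.succAbove) * neg_one_sq_pow (n := n) i
    have c4 : κ (Function.update (τ.e ∘ k.succAbove) r (J bj)) = (-1) ^ (k:ℕ) * Bc τ.e k i p κ := by
      rw [Bc, if_neg hik.symm, hJj, Top.update_comp_succAbove', hr]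
      linear_combination - κ (Function.update τ.e i p ∘ k.succAbove) * neg_one_sq_pow (n := n) k
    have c5 : τ.P0 (Function.update (τ.e ∘ k.succAbove) r (J bk)) = - ((-1) ^ (k:ℕ) * τ.A i) := by
      have := Bc_k τ.e τ.P0_alt hik.symm
      rw [Bc, if_neg hik.symm, τ.Ac_P0] at this
      rw [hJk, Top.update_comp_succAbove', hr]
      linear_combination (-1) ^ (k:ℕ) * this - τ.P0 (Function.update τ.e i (τ.e k) ∘ k.succAbove) * neg_one_sq_pow (n := n) k
    have c6 : κ (Function.update J bk (τ.e i)) = - ((-1) ^ (i:ℕ) * Bc τ.e k j p κ) := by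
      have := sgn_swap h.kalt hik (f := Function.update (Function.update τ.e j p) k (τ.e i))
        (by simp [Function.update_of_ne hik, Function.update_of_ne hij])
      rw [update_comp_succAbove] at this
      rw [Bc, if_neg hjk.symm, this, hJ, Top.update_comp_succAbove', hbk]
      linear_combination - κ (Function.update (Function.update τ.e j p) k (τ.e i) ∘ i.succAbove) * neg_one_sq_pow (n := n) i
    have c7 : κ J = (-1) ^ (i:ℕ) * Bc τ.e i j p κ := by
      rw [Bc, if_neg hij]
      linear_combination - κ J * neg_one_sq_pow (n := n) i
    have c8 : τ.P0 (τ.e ∘ k.succAbove) = (-1) ^ (k:ℕ) * τ.A k := by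
      rw [← τ.Ac_P0, Ac]
      linear_combination - τ.P0 (τ.e ∘ k.succAbove) * neg_one_sq_pow (n := n) k
    rw [c1, c2, c3, c4, c5, c6, c7, c8] at hpl
    have hu : ((-1 : Pol n) ^ (k:ℕ) * (-1) ^ (i:ℕ)) ≠ 0 := by simp
    apply mul_left_cancel₀ hu
    linear_combination hpl
  · rintro c ⟨hc1, hc2⟩
    have hl1 : i.succAbove c ≠ j := by rw [← hbj]; exact fun h => hc1 (Fin.succAbove_right_injective h)
    have hl2 : i.succAbove c ≠ k := by rw [← hbk]; exact fun h => hc2 (Fin.succAbove_right_injective h)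
    have hJc : J c = τ.e (i.succAbove c) := by simp [hJ, Function.update_of_ne hl1]
    rw [hJc, alt_dup τ.P0_alt τ.e hl2 (by rw [hr]; exact Fin.succAbove_ne i c),
      alt_dup h.kalt τ.e hl2 (by rw [hr]; exact Fin.succAbove_ne i c)]
    ring

lemma Bc_self {R : Type*} [CommRing R] (e : Fin (q+1) → Fin n) (i : Fin (q+1)) (p : Fin n) (w : Ten R n q) :
    Bc e i i p w = 0 := by simp [Bc]

lemma Cyc.D (h : Cyc τ t R κ N) (i j k : Fin (q+1)) {p : Fin n} (hp : p ∉ Set.range τ.e) :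
    τ.A k * Bc τ.e i j p κ + τ.A i * Bc τ.e j k p κ + τ.A j * Bc τ.e k i p κ = 0 := by
  have ha := fun i j => Bc_anti τ.e h.kalt i j p
  by_cases hij : i = j
  · subst hij; rw [Bc_self, ha k i]; ring
  by_cases hik : i = k
  · subst hik; rw [Bc_self, ha j i]; ring
  by_cases hjk : j = k
  · subst hjk; rw [Bc_self, ha j i]; ring
  rw [h.D3 hij hik hjk hp, ha j k]; ring

end cyc

end NambuLin


namespace NambuLin

open MvPolynomial Finset
open scoped Nat Topology ContDiff

section cyc2
open Asymptotics Filter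
variable {n q : ℕ}

lemma Dv_hom {v : Fin n → Pol n} {f : Pol n} {a b c : ℕ} (hv : ∀ r, (v r).IsHomogeneous a)
    (hf : f.IsHomogeneous b) (hc : a + (b - 1) = c) : (Dv v f).IsHomogeneous c :=
  IsHomogeneous.sum _ _ _ fun r _ => hom_mul' (hv r) hf.pderiv hc

/-- polynomial version of the bracket expression -/
noncomputable def brp (A : Pol n) (X Y : Fin n → Pol n) (l : Fin n) : Pol n :=
  A * (Dv X (Y l) - Dv Y (X l)) - Dv X A * Y l + Dv Y A * X l

/-- linearization of the bracket expression -/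
noncomputable def brl (A0 A1 : Pol n) (X0 X1 Y0 Y1 : Fin n → Pol n) (l : Fin n) : Pol n :=
  A1 * (Dv X0 (Y0 l) - Dv Y0 (X0 l))
  + A0 * (Dv X1 (Y0 l) + Dv X0 (Y1 l) - Dv Y1 (X0 l) - Dv Y0 (X1 l))
  - (Dv X1 A0 * Y0 l + Dv X0 A1 * Y0 l + Dv X0 A0 * Y1 l)
  + (Dv Y1 A0 * X0 l + Dv Y0 A1 * X0 l + Dv Y0 A0 * X1 l)

lemma brl_zero {A0 A1 : Pol n} {X0 X1 Y0 Y1 : Fin n → Pol n} {N : ℕ} (hN : 2 ≤ N)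
    (hA0 : A0.IsHomogeneous 1) (hA1 : A1.IsHomogeneous N)
    (hX0 : ∀ r, (X0 r).IsHomogeneous 1) (hX1 : ∀ r, (X1 r).IsHomogeneous N)
    (hY0 : ∀ r, (Y0 r).IsHomogeneous 1) (hY1 : ∀ r, (Y1 r).IsHomogeneous N) (l : Fin n)
    (h : brp (A0 + A1) (X0 + X1) (Y0 + Y1) l ∈ Ord n (N+2)) : brl A0 A1 X0 X1 Y0 Y1 l = 0 := by
  have oA0 := ord_homog le_rfl hA0
  have oA1 := ord_homog le_rfl hA1
  have oX0 := fun r => ord_homog le_rfl (hX0 r)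
  have oX1 := fun r => ord_homog le_rfl (hX1 r)
  have oY0 := fun r => ord_homog le_rfl (hY0 r)
  have oY1 := fun r => ord_homog le_rfl (hY1 r)
  refine three (d0 := 2) (d1 := N+1) (by omega) (f := brp A0 X0 Y0 l)
    (r := A1 * (Dv X1 (Y0 l) + Dv X0 (Y1 l) - Dv Y1 (X0 l) - Dv Y0 (X1 l))
      + (A0 + A1) * (Dv X1 (Y1 l) - Dv Y1 (X1 l))
      - (Dv X1 A1 * (Y0 l + Y1 l) + Dv X0 A1 * Y1 l + Dv X1 A0 * Y1 l)
      + (Dv Y1 A1 * (X0 l + X1 l) + Dv Y0 A1 * X1 l + Dv Y1 A0 * X1 l)) ?_ ?_ ?_ ?_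
  · unfold brp
    exact (hom_sub (hom_mul' hA0 (hom_sub (Dv_hom hX0 (hY0 l) rfl) (Dv_hom hY0 (hX0 l) rfl)) rfl)
      (hom_mul' (Dv_hom hX0 hA0 rfl) (hY0 l) rfl)).add (hom_mul' (Dv_hom hY0 hA0 rfl) (hX0 l) rfl)
  · unfold brl
    refine (hom_sub (.add (hom_mul' hA1 (hom_sub (Dv_hom hX0 (hY0 l) rfl) (Dv_hom hY0 (hX0 l) rfl)) (by omega))
      (hom_mul' (b := N) hA0 (hom_sub (hom_sub (.add (Dv_hom hX1 (hY0 l) (by omega)) (Dv_hom hX0 (hY1 l) (by omega)))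
        (Dv_hom hY1 (hX0 l) (by omega))) (Dv_hom hY0 (hX1 l) (by omega))) (by omega)))
      (.add (.add (hom_mul' (Dv_hom hX1 hA0 rfl) (hY0 l) (by omega)) (hom_mul' (Dv_hom hX0 hA1 rfl) (hY0 l) (by omega)))
       (hom_mul' (Dv_hom hX0 hA0 rfl) (hY1 l) (by omega)))).add
       (.add (.add (hom_mul' (Dv_hom hY1 hA0 rfl) (hX0 l) (by omega)) (hom_mul' (Dv_hom hY0 hA1 rfl) (hX0 l) (by omega)))
       (hom_mul' (Dv_hom hY0 hA0 rfl) (hX1 l) (by omega)))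
  · refine add_mem (sub_mem (add_mem ?_ ?_) ?_) ?_
    · exact ord_mul' (l := N) (by omega) oA1 (sub_mem (sub_mem (add_mem (Dv_ord oX1 (oY0 l) (by omega)) (Dv_ord oX0 (oY1 l) (by omega)))
        (Dv_ord oY1 (oX0 l) (by omega))) (Dv_ord oY0 (oX1 l) (by omega)))
    · exact ord_mul' (k := 1) (l := N+1) (by omega) (add_mem oA0 (ord_mono (by omega) oA1))
        (sub_mem (Dv_ord oX1 (oY1 l) (by omega)) (Dv_ord oY1 (oX1 l) (by omega)))
    · refine add_mem (add_mem ?_ ?_) ?_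
      · exact ord_mul' (k := N+1) (l := 1) (by omega) (Dv_ord oX1 oA1 (by omega)) (add_mem (oY0 l) (ord_mono (by omega) (oY1 l)))
      · exact ord_mul' (k := N) (l := N) (by omega) (Dv_ord oX0 oA1 (by omega)) (oY1 l)
      · exact ord_mul' (k := N) (l := N) (by omega) (Dv_ord oX1 oA0 (by omega)) (oY1 l)
    · refine add_mem (add_mem ?_ ?_) ?_
      · exact ord_mul' (k := N+1) (l := 1) (by omega) (Dv_ord oY1 oA1 (by omega)) (add_mem (oX0 l) (ord_mono (by omega) (oX1 l)))
      · exact ord_mul' (k := N) (l := N) (by omega) (Dv_ord oY0 oA1 (by omega)) (oX1 l)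
      · exact ord_mul' (k := N) (l := N) (by omega) (Dv_ord oY1 oA0 (by omega)) (oX1 l)
  · convert h using 1
    unfold brp brl
    simp only [Dv_add_left, Pi.add_apply, Dv_add_right]
    ring

variable {τ : Top n (q+1)} {t : Fin q → Fin n} {R : (Fin n → ℝ) → Ten ℝ n q} {κ : Ten (Pol n) n q} {N : ℕ}

lemma Ac_add {R : Type*} [CommRing R] (e : Fin (q+1) → Fin n) (k : Fin (q+1)) (w v : Ten R n q) :
    Ac e k (w + v) = Ac e k w + Ac e k v := by simp [Ac, mul_add]

lemma Bc_add {R : Type*} [CommRing R] (e : Fin (q+1) → Fin n) (k i : Fin (q+1)) (p : Fin n) (w v : Ten R n q) :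
    Bc e k i p (w + v) = Bc e k i p w + Bc e k i p v := by
  unfold Bc; split_ifs <;> simp [mul_add]

lemma hom_sgn {f : Pol n} {d : ℕ} (k : ℕ) (hf : f.IsHomogeneous d) : ((-1) ^ k * f).IsHomogeneous d := by
  have : ((-1 : Pol n) ^ k) = C ((-1) ^ k) := by simp
  rw [this]
  exact hom_mul' (isHomogeneous_C _ _) hf (zero_add d)

lemma Ac_hom {w : Ten (Pol n) n q} {d : ℕ} (hw : ∀ j, (w j).IsHomogeneous d) (e : Fin (q+1) → Fin n) (k : Fin (q+1)) :
    (Ac e k w).IsHomogeneous d := hom_sgn _ (hw _)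

lemma Bc_hom {w : Ten (Pol n) n q} {d : ℕ} (hw : ∀ j, (w j).IsHomogeneous d) (e : Fin (q+1) → Fin n) (k i : Fin (q+1)) (p : Fin n) :
    (Bc e k i p w).IsHomogeneous d := by
  unfold Bc; split_ifs
  · exact isHomogeneous_zero _ _ _
  · exact hom_sgn _ (hw _)

lemma Cyc.app' (h : Cyc τ t R κ N) (j : Fin q → Fin n) : App 1 N (fun x => R x j) ((τ.P0 + κ) j) := h.app j

lemma app_sgn {c k : ℕ} {f : (Fin n → ℝ) → ℝ} {g : Pol n} (m : ℕ) (h : App c k f g) :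
    App c k (fun x => (-1) ^ m * f x) ((-1) ^ m * g) := by
  have := h.const_mul ((-1) ^ m)
  simpa using this

lemma Cyc.app_Ac (h : Cyc τ t R κ N) (m : Fin (q+1)) : App 1 N (fun x => Ac τ.e m (R x)) (Ac τ.e m (τ.P0 + κ)) :=
  app_sgn _ (h.app' _)

lemma Cyc.app_Bc (h : Cyc τ t R κ N) (m i : Fin (q+1)) (s : Fin n) :
    App 1 N (fun x => Bc τ.e m i s (R x)) (Bc τ.e m i s (τ.P0 + κ)) := by
  unfold Bc
  split_ifs
  · exact App.zero
  · exact app_sgn _ (h.app' _)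

lemma an_apply {R : (Fin n → ℝ) → Ten ℝ n q} {x : Fin n → ℝ} (h : AnalyticAt ℝ R x) (j : Fin q → Fin n) :
    AnalyticAt ℝ (fun x => R x j) x :=
  ((ContinuousLinearMap.proj j : (Ten ℝ n q →L[ℝ] ℝ)).analyticAt _).comp h

lemma an_Ac {R : (Fin n → ℝ) → Ten ℝ n q} {x : Fin n → ℝ} (h : AnalyticAt ℝ R x) (e : Fin (q+1) → Fin n) (k : Fin (q+1)) :
    AnalyticAt ℝ (fun x => Ac e k (R x)) x := analyticAt_const.mul (an_apply h _)

lemma an_Bc {R : (Fin n → ℝ) → Ten ℝ n q} {x : Fin n → ℝ} (h : AnalyticAt ℝ R x) (e : Fin (q+1) → Fin n) (k i : Fin (q+1))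
    (s : Fin n) : AnalyticAt ℝ (fun x => Bc e k i s (R x)) x := by
  unfold Bc
  split_ifs
  · exact analyticAt_const
  · exact analyticAt_const.mul (an_apply h _)

lemma Cyc.brl (h : Cyc τ t R κ N) (m i j : Fin (q+1)) (l : Fin n) :
    brl (Ac τ.e m τ.P0) (Ac τ.e m κ) (fun r => Bc τ.e m i r τ.P0) (fun r => Bc τ.e m i r κ)
      (fun r => Bc τ.e m j r τ.P0) (fun r => Bc τ.e m j r κ) l = 0 := by
  have hP := τ.P0_homog
  have hk := h.khom
  have hN := h.hN
  refine brl_zero h.hN (Ac_hom hP _ _) (Ac_hom hk _ _) (fun r => Bc_hom hP _ _ _ _) (fun r => Bc_hom hk _ _ _ _)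
    (fun r => Bc_hom hP _ _ _ _) (fun r => Bc_hom hk _ _ _ _) l ?_
  have e1 : ∀ i, ((fun r => Bc τ.e m i r τ.P0) + fun r => Bc τ.e m i r κ) = fun r => Bc τ.e m i r (τ.P0 + κ) := by
    intro i; funext r; rw [Bc_add]; rfl
  rw [e1, e1, ← Ac_add]
  refine ord_cancel (A0 := τ.A m) (A := Ac τ.e m (τ.P0 + κ)) ?_ (τ.A_ne m) ?_ ?_
  · rw [← τ.Ac_P0]; exact Ac_hom hP _ _
  · rw [Ac_add, τ.Ac_P0, add_sub_cancel_left]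
    exact ord_homog hN (Ac_hom hk _ _)
  · have hb : App 2 N (fun x => Ac τ.e m (R x) * (fderiv ℝ (fun y => Bc τ.e m j l (R y)) x (vX τ.e m i (R x))
          - fderiv ℝ (fun y => Bc τ.e m i l (R y)) x (vX τ.e m j (R x)))
        - fderiv ℝ (fun y => Ac τ.e m (R y)) x (vX τ.e m i (R x)) * Bc τ.e m j l (R x)
        + fderiv ℝ (fun y => Ac τ.e m (R y)) x (vX τ.e m j (R x)) * Bc τ.e m i l (R x))
        (brp (Ac τ.e m (τ.P0 + κ)) (fun r => Bc τ.e m i r (τ.P0 + κ)) (fun r => Bc τ.e m j r (τ.P0 + κ)) l) := by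
      have hA := h.app_Ac m
      have hB := h.app_Bc m
      have aA := an_Ac h.an τ.e m
      have aB := an_Bc h.an τ.e m
      have hv : ∀ i r, App 1 N (fun x => vX τ.e m i (R x) r) (Bc τ.e m i r (τ.P0 + κ)) := fun i r => hB i r
      exact ((hA.mul ((App.Dv (hv i) (hB j l) (aB j l)).sub (App.Dv (hv j) (hB i l) (aB i l)))).sub
        ((App.Dv (hv i) hA aA).mul (hB j l))).add ((App.Dv (hv j) hA aA).mul (hB i l))
    have := ((h.app_Ac m).mul hb).ord ?_
    · convert this using 2; omega
    · filter_upwards [h.nam, h.an.eventually_analyticAt] with x hx hax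
      by_cases hA : Ac τ.e m (R x) = 0
      · rw [hA, zero_mul]
      · have hne : R x ≠ 0 := by
          intro h0; apply hA; simp [h0, Ac]
        have hz := congrFun (brk_zero τ.e h.ht h.alt hax.differentiableAt (hx hne) m i j hA) l
        rw [brk_apply (diff_vX τ.e hax.differentiableAt m i) (diff_vX τ.e hax.differentiableAt m j)] at hz
        rw [mul_eq_zero]; right
        exact hz

lemma Dv_P0 (m i : Fin (q+1)) (f : Pol n) : Dv (fun r => Bc τ.e m i r τ.P0) f = τ.XX m i f := τ.sum_Bc_P0 m i f

lemma Dv_zero_right (v : Fin n → Pol n) : Dv v 0 = 0 := by simp [Dv]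

lemma XX_A_left {m i : Fin (q+1)} (h : m ≠ i) : τ.XX m i (τ.A m) = - (τ.se m * τ.A i) := by
  rw [τ.XX_A]; simp [Top.dl, h.symm]

lemma XX_A_other {m i j : Fin (q+1)} (h : m ≠ j) (h' : i ≠ j) : τ.XX m i (τ.A j) = 0 := by
  rw [τ.XX_A]; simp [Top.dl, h, h']

lemma Bc_P0_nontop (m i : Fin (q+1)) {p : Fin n} (hp : p ∉ Set.range τ.e) : Bc τ.e m i p τ.P0 = 0 := by
  by_cases h : m = i
  · simp [Bc, h]
  rw [τ.Bc_P0 h, if_neg, if_neg, sub_zero]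
  · rintro rfl; exact hp ⟨_, rfl⟩
  · rintro rfl; exact hp ⟨_, rfl⟩

lemma Cyc.J (h : Cyc τ t R κ N) (i j k : Fin (q+1)) (hki : k ≠ i) (hkj : k ≠ j) {p : Fin n} (hp : p ∉ Set.range τ.e) :
    τ.XX k i (Bc τ.e k j p κ) - τ.XX k j (Bc τ.e k i p κ) = - (τ.se k * Bc τ.e i j p κ) := by
  have hb := h.brl k i j p
  have hD := h.D i j k hp
  unfold NambuLin.brl at hb
  simp only [Bc_P0_nontop _ _ hp, Dv_zero_right, Dv_P0, τ.Ac_P0, XX_A_left hki, XX_A_left hkj] at hb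
  rw [Bc_anti τ.e h.kalt j k] at hD
  apply mul_left_cancel₀ (τ.A_ne k)
  linear_combination hb + τ.se k * hD

lemma Dv_A (v : Fin n → Pol n) (j : Fin (q+1)) : Dv v (τ.A j) = v (τ.e j) * τ.se j := by
  unfold Dv
  rw [Finset.sum_eq_single (τ.e j)]
  · simp [Top.A, Top.se]
  · intro r _ hr
    simp [Top.A, pderiv_X, Pi.single_apply, Ne.symm hr]
  · simp

lemma Cyc.Y (h : Cyc τ t R κ N) : τ.Y (fun k => Ac τ.e k κ) := by
  intro i j m
  show τ.XX m i (Ac τ.e j κ) + τ.XX i j (Ac τ.e m κ) + τ.XX j m (Ac τ.e i κ) = 0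
  by_cases hij : i = j
  · subst hij; rw [τ.XX_self, τ.XX_anti' m i]; simp
  by_cases hmi : m = i
  · subst hmi; rw [τ.XX_self, τ.XX_anti' m j]; simp
  by_cases hmj : m = j
  · subst hmj; rw [τ.XX_self, τ.XX_anti' m i]; simp
  have hb := h.brl m i j (τ.e m)
  unfold NambuLin.brl at hb
  simp only [Bc_k τ.e τ.P0_alt hmi, Bc_k τ.e τ.P0_alt hmj, Bc_k τ.e h.kalt hmi, Bc_k τ.e h.kalt hmj, Dv_P0, τ.Ac_P0,
    Dv_neg_right, Dv_A, XX_A_left hmi, XX_A_left hmj, map_neg, XX_A_other hmj hij, XX_A_other hmi (Ne.symm hij),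
    Bc_l τ.e h.kalt (Ne.symm hmj) (Ne.symm hij), Bc_l τ.e h.kalt (Ne.symm hmi) hij,
    Bc_l τ.e τ.P0_alt (Ne.symm hmj) (Ne.symm hij), Bc_l τ.e τ.P0_alt (Ne.symm hmi) hij] at hb
  apply mul_left_cancel₀ (τ.A_ne m)
  rw [τ.XX_anti' j m, τ.XX_apply i j]
  simp only [τ.XX_apply m i (Ac τ.e m κ), τ.XX_apply m j (Ac τ.e m κ)] at hb
  linear_combination -hb

end cyc2

end NambuLin


namespace NambuLin

open MvPolynomial Finset
open scoped Nat Topology ContDiff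

namespace Top
variable {n q : ℕ} (τ : Top n (q+1))

lemma LZ_add (Z W : Fin n → Pol n) : τ.LZ (Z + W) = τ.LZ Z + τ.LZ W := by
  funext j
  simp only [LZ, Pi.add_apply, map_add, add_mul, Finset.sum_add_distrib]
  ring

lemma LZ_smul (c : ℝ) (Z : Fin n → Pol n) : τ.LZ (c • Z) = (C c : Pol n) • τ.LZ Z := by
  funext j
  simp only [LZ, Pi.smul_apply, smul_eq_C_mul, pderiv_C_mul, smul_eq_mul, mul_sub, Finset.mul_sum, mul_assoc]

lemma LZ_zero : τ.LZ 0 = 0 := by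
  funext j
  simp [LZ]

lemma LZ_sum {ι : Type*} (s : Finset ι) (Z : ι → Fin n → Pol n) : τ.LZ (∑ i ∈ s, Z i) = ∑ i ∈ s, τ.LZ (Z i) := by
  classical
  induction s using Finset.induction_on with
  | empty => simp [LZ_zero]
  | insert a s ha ih => rw [Finset.sum_insert ha, Finset.sum_insert ha, LZ_add, ih]

lemma LZ_hom {d : ℕ} (hd : 1 ≤ d) {Z : Fin n → Pol n} (hZ : ∀ i, (Z i).IsHomogeneous d) (j : Fin q → Fin n) :
    (τ.LZ Z j).IsHomogeneous d := by
  unfold LZ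
  refine hom_sub (IsHomogeneous.sum _ _ _ fun i _ => hom_mul' (hZ i) (τ.P0_homog j).pderiv (by omega)) ?_
  exact IsHomogeneous.sum _ _ _ fun a _ => IsHomogeneous.sum _ _ _ fun l _ =>
    hom_mul' (hZ _).pderiv (τ.P0_homog _) (by omega)

/-- normalization condition for the homogeneous vector fields -/
def Nrm (d : ℕ) (Z : Fin n → Pol n) : Prop :=
  τ.Y (fun i => τ.se i * Z (τ.e i)) ∧ ∀ p, p ∉ Set.range τ.e → τ.Perp d (Z p)

lemma Y_comb {m : ℕ} (τ : Top n m) {a b : Fin m → Pol n} (ha : τ.Y a) (hb : τ.Y b) (c : ℝ) : τ.Y (fun i => a i - C c * b i) := by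
  intro i j k
  have h1 := ha i j k
  have h2 := hb i j k
  simp only [map_sub, ← smul_eq_C_mul, Derivation.map_smul]
  rw [smul_eq_C_mul, smul_eq_C_mul, smul_eq_C_mul]
  linear_combination h1 - C c * h2

lemma Ac_smul (e : Fin (q+1) → Fin n) (k : Fin (q+1)) (c : Pol n) (w : Ten (Pol n) n q) :
    Ac e k (c • w) = c * Ac e k w := by simp [Ac]; ring

lemma Bc_smul (e : Fin (q+1) → Fin n) (k i : Fin (q+1)) (p : Fin n) (c : Pol n) (w : Ten (Pol n) n q) :
    Bc e k i p (c • w) = c * Bc e k i p w := by unfold Bc; split_ifs <;> simp; ring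

lemma Ac_sub (e : Fin (q+1) → Fin n) (k : Fin (q+1)) (w v : Ten (Pol n) n q) :
    Ac e k (w - v) = Ac e k w - Ac e k v := by simp [Ac, mul_sub]

lemma Bc_sub (e : Fin (q+1) → Fin n) (k i : Fin (q+1)) (p : Fin n) (w v : Ten (Pol n) n q) :
    Bc e k i p (w - v) = Bc e k i p w - Bc e k i p v := by
  unfold Bc; split_ifs <;> simp [mul_sub]

/-- solution of the homological equation with prescribed normalization -/
lemma hom_step (hq : 2 ≤ q) {t : Fin q → Fin n} {R : (Fin n → ℝ) → Ten ℝ n q} {κ : Ten (Pol n) n q} {N : ℕ}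
    (h : Cyc τ t R κ N) (c : ℝ) {W : Fin n → Pol n} (hW : ∀ i, (W i).IsHomogeneous N) :
    ∃ Z : Fin n → Pol n, (∀ i, (Z i).IsHomogeneous N) ∧ τ.Nrm N Z ∧ τ.LZ Z = τ.LZ W - (C c : Pol n) • κ := by
  classical
  have hN := h.hN
  set K := τ.LZ W - (C c : Pol n) • κ with hK
  have hKalt : IsAlt K := (τ.LZ_alt W).sub (h.kalt.smul _)
  have hKhom : ∀ j, (K j).IsHomogeneous N := fun j => hom_sub (τ.LZ_hom (by omega) hW j)
    (hom_mul' (isHomogeneous_C _ _) (h.khom j) (zero_add N))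
  have hAY : τ.Y (fun k => Ac τ.e k K) := by
    have := τ.Y_comb (τ.T_Y (fun i => τ.se i * W (τ.e i))) h.Y c
    convert this using 2 with k
    rw [hK, Ac_sub, Ac_smul, τ.Ac_LZ]
  obtain ⟨z, hzY, hzh, hzT⟩ := τ.T_surj (by omega) hAY (fun j => Ac_hom hKhom _ j)
  have hy : ∀ p, ∃ w : Pol n, p ∉ Set.range τ.e → w.IsHomogeneous N ∧ τ.Perp N w ∧
      ∀ k l, τ.XX k l w = τ.XX k l (W p) + C c * Bc τ.e k l p κ := by
    intro p
    by_cases hp : p ∈ Set.range τ.e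
    · exact ⟨0, fun h => absurd hp h⟩
    obtain ⟨v, hv1, -, hv3⟩ := τ.y_solve (by omega) (fun k l => Bc τ.e k l p κ) (fun i j => Bc_hom h.khom _ _ _ _)
      (fun i j => Bc_anti τ.e h.kalt i j p) (fun i j k => h.D i j k hp) (fun i j k h1 h2 => h.J i j k h1 h2 hp)
    obtain ⟨w, hw1, hw2, hw3⟩ := τ.y_proj (by omega) ((hW p).add (hom_mul' (isHomogeneous_C _ c) hv1 (zero_add N)))
    refine ⟨w, fun _ => ⟨hw1, hw2, fun k l => ?_⟩⟩
    rw [hw3, map_add, ← smul_eq_C_mul, Derivation.map_smul, ← hv3, smul_eq_C_mul]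
  choose w hw using hy
  let Z : Fin n → Pol n := fun r => if hr : r ∈ Set.range τ.e then τ.se hr.choose * z hr.choose else w r
  have hZe : ∀ i, Z (τ.e i) = τ.se i * z i := by
    intro i
    have hr : τ.e i ∈ Set.range τ.e := ⟨i, rfl⟩
    simp only [Z, dif_pos hr]
    rw [τ.inj hr.choose_spec]
  have hZp : ∀ p, p ∉ Set.range τ.e → Z p = w p := fun p hp => by simp only [Z, dif_neg hp]
  have hsz : (fun i => τ.se i * Z (τ.e i)) = z := by
    funext i
    rw [hZe, ← mul_assoc, τ.se_sq, one_mul]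
  refine ⟨Z, fun r => ?_, ⟨by rw [hsz]; exact hzY, fun p hp => by rw [hZp p hp]; exact (hw p hp).2.1⟩, ?_⟩
  · by_cases hr : r ∈ Set.range τ.e
    · obtain ⟨i, rfl⟩ := hr
      rw [hZe]
      exact hom_mul' (isHomogeneous_C _ _) (hzh i) (zero_add N)
    · rw [hZp r hr]; exact (hw r hr).1
  · rw [← sub_eq_zero]
    refine ten_ext0 τ.e ((τ.LZ_alt Z).sub hKalt) ?_ ?_ ?_
    · intro k
      rw [Ac_sub, τ.Ac_LZ, hsz, hzT, sub_self]
    · intro k i p hp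
      rw [Bc_sub, τ.Bc_LZ _ _ _ hp, hZp p hp, (hw p hp).2.2, hK, Bc_sub, τ.Bc_LZ _ _ _ hp, Bc_smul]
      ring
    · intro j a b hab ha hb
      rw [Pi.sub_apply, hK, Pi.sub_apply, τ.LZ_two Z hab ha hb, τ.LZ_two W hab ha hb, Pi.smul_apply, h.two hab ha hb]
      simp

lemma bom_sgn (d k : ℕ) (f : Pol n) : bom d ((-1) ^ k * f) = bom d f := by
  have : ((-1 : Pol n) ^ k) = C ((-1) ^ k) := by simp
  rw [this, bom_C_mul]; simp

lemma bom_Ac_le (e : Fin (q+1) → Fin n) (d : ℕ) (k : Fin (q+1)) (w : Ten (Pol n) n q) :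
    bom d (Ac e k w) ≤ ∑ j, bom d (w j) := by
  unfold Ac
  rw [bom_sgn]
  exact Finset.single_le_sum (f := fun j => bom d (w j)) (fun j _ => bom_nonneg _ _) (mem_univ _)

lemma bom_Bc_le (e : Fin (q+1) → Fin n) (d : ℕ) (k i : Fin (q+1)) (p : Fin n) (w : Ten (Pol n) n q) :
    bom d (Bc e k i p w) ≤ ∑ j, bom d (w j) := by
  unfold Bc
  split_ifs
  · rw [bom_zero]; exact Finset.sum_nonneg fun j _ => bom_nonneg _ _
  rw [bom_sgn]
  exact Finset.single_le_sum (f := fun j => bom d (w j)) (fun j _ => bom_nonneg _ _) (mem_univ _)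

/-- the estimate of the normalized solution -/
lemma nrm_bound (hq : 2 ≤ q) {d : ℕ} {Z : Fin n → Pol n} (hZ : ∀ i, (Z i).IsHomogeneous d) (hd : 1 ≤ d)
    (hn : τ.Nrm d Z) (r : Fin n) : bom d (Z r) ≤ (q+1) * ∑ j, bom d (τ.LZ Z j) := by
  set B := ∑ j, bom d (τ.LZ Z j) with hB
  have hB0 : 0 ≤ B := Finset.sum_nonneg fun j _ => bom_nonneg _ _
  have hf : (0:ℝ) < (d ! : ℝ) := by exact_mod_cast Nat.factorial_pos d
  have hLh := τ.LZ_hom hd hZ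
  have hfb : ∀ {f : Pol n}, f.IsHomogeneous d → fis f f = d ! * bom d f ^ 2 := by
    intro f hf'
    rw [bom_sq_fis hf']; field_simp
  apply le_of_sq_le_sq _ (by positivity)
  by_cases hr : r ∈ Set.range τ.e
  · obtain ⟨i, rfl⟩ := hr
    have hh : ∀ j, (τ.se j * Z (τ.e j)).IsHomogeneous d := fun j =>
      hom_mul' (isHomogeneous_C _ _) (hZ _) (zero_add d)
    have h1 := τ.T_bound (by omega) hn.1 hh
    simp only [← τ.Ac_LZ] at h1
    have h2 : bom d (Z (τ.e i)) = bom d (τ.se i * Z (τ.e i)) := by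
      rw [se, bom_C_mul]
      have : |τ.s i| = 1 := by
        have := τ.sq i
        rw [← abs_mul_abs_self] at this
        nlinarith [abs_nonneg (τ.s i)]
      rw [this, one_mul]
    have h3 : fis (τ.se i * Z (τ.e i)) (τ.se i * Z (τ.e i)) ≤ ∑ j, fis (τ.se j * Z (τ.e j)) (τ.se j * Z (τ.e j)) :=
      Finset.single_le_sum (f := fun j => fis (τ.se j * Z (τ.e j)) (τ.se j * Z (τ.e j)))
        (fun j _ => fis_self_nonneg _) (mem_univ _)
    have h4 : ∑ j, fis (Ac τ.e j (τ.LZ Z)) (Ac τ.e j (τ.LZ Z)) ≤ ∑ j : Fin (q+1), (d ! : ℝ) * B ^ 2 := by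
      apply Finset.sum_le_sum
      intro j _
      rw [hfb (Ac_hom hLh _ _)]
      exact mul_le_mul_of_nonneg_left (pow_le_pow_left₀ (bom_nonneg _ _) (bom_Ac_le _ _ _ _) 2) hf.le
    rw [hfb (hh i)] at h3
    simp only [sum_const, card_univ, Fintype.card_fin, nsmul_eq_mul] at h4
    rw [h2]
    have h5 : (d ! : ℝ) * bom d (τ.se i * Z (τ.e i)) ^ 2 ≤ d ! * ((q+1) * B ^ 2) := by
      push_cast at h4; linarith
    have h6 := le_of_mul_le_mul_left h5 hf
    have h7 : (0:ℝ) ≤ q := by positivity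
    nlinarith [mul_nonneg h7 (sq_nonneg B), mul_nonneg (mul_nonneg h7 h7) (sq_nonneg B)]
  · have h1 := τ.y_bound (by omega) (hZ r) (hn.2 r hr)
    have h2 : ∀ k l, fis (τ.XX k l (Z r)) (τ.XX k l (Z r)) ≤ (d ! : ℝ) * B ^ 2 := by
      intro k l
      have e1 : τ.XX k l (Z r) = - Bc τ.e k l r (τ.LZ Z) := by rw [τ.Bc_LZ _ _ _ hr, neg_neg]
      rw [e1, hfb (hom_neg (Bc_hom hLh _ _ _ _)), bom_neg]
      exact mul_le_mul_of_nonneg_left (pow_le_pow_left₀ (bom_nonneg _ _) (bom_Bc_le _ _ _ _ _ _) 2) hf.le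
    have h4 : ∑ k, ∑ l, fis (τ.XX k l (Z r)) (τ.XX k l (Z r)) ≤ ∑ _k : Fin (q+1), ∑ _l : Fin (q+1), (d ! : ℝ) * B ^ 2 :=
      Finset.sum_le_sum fun k _ => Finset.sum_le_sum fun l _ => h2 k l
    simp only [sum_const, card_univ, Fintype.card_fin, nsmul_eq_mul] at h4
    rw [hfb (hZ r)] at h1
    push_cast at h4
    have h5 : (d ! : ℝ) * (4 * bom d (Z r) ^ 2) ≤ d ! * (((q+1) * B) ^ 2) := by nlinarith
    have h6 := le_of_mul_le_mul_left h5 hf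
    nlinarith [sq_nonneg (bom d (Z r))]

end Top

end NambuLin


namespace NambuLin

open MvPolynomial Finset
open scoped Nat Topology ContDiff

section formal
variable {n q : ℕ}

lemma bind_ord {ψ : Fin n → Pol n} (hψ : ∀ i, ψ i ∈ Ord n 1) {k : ℕ} {f : Pol n} (hf : f ∈ Ord n k) :
    bind₁ ψ f ∈ Ord n k := by
  have h1 : (idealOfVars (Fin n) ℝ).map (bind₁ ψ) ≤ idealOfVars (Fin n) ℝ := by
    unfold idealOfVars
    rw [Ideal.map_span, Ideal.span_le]
    rintro _ ⟨_, ⟨i, rfl⟩, rfl⟩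
    have := hψ i
    rw [Ord, pow_one] at this
    simpa using this
  have h2 := Ideal.mem_map_of_mem (bind₁ ψ) hf
  rw [Ord, Ideal.map_pow] at h2
  exact Ideal.pow_right_mono h1 k h2

lemma prod_sub_mem {R ι : Type*} [CommRing R] (I : Ideal R) (s : Finset ι) {f g : ι → R}
    (h : ∀ a ∈ s, f a - g a ∈ I) : ∏ a ∈ s, f a - ∏ a ∈ s, g a ∈ I := by
  rw [← Ideal.Quotient.eq, map_prod, map_prod]
  exact Finset.prod_congr rfl fun a ha => Ideal.Quotient.eq.2 (h a ha)

lemma bind_update {ψ u : Fin n → Pol n} {N : ℕ} (hN : 1 ≤ N) (hu : ∀ i, u i ∈ Ord n N) (f : Pol n) :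
    bind₁ (ψ + u) f - bind₁ ψ f - ∑ i, u i * bind₁ ψ (pderiv i f) ∈ Ord n (N+1) := by
  induction f using MvPolynomial.induction_on with
  | C c => simp
  | add f g hf hg =>
    have := Ideal.add_mem _ hf hg
    convert this using 1
    simp only [map_add, mul_add, Finset.sum_add_distrib]; ring
  | mul_X f k ih =>
    have hs : ∑ i, u i * bind₁ ψ (pderiv i f) ∈ Ord n N := Ideal.sum_mem _ fun i _ => Ideal.mul_mem_right _ _ (hu i)
    have h1 : bind₁ (ψ + u) f - bind₁ ψ f ∈ Ord n N := by
      have := Ideal.add_mem _ (ord_mono (by omega : N ≤ N + 1) ih) hs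
      simpa using this
    have h2 : ∑ i, u i * bind₁ ψ (pderiv i (f * X k)) = ψ k * ∑ i, u i * bind₁ ψ (pderiv i f) + u k * bind₁ ψ f := by
      have : ∀ i, u i * bind₁ ψ (pderiv i (f * X k)) = ψ k * (u i * bind₁ ψ (pderiv i f)) +
          if i = k then u i * bind₁ ψ f else 0 := by
        intro i
        rw [Derivation.leibniz, pderiv_X]
        by_cases h : i = k
        · subst h; simp; ring
        · simp [h, Pi.single_apply, Ne.symm h]; ring
      simp only [this, Finset.sum_add_distrib, Finset.mul_sum, Finset.sum_ite_eq', mem_univ, if_true]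
    rw [h2]
    have h3 := Ideal.add_mem _ (Ideal.mul_mem_left _ (ψ k) ih) (ord_mul' (by omega : N + 1 ≤ N + N) (hu k) h1)
    convert h3 using 1
    simp only [map_mul, bind₁_X_right, Pi.add_apply]; ring

lemma prod_update_mem {ι : Type*} [DecidableEq ι] {N : ℕ} (hN : 2 ≤ N) (s : Finset ι) {f g e : ι → Pol n}
    (hfg : ∀ a, f a - g a ∈ Ord n 1) (he : ∀ a, e a ∈ Ord n (N-1)) :
    ∏ a ∈ s, (f a + e a) - ∏ a ∈ s, f a - ∑ a ∈ s, e a * ∏ b ∈ s.erase a, g b ∈ Ord n N := by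
  induction s using Finset.induction_on with
  | empty => simp
  | insert c s hc ih =>
    have h1 : ∏ a ∈ s, (f a + e a) - ∏ a ∈ s, f a ∈ Ord n (N-1) :=
      prod_sub_mem _ s fun a _ => by simpa using he a
    have h2 : ∏ a ∈ s, f a - ∏ a ∈ s, g a ∈ Ord n 1 := prod_sub_mem _ s fun a _ => hfg a
    have h3 : ∑ a ∈ s, e a * ∏ b ∈ (insert c s).erase a, g b = g c * ∑ a ∈ s, e a * ∏ b ∈ s.erase a, g b := by
      rw [Finset.mul_sum]
      refine Finset.sum_congr rfl fun a ha => ?_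
      have : (insert c s).erase a = insert c (s.erase a) := by
        rw [Finset.erase_insert_of_ne]; rintro rfl; exact hc ha
      rw [this, Finset.prod_insert (by simp [hc])]; ring
    have h5 : ∑ a ∈ s, e a * ∏ b ∈ s.erase a, g b ∈ Ord n (N-1) :=
      Ideal.sum_mem _ fun a _ => Ideal.mul_mem_right _ _ (he a)
    rw [Finset.prod_insert hc, Finset.prod_insert hc, Finset.sum_insert hc, h3, Finset.erase_insert hc]
    have h4 := Ideal.add_mem _ (Ideal.add_mem _ (Ideal.mul_mem_left _ (f c) ih)
      (ord_mul' (by omega : N ≤ 1 + (N-1)) (hfg c) h5))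
      (Ideal.add_mem _ (ord_mul' (by omega : N ≤ (N-1) + (N-1)) (he c) h1) (ord_mul' (by omega : N ≤ (N-1)+1) (he c) h2))
    convert h4 using 1
    ring

lemma slot_delta {R : Type*} [CommRing R] (j : Fin q → Fin n) (a : Fin q) (e : Fin n → R) (w : Ten R n q) :
    ∑ i : Fin q → Fin n, e (i a) * (∏ b ∈ univ.erase a, (1 : Matrix (Fin n) (Fin n) R) (j b) (i b)) * w i =
    ∑ l, e l * w (Function.update j a l) := by
  symm
  apply Fintype.sum_of_injective (fun l => Function.update j a l) (Function.update_injective j a)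
  · intro i hi
    have : ∃ b, b ≠ a ∧ j b ≠ i b := by
      by_contra! hc
      apply hi
      refine ⟨i a, ?_⟩
      funext b
      by_cases hb : b = a
      · subst hb; simp
      · simp [hb, hc b hb]
    obtain ⟨b, hb, hb'⟩ := this
    have h0 : ∏ b ∈ univ.erase a, (1 : Matrix (Fin n) (Fin n) R) (j b) (i b) = 0 :=
      Finset.prod_eq_zero (mem_erase.2 ⟨hb, mem_univ b⟩) (Matrix.one_apply_ne hb')
    rw [h0]; simp
  · intro l
    have : ∏ b ∈ univ.erase a, (1 : Matrix (Fin n) (Fin n) R) (j b) (Function.update j a l b) = 1 := by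
      apply Finset.prod_eq_one
      intro b hb
      rw [Function.update_of_ne (ne_of_mem_erase hb), Matrix.one_apply_eq]
    rw [this]; simp

lemma act_update {N : ℕ} (hN : 2 ≤ N) {J E : Matrix (Fin n) (Fin n) (Pol n)} (hJ : ∀ i j, J i j - (1 : Matrix _ _ _) i j ∈ Ord n 1)
    (hE : ∀ i j, E i j ∈ Ord n (N-1)) {w : Ten (Pol n) n q} (hw : ∀ i, w i ∈ Ord n 1) (j : Fin q → Fin n) :
    act (J + E) w j - act J w j - ∑ a, ∑ l, E (j a) l * w (Function.update j a l) ∈ Ord n (N+1) := by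
  have h1 : ∑ a, ∑ l, E (j a) l * w (Function.update j a l) =
      ∑ i : Fin q → Fin n, (∑ a, E (j a) (i a) * ∏ b ∈ univ.erase a, (1 : Matrix (Fin n) (Fin n) (Pol n)) (j b) (i b)) * w i := by
    simp only [← slot_delta, Finset.sum_mul]
    rw [Finset.sum_comm]
  rw [h1]
  unfold act
  rw [← Finset.sum_sub_distrib, ← Finset.sum_sub_distrib]
  refine Ideal.sum_mem _ fun i _ => ?_
  have := ord_mul (prod_update_mem hN univ (f := fun a => J (j a) (i a)) (g := fun a => (1 : Matrix _ _ _) (j a) (i a))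
    (e := fun a => E (j a) (i a)) (fun a => hJ _ _) (fun a => hE _ _)) (hw i)
  convert this using 1
  simp only [Matrix.add_apply]; ring

lemma act_ord {k m : ℕ} {J J' : Matrix (Fin n) (Fin n) (Pol n)} (hJ : ∀ i j, J i j - J' i j ∈ Ord n k)
    {w : Ten (Pol n) n q} (hw : ∀ i, w i ∈ Ord n m) (j : Fin q → Fin n) : act J w j - act J' w j ∈ Ord n (k+m) := by
  unfold act
  rw [← Finset.sum_sub_distrib]
  refine Ideal.sum_mem _ fun i _ => ?_
  rw [← sub_mul]
  exact ord_mul (prod_sub_mem _ _ fun a _ => hJ _ _) (hw i)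

lemma Dv_add' (v : Fin n → Pol n) (f g : Pol n) : Dv v (f + g) = Dv v f + Dv v g := by
  simp [Dv, mul_add, Finset.sum_add_distrib]

lemma Dv_sub' (v : Fin n → Pol n) (f g : Pol n) : Dv v (f - g) = Dv v f - Dv v g := by
  simp [Dv, mul_sub, Finset.sum_sub_distrib]

lemma Dv_sum' {ι : Type*} (v : Fin n → Pol n) (s : Finset ι) (f : ι → Pol n) : Dv v (∑ i ∈ s, f i) = ∑ i ∈ s, Dv v (f i) := by
  simp only [Dv, map_sum, Finset.mul_sum]
  rw [Finset.sum_comm]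

lemma Dv_mul' (v : Fin n → Pol n) (f g : Pol n) : Dv v (f * g) = f * Dv v g + g * Dv v f := by
  simp only [Dv, Derivation.leibniz, smul_eq_mul, Finset.mul_sum, ← Finset.sum_add_distrib]
  exact Finset.sum_congr rfl fun i _ => by ring

lemma Dv_X (v : Fin n → Pol n) (i : Fin n) : Dv v (X i) = v i := by
  simp [Dv, pderiv_X, Pi.single_apply]

lemma Dv_C (v : Fin n → Pol n) (c : ℝ) : Dv v (C c) = 0 := by
  simp [Dv]

lemma Dv_prod' {ι : Type*} [DecidableEq ι] (v : Fin n → Pol n) (s : Finset ι) (f : ι → Pol n) :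
    Dv v (∏ a ∈ s, f a) = ∑ a ∈ s, Dv v (f a) * ∏ b ∈ s.erase a, f b := by
  induction s using Finset.induction_on with
  | empty => simpa using Dv_C v 1
  | insert c s hc ih =>
    rw [Finset.prod_insert hc, Dv_mul', Finset.sum_insert hc, Finset.erase_insert hc, ih, Finset.mul_sum, add_comm]
    congr 1
    · ring
    · refine Finset.sum_congr rfl fun a ha => ?_
      have : (insert c s).erase a = insert c (s.erase a) := by
        rw [Finset.erase_insert_of_ne]; rintro rfl; exact hc ha
      rw [this, Finset.prod_insert (by simp [hc])]; ring

lemma Dv_bind (v ψ : Fin n → Pol n) (f : Pol n) : Dv v (bind₁ ψ f) = ∑ i, bind₁ ψ (pderiv i f) * Dv v (ψ i) := by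
  induction f using MvPolynomial.induction_on with
  | C c => simp [Dv_C]
  | add f g hf hg => simp only [map_add, Dv_add', hf, hg, add_mul, Finset.sum_add_distrib]
  | mul_X f k ih =>
    rw [map_mul, Dv_mul', ih, bind₁_X_right, Finset.mul_sum]
    have : ∀ i, bind₁ ψ (pderiv i (f * X k)) * Dv v (ψ i) = (if i = k then bind₁ ψ f * Dv v (ψ i) else 0) +
        ψ k * (bind₁ ψ (pderiv i f) * Dv v (ψ i)) := by
      intro i
      rw [Derivation.leibniz, pderiv_X]
      by_cases h : i = k
      · subst h; simp; ring
      · simp [h, Pi.single_apply, Ne.symm h]; ring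
    simp only [this, Finset.sum_add_distrib, Finset.sum_ite_eq', mem_univ, if_true]

lemma Dv_ord1 {v : Fin n → Pol n} (hv : ∀ i, v i ∈ Ord n 1) {k : ℕ} {f : Pol n} (hf : f ∈ Ord n k) : Dv v f ∈ Ord n k := by
  refine Ideal.sum_mem _ fun i _ => ?_
  cases k with
  | zero => exact ord_zero_mem _
  | succ k => exact ord_mul' (by omega) (hv i) (ord_pderiv i hf)

lemma reindex_slot {R : Type*} [CommRing R] (a : Fin q) (F : (Fin q → Fin n) → Fin n → R) :
    ∑ i, ∑ l, F i l = ∑ i, ∑ l, F (Function.update i a l) (i a) := by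
  rw [← Finset.sum_product', ← Finset.sum_product']
  refine Finset.sum_bij' (fun p _ => (Function.update p.1 a p.2, p.1 a)) (fun p _ => (Function.update p.1 a p.2, p.1 a)) ?_ ?_ ?_ ?_ ?_
  all_goals simp

end formal

end NambuLin


namespace NambuLin

open MvPolynomial Finset
open scoped Nat Topology ContDiff

section formal
variable {n q : ℕ}

lemma pd_comm (i j : Fin n) (f : Pol n) : pderiv i (pderiv j f) = pderiv j (pderiv i f) := by
  ext α
  simp only [coeff_pderiv]
  rw [add_right_comm]
  by_cases h : i = j
  · subst h; rfl
  · simp [h, Ne.symm h]; ring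

/-- Taylor components of the structure -/
structure Dat (τ : Top n (q+1)) (p : ℕ → Ten (Pol n) n q) : Prop where
  hom : ∀ d j, (p d j).IsHomogeneous d
  alt : ∀ d, IsAlt (p d)
  p0 : p 0 = 0
  p1 : p 1 = τ.P0

noncomputable def psum (p : ℕ → Ten (Pol n) n q) (D : ℕ) : Ten (Pol n) n q := fun j => ∑ d ∈ range (D+1), p d j

/-- the map `id + v` -/
noncomputable def ps (v : Fin n → Pol n) : Fin n → Pol n := fun i => X i + v i

noncomputable def JJ (v : Fin n → Pol n) : Matrix (Fin n) (Fin n) (Pol n) := Matrix.of fun i j => pderiv j (ps v i)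

noncomputable def GG (τ : Top n (q+1)) (p : ℕ → Ten (Pol n) n q) (D : ℕ) (v : Fin n → Pol n) : Ten (Pol n) n q :=
  fun j => bind₁ (ps v) (psum p D j) - act (JJ v) τ.P0 j

structure St (τ : Top n (q+1)) (p : ℕ → Ten (Pol n) n q) (D : ℕ) (v Z : Fin n → Pol n) : Prop where
  v2 : ∀ i, v i ∈ Ord n 2
  Z2 : ∀ i, Z i ∈ Ord n 2
  vdeg : ∀ i d, D < d → homogeneousComponent d (v i) = 0
  Zdeg : ∀ i d, D < d → homogeneousComponent d (Z i) = 0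
  eq : ∀ j, GG τ p D v j ∈ Ord n (D+1)
  rel : ∀ i, Dv (fun l => X l - Z l) (ps v i) - ps v i ∈ Ord n (D+1)
  nrm : ∀ d, 1 ≤ d → d ≤ D → τ.Nrm d (fun i => homogeneousComponent d (Z i))

variable {τ : Top n (q+1)} {p : ℕ → Ten (Pol n) n q}

lemma X_ord (i : Fin n) : (X i : Pol n) ∈ Ord n 1 := ord_homog le_rfl (isHomogeneous_X _ _)

lemma ps_ord {v : Fin n → Pol n} (hv : ∀ i, v i ∈ Ord n 2) (i : Fin n) : ps v i ∈ Ord n 1 :=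
  add_mem (X_ord i) (ord_mono (by omega) (hv i))

lemma JJ_apply (v : Fin n → Pol n) (i j : Fin n) : JJ v i j = (1 : Matrix _ _ _) i j + pderiv j (v i) := by
  simp only [JJ, ps, Matrix.of_apply, map_add, pderiv_X]
  congr 1
  by_cases h : i = j
  · subst h; simp
  · simp [h, Pi.single_apply, Ne.symm h]

lemma JJ_ord {v : Fin n → Pol n} (hv : ∀ i, v i ∈ Ord n 2) (i j : Fin n) : JJ v i j - (1 : Matrix _ _ _) i j ∈ Ord n 1 := by
  rw [JJ_apply, add_sub_cancel_left]
  exact ord_pderiv' (by omega) j (hv i)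

lemma P0_ord (j : Fin q → Fin n) : τ.P0 j ∈ Ord n 1 := ord_homog le_rfl (τ.P0_homog j)

lemma psum_sub (hp : Dat τ p) {D : ℕ} (hD : 1 ≤ D) (j : Fin q → Fin n) : psum p D j - τ.P0 j ∈ Ord n 2 := by
  unfold psum
  rw [Finset.range_eq_Ico, Finset.sum_eq_sum_Ico_succ_bot (by omega), Finset.sum_eq_sum_Ico_succ_bot (by omega), hp.p0, hp.p1]
  simp only [Pi.zero_apply, zero_add, add_sub_cancel_left]
  refine Ideal.sum_mem _ fun d hd => ord_homog (d := d) ?_ (hp.hom d j)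
  rw [Finset.mem_Ico] at hd; omega

lemma P0_pderiv_bind {ψ : Fin n → Pol n} (i : Fin n) (j : Fin q → Fin n) : bind₁ ψ (pderiv i (τ.P0 j)) = pderiv i (τ.P0 j) := by
  have h := (τ.P0_homog j).pderiv (i := i)
  have h' := totalDegree_eq_zero_iff_eq_C.1 (Nat.le_zero.1 h.totalDegree_le)
  rw [h']; simp

lemma GG_update (hp : Dat τ p) {N : ℕ} (hN : 2 ≤ N) {v u : Fin n → Pol n} (hv : ∀ i, v i ∈ Ord n 2)
    (hu : ∀ i, u i ∈ Ord n N) (j : Fin q → Fin n) :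
    GG τ p N (v + u) j - GG τ p N v j - τ.LZ u j ∈ Ord n (N+1) := by
  have hps : ps (v + u) = ps v + u := by funext i; simp [ps, add_assoc]
  have hJJ : JJ (v + u) = JJ v + Matrix.of fun i j => pderiv j (u i) := by
    ext i j : 1
    simp [JJ, hps]
  have h1 := bind_update (ψ := ps v) (by omega) hu (psum p N j)
  have h2 := act_update (E := Matrix.of fun i j => pderiv j (u i)) hN (JJ_ord hv)
    (fun i j => ord_pderiv' le_rfl j (hu i)) (P0_ord (τ := τ)) j
  have h3 : ∑ i, u i * bind₁ (ps v) (pderiv i (psum p N j)) - ∑ i, u i * pderiv i (τ.P0 j) ∈ Ord n (N+1) := by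
    rw [← Finset.sum_sub_distrib]
    refine Ideal.sum_mem _ fun i _ => ?_
    rw [← mul_sub, ← P0_pderiv_bind (ψ := ps v) i j, ← map_sub, ← map_sub]
    exact ord_mul (hu i) (bind_ord (ps_ord hv) (ord_pderiv i (psum_sub hp (by omega) j)))
  have h4 := sub_mem (add_mem h1 h3) h2
  convert h4 using 1
  unfold GG Top.LZ
  rw [hps, hJJ]
  simp only [Matrix.of_apply]
  ring

lemma GG_succ (hp : Dat τ p) {D : ℕ} {v : Fin n → Pol n} (hv : ∀ i, v i ∈ Ord n 2) (j : Fin q → Fin n)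
    (h : GG τ p D v j ∈ Ord n (D+1)) : GG τ p (D+1) v j ∈ Ord n (D+1) := by
  have : GG τ p (D+1) v j = GG τ p D v j + bind₁ (ps v) (p (D+1) j) := by
    unfold GG psum
    rw [Finset.sum_range_succ, map_add]; ring
  rw [this]
  exact add_mem h (bind_ord (ps_ord hv) (ord_homog le_rfl (hp.hom _ _)))

/-- the obstruction at the next order -/
noncomputable def kap (τ : Top n (q+1)) (p : ℕ → Ten (Pol n) n q) (D : ℕ) (v : Fin n → Pol n) : Ten (Pol n) n q :=
  fun j => homogeneousComponent (D+1) (GG τ p (D+1) v j)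

lemma homComp_self {d : ℕ} {f : Pol n} (hf : f.IsHomogeneous d) : homogeneousComponent d f = f := by
  rw [homogeneousComponent_of_mem hf, if_pos rfl]

lemma homComp_ne {d e : ℕ} (h : d ≠ e) {f : Pol n} (hf : f.IsHomogeneous d) : homogeneousComponent e f = 0 := by
  rw [homogeneousComponent_of_mem hf, if_neg h.symm]

lemma St.step (hp : Dat τ p) {D : ℕ} (hD : 1 ≤ D) {v Z : Fin n → Pol n} (h : St τ p D v Z)
    (hs : ∀ (c : ℝ) (W : Fin n → Pol n), (∀ i, (W i).IsHomogeneous (D+1)) →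
      ∃ Z : Fin n → Pol n, (∀ i, (Z i).IsHomogeneous (D+1)) ∧ τ.Nrm (D+1) Z ∧
        τ.LZ Z = τ.LZ W - (C c : Pol n) • kap τ p D v) :
    ∃ u z : Fin n → Pol n, (∀ i, (u i).IsHomogeneous (D+1)) ∧ (∀ i, (z i).IsHomogeneous (D+1)) ∧
      St τ p (D+1) (v + u) (Z + z) := by
  set W : Fin n → Pol n := fun i => homogeneousComponent (D+1) (Dv (fun l => X l - Z l) (ps v i) - ps v i) with hW
  have hWh : ∀ i, (W i).IsHomogeneous (D+1) := fun i => homogeneousComponent_isHomogeneous _ _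
  obtain ⟨z, hz, hzn, hzL⟩ := hs D W hWh
  have hD0 : (D : ℝ) ≠ 0 := by positivity
  set u : Fin n → Pol n := (D : ℝ)⁻¹ • (z + (-1 : ℝ) • W) with hu
  have huh : ∀ i, (u i).IsHomogeneous (D+1) := by
    intro i
    simp only [hu, Pi.smul_apply, Pi.add_apply, smul_eq_C_mul]
    exact hom_mul' (isHomogeneous_C _ _) ((hz i).add (hom_mul' (isHomogeneous_C _ _) (hWh i) (zero_add _))) (zero_add _)
  have huL : τ.LZ u = - kap τ p D v := by
    rw [hu, τ.LZ_smul, τ.LZ_add, τ.LZ_smul, hzL]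
    funext j
    simp only [Pi.smul_apply, Pi.add_apply, Pi.sub_apply, Pi.neg_apply, smul_eq_mul, C_neg, C_1]
    have : (C (D:ℝ)⁻¹ : Pol n) * C (D:ℝ) = 1 := by rw [← C_mul, inv_mul_cancel₀ hD0, C_1]
    linear_combination (-(kap τ p D v j)) * this
  have huz : ∀ i, C (D:ℝ) * u i = z i - W i := by
    intro i
    simp only [hu, Pi.smul_apply, Pi.add_apply, smul_eq_C_mul, C_neg, C_1]
    have : (C (D:ℝ) : Pol n) * C (D:ℝ)⁻¹ = 1 := by rw [← C_mul, mul_inv_cancel₀ hD0, C_1]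
    linear_combination (z i - W i) * this
  have huo : ∀ i, u i ∈ Ord n (D+1) := fun i => ord_homog le_rfl (huh i)
  have hzo : ∀ i, z i ∈ Ord n (D+1) := fun i => ord_homog le_rfl (hz i)
  refine ⟨u, z, huh, hz, ?_⟩
  constructor
  · intro i; exact add_mem (h.v2 i) (ord_mono (by omega) (huo i))
  · intro i; exact add_mem (h.Z2 i) (ord_mono (by omega) (hzo i))
  · intro i d hd
    rw [Pi.add_apply, map_add, h.vdeg i d (by omega), homComp_ne (by omega) (huh i), add_zero]
  · intro i d hd
    rw [Pi.add_apply, map_add, h.Zdeg i d (by omega), homComp_ne (by omega) (hz i), add_zero]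
  · intro j
    have h1 := GG_update hp (by omega : 2 ≤ D+1) h.v2 huo j
    have h2 := ord_sub_homComp (GG_succ hp h.v2 j (h.eq j))
    have h3 := add_mem h1 h2
    convert h3 using 1
    rw [huL]
    simp only [Pi.neg_apply, kap]
    ring
  · intro i
    have hr := ord_sub_homComp (h.rel i)
    have e1 : homogeneousComponent (D+1) (Dv (fun l => X l - Z l) (ps v i) - ps v i) = z i - C (D:ℝ) * u i := by
      rw [huz]; simp [hW]
    rw [e1] at hr
    have hps : ps (v + u) i = ps v i + u i := by simp [ps, add_assoc]
    have hEu : Dv X (u i) = C ((D:ℝ)+1) * u i := by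
      have := (huh i).sum_X_mul_pderiv
      unfold Dv
      rw [this]; simp [nsmul_eq_mul]
    have h1 : Dv Z (u i) ∈ Ord n (D+1+1) := Dv_ord h.Z2 (huo i) (by omega)
    have h2 : Dv z (u i) ∈ Ord n (D+1+1) := Dv_ord hzo (huo i) (by omega)
    have h3 : Dv z (v i) ∈ Ord n (D+1+1) := Dv_ord hzo (h.v2 i) (by omega)
    have e3 : Dv z (ps v i) = z i + Dv z (v i) := by rw [ps, Dv_add', Dv_X]
    have e4 : Dv (fun l => X l - (Z + z) l) (ps (v + u) i) =
        Dv (fun l => X l - Z l) (ps v i) - Dv z (ps v i) + Dv X (u i) - Dv Z (u i) - Dv z (u i) := by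
      rw [hps, Dv_add']
      simp only [Dv, Pi.add_apply, sub_mul, add_mul, Finset.sum_sub_distrib, Finset.sum_add_distrib]
      ring
    rw [e4, e3, hEu, hps]
    have h4 := sub_mem (sub_mem (sub_mem hr h1) h2) h3
    convert h4 using 1
    rw [C_add, C_1]; ring
  · intro d hd1 hd2
    by_cases hd : d = D + 1
    · subst hd
      convert hzn using 2 with i
      rw [Pi.add_apply, map_add, h.Zdeg i _ (by omega), homComp_self (hz i), zero_add]
    · convert h.nrm d hd1 (by omega) using 2 with i
      rw [Pi.add_apply, map_add, homComp_ne (by omega) (hz i), add_zero]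

lemma JJ_zero : JJ (0 : Fin n → Pol n) = 1 := by
  ext i j : 1
  rw [JJ_apply]; simp

lemma ps_zero : ps (0 : Fin n → Pol n) = X := by
  funext i; simp [ps]

lemma St.base (hp : Dat τ p) : St τ p 1 0 0 := by
  constructor
  · intro i; exact zero_mem _
  · intro i; exact zero_mem _
  · intro i d _; simp
  · intro i d _; simp
  · intro j
    have : GG τ p 1 0 j = 0 := by
      unfold GG
      rw [JJ_zero, ps_zero, act_one, bind₁_X_left]
      simp [psum, Finset.sum_range_succ, hp.p0, hp.p1]
    rw [this]; exact zero_mem _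
  · intro i
    rw [ps_zero, Dv_X]; simp
  · intro d _ _
    refine ⟨fun i j k => by simp, fun p _ g _ _ => by simp [fis_zero_left]⟩

set_option maxHeartbeats 800000 in
/-- the differentiated equation -/
lemma St.diff (hp : Dat τ p) {D : ℕ} {v Z : Fin n → Pol n} (h : St τ p D v Z) (j : Fin q → Fin n) :
    act (JJ v) (τ.LZ Z) j + ∑ d ∈ range (D+1), C ((d:ℝ) - 1) * bind₁ (ps v) (p d j) ∈ Ord n (D+1) := by
  set V : Fin n → Pol n := fun l => X l - Z l with hV
  have hV1 : ∀ l, V l ∈ Ord n 1 := fun l => sub_mem (X_ord l) (ord_mono (by omega) (h.Z2 l))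
  have h1 := Dv_ord1 hV1 (h.eq j)
  -- first term
  have e1 : Dv V (bind₁ (ps v) (psum p D j)) - ∑ d ∈ range (D+1), C (d:ℝ) * bind₁ (ps v) (p d j) ∈ Ord n (D+1) := by
    have e2 : ∑ d ∈ range (D+1), C (d:ℝ) * bind₁ (ps v) (p d j) = ∑ i, bind₁ (ps v) (pderiv i (psum p D j)) * ps v i := by
      have : ∀ d : ℕ, C (d:ℝ) * bind₁ (ps v) (p d j) = ∑ i, bind₁ (ps v) (pderiv i (p d j)) * ps v i := by
        intro d
        have hE := (hp.hom d j).sum_X_mul_pderiv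
        have := congrArg (bind₁ (ps v)) hE
        simp only [map_sum, map_mul, bind₁_X_right, nsmul_eq_mul, map_natCast] at this
        rw [map_natCast, ← this]
        exact Finset.sum_congr rfl fun i _ => mul_comm _ _
      simp only [this, psum, map_sum, Finset.sum_mul]
      rw [Finset.sum_comm]
    rw [e2, Dv_bind, ← Finset.sum_sub_distrib]
    refine Ideal.sum_mem _ fun i _ => ?_
    rw [← mul_sub]
    exact Ideal.mul_mem_left _ _ (h.rel i)
  -- derivative of the Jacobian
  have e3 : ∀ i k, Dv V (JJ v i k) - ∑ l, JJ v i l * pderiv k (Z l) ∈ Ord n D := by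
    intro i k
    have := ord_pderiv k (h.rel i)
    convert this using 1
    have c1 : ∀ l, pderiv k (V l) = (if l = k then 1 else 0) - pderiv k (Z l) := by
      intro l
      simp only [hV, map_sub, pderiv_X]
      congr 1
      by_cases hl : l = k
      · subst hl; simp
      · simp [hl, Pi.single_apply]
    have c2 : pderiv k (Dv V (ps v i)) = Dv V (JJ v i k) + ∑ l, JJ v i l * pderiv k (V l) := by
      unfold Dv
      rw [map_sum, ← Finset.sum_add_distrib]
      refine Finset.sum_congr rfl fun l _ => ?_
      rw [Derivation.leibniz, smul_eq_mul, smul_eq_mul, JJ, Matrix.of_apply, Matrix.of_apply, pd_comm]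
    rw [map_sub, c2]
    simp only [c1, mul_sub, Finset.sum_sub_distrib, mul_ite, mul_one, mul_zero, Finset.sum_ite_eq', mem_univ, if_true]
    simp only [JJ, Matrix.of_apply]
    ring
  have e4 : Dv V (act (JJ v) τ.P0 j) - (act (JJ v) τ.P0 j - act (JJ v) (τ.LZ Z) j) ∈ Ord n (D+1) := by
    have c1 : Dv V (act (JJ v) τ.P0 j) = ∑ i : Fin q → Fin n, ((∏ a, JJ v (j a) (i a)) * Dv V (τ.P0 i)) +
        ∑ i : Fin q → Fin n, ∑ a, τ.P0 i * (Dv V (JJ v (j a) (i a)) * ∏ b ∈ univ.erase a, JJ v (j b) (i b)) := by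
      unfold act
      rw [Dv_sum', ← Finset.sum_add_distrib]
      refine Finset.sum_congr rfl fun i _ => ?_
      rw [Dv_mul', Dv_prod', Finset.mul_sum]
    have c2 : ∀ i, Dv V (τ.P0 i) = τ.P0 i - ∑ l, Z l * pderiv l (τ.P0 i) := by
      intro i
      have hE := (τ.P0_homog i).sum_X_mul_pderiv
      rw [one_smul] at hE
      simp only [Dv, hV, sub_mul, Finset.sum_sub_distrib, hE]
    have c3 : ∑ i : Fin q → Fin n, ∑ a, τ.P0 i * (Dv V (JJ v (j a) (i a)) * ∏ b ∈ univ.erase a, JJ v (j b) (i b)) -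
        ∑ i : Fin q → Fin n, ∑ a, τ.P0 i * ((∑ l, JJ v (j a) l * pderiv (i a) (Z l)) * ∏ b ∈ univ.erase a, JJ v (j b) (i b)) ∈ Ord n (D+1) := by
      rw [← Finset.sum_sub_distrib]
      refine Ideal.sum_mem _ fun i _ => ?_
      rw [← Finset.sum_sub_distrib]
      refine Ideal.sum_mem _ fun a _ => ?_
      rw [← mul_sub, ← sub_mul]
      exact ord_mul' (by omega) (P0_ord i) (Ideal.mul_mem_right _ _ (e3 (j a) (i a)))
    have c4 : ∑ i : Fin q → Fin n, ∑ a, τ.P0 i * ((∑ l, JJ v (j a) l * pderiv (i a) (Z l)) * ∏ b ∈ univ.erase a, JJ v (j b) (i b)) =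
        ∑ i : Fin q → Fin n, ∑ a, ∑ l, (∏ b, JJ v (j b) (i b)) * (pderiv l (Z (i a)) * τ.P0 (Function.update i a l)) := by
      rw [Finset.sum_comm]
      conv_rhs => rw [Finset.sum_comm]
      refine Finset.sum_congr rfl fun a _ => ?_
      conv_rhs => rw [reindex_slot a]
      refine Finset.sum_congr rfl fun i _ => ?_
      rw [Finset.sum_mul, Finset.mul_sum]
      refine Finset.sum_congr rfl fun l _ => ?_
      rw [← Finset.mul_prod_erase univ _ (mem_univ a)]
      have : ∏ b ∈ univ.erase a, JJ v (j b) (Function.update i a l b) = ∏ b ∈ univ.erase a, JJ v (j b) (i b) :=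
        Finset.prod_congr rfl fun b hb => by rw [Function.update_of_ne (ne_of_mem_erase hb)]
      rw [this]
      simp
      ring
    rw [c4] at c3
    convert c3 using 1
    rw [c1]
    simp only [c2, act, Top.LZ, mul_sub, Finset.sum_sub_distrib, Finset.mul_sum]
    ring
  have e5 : Dv V (GG τ p D v j) = Dv V (bind₁ (ps v) (psum p D j)) - Dv V (act (JJ v) τ.P0 j) := by
    rw [GG, Dv_sub']
  rw [e5] at h1
  have h4 := sub_mem (add_mem (sub_mem h1 e1) e4) (h.eq j)
  convert h4 using 1
  simp only [C_sub, C_1, sub_mul, one_mul, Finset.sum_sub_distrib, GG, psum, map_sum]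
  ring

end formal

end NambuLin


namespace NambuLin

open MvPolynomial Finset
open scoped Nat Topology ContDiff

section bounds
variable {n q : ℕ}

lemma bom_one_zero : bom 0 (1 : Pol n) ≤ 1 := by
  apply le_of_sq_le_sq _ zero_le_one
  rw [bom_sq]
  have : expo n 0 = {0} := by
    ext α; rw [mem_expo, mem_singleton, Finsupp.degree_eq_zero_iff]
  rw [this]
  simp [mfac]

lemma bom_X_le (i : Fin n) : bom 1 (X i : Pol n) ≤ 1 := by
  apply le_of_sq_le_sq _ zero_le_one
  rw [bom_sq, Finset.sum_eq_single (Finsupp.single i 1)]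
  · have : mfac (Finsupp.single i 1) = 1 := by
      have := mfac_add_single (0 : Fin n →₀ ℕ) i
      rw [zero_add] at this
      rw [this]; simp [mfac]
    rw [this]; simp
  · intro α _ hα
    rw [coeff_X', if_neg (Ne.symm hα)]; simp
  · intro h
    exfalso; apply h
    rw [mem_expo]; simp

/-- truncated majorant norm -/
noncomputable def NN (D : ℕ) (ρ : ℝ) (f : Pol n) : ℝ := ∑ d ∈ range (D+1), bom d f * ρ ^ d

variable {D : ℕ} {ρ : ℝ}

lemma NN_nonneg (hρ : 0 ≤ ρ) (f : Pol n) : 0 ≤ NN D ρ f :=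
  Finset.sum_nonneg fun d _ => mul_nonneg (bom_nonneg _ _) (pow_nonneg hρ _)

lemma NN_add (hρ : 0 ≤ ρ) (f g : Pol n) : NN D ρ (f + g) ≤ NN D ρ f + NN D ρ g := by
  unfold NN
  rw [← Finset.sum_add_distrib]
  refine Finset.sum_le_sum fun d _ => ?_
  rw [← add_mul]
  exact mul_le_mul_of_nonneg_right (bom_add_le _ _ _) (pow_nonneg hρ _)

lemma NN_neg (f : Pol n) : NN D ρ (-f) = NN D ρ f := by
  simp only [NN, bom_neg]

lemma NN_sub (hρ : 0 ≤ ρ) (f g : Pol n) : NN D ρ (f - g) ≤ NN D ρ f + NN D ρ g := by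
  rw [sub_eq_add_neg, ← NN_neg g]; exact NN_add hρ _ _

lemma NN_zero : NN D ρ (0 : Pol n) = 0 := by simp [NN, bom_zero]

lemma NN_sum {ι : Type*} (hρ : 0 ≤ ρ) (s : Finset ι) (f : ι → Pol n) : NN D ρ (∑ i ∈ s, f i) ≤ ∑ i ∈ s, NN D ρ (f i) := by
  classical
  induction s using Finset.induction_on with
  | empty => simp [NN_zero]
  | insert a s ha ih =>
    rw [Finset.sum_insert ha, Finset.sum_insert ha]
    exact (NN_add hρ _ _).trans (by linarith)

lemma NN_C_mul (c : ℝ) (f : Pol n) : NN D ρ (C c * f) = |c| * NN D ρ f := by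
  simp only [NN, bom_C_mul, Finset.mul_sum, mul_assoc]

lemma NN_ord {f : Pol n} (hf : f ∈ Ord n (D+1)) : NN D ρ f = 0 :=
  Finset.sum_eq_zero fun d hd => by rw [bom_ord (mem_range.1 hd) hf, zero_mul]

lemma NN_mul (hρ : 0 ≤ ρ) (f g : Pol n) : NN D ρ (f * g) ≤ NN D ρ f * NN D ρ g := by
  have h1 : NN D ρ (f * g) ≤ ∑ d ∈ range (D+1), ∑ p ∈ antidiagonal d, (bom p.1 f * ρ ^ p.1) * (bom p.2 g * ρ ^ p.2) := by
    refine Finset.sum_le_sum fun d _ => ?_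
    refine (mul_le_mul_of_nonneg_right (bom_mul d f g) (pow_nonneg hρ _)).trans (le_of_eq ?_)
    rw [Finset.sum_mul]
    refine Finset.sum_congr rfl fun p hp => ?_
    rw [← mem_antidiagonal.1 hp, pow_add]; ring
  refine h1.trans ?_
  unfold NN
  rw [Finset.sum_mul_sum, ← Finset.sum_product']
  have hF : ∀ p : ℕ × ℕ, 0 ≤ (bom p.1 f * ρ ^ p.1) * (bom p.2 g * ρ ^ p.2) := fun p =>
    mul_nonneg (mul_nonneg (bom_nonneg _ _) (pow_nonneg hρ _)) (mul_nonneg (bom_nonneg _ _) (pow_nonneg hρ _))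
  have h2 := Finset.sum_fiberwise_le_sum_of_sum_fiber_nonneg (s := range (D+1) ×ˢ range (D+1)) (t := range (D+1))
    (g := fun p : ℕ × ℕ => p.1 + p.2) (f := fun p => (bom p.1 f * ρ ^ p.1) * (bom p.2 g * ρ ^ p.2))
    (fun y _ => Finset.sum_nonneg fun p _ => hF p)
  refine le_trans (le_of_eq ?_) h2
  refine Finset.sum_congr rfl fun d hd => Finset.sum_congr ?_ fun _ _ => rfl
  ext ⟨a, b⟩
  rw [mem_range] at hd
  simp only [HasAntidiagonal.mem_antidiagonal, mem_filter, mem_product, mem_range]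
  omega

lemma NN_one (_ : 0 ≤ ρ) : NN D ρ (1 : Pol n) ≤ 1 := by
  unfold NN
  rw [Finset.sum_eq_single 0]
  · simpa using bom_one_zero
  · intro d _ hd
    rw [bom_homog_ne (isHomogeneous_one _ _) hd, zero_mul]
  · simp

lemma NN_X (hρ : 0 ≤ ρ) (i : Fin n) : NN D ρ (X i : Pol n) ≤ ρ := by
  unfold NN
  have : ∀ d ∈ range (D+1), bom d (X i : Pol n) * ρ ^ d ≤ if d = 1 then ρ else 0 := by
    intro d _
    split_ifs with h
    · subst h
      rw [pow_one]
      exact mul_le_of_le_one_left hρ (bom_X_le i)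
    · rw [bom_homog_ne (isHomogeneous_X _ i) h, zero_mul]
  refine (Finset.sum_le_sum this).trans ?_
  rw [Finset.sum_ite_eq']
  split_ifs
  · exact le_rfl
  · exact hρ

lemma NN_pow (hρ : 0 ≤ ρ) (f : Pol n) {r : ℝ} (h : NN D ρ f ≤ r) (k : ℕ) : NN D ρ (f ^ k) ≤ r ^ k := by
  have hr : 0 ≤ r := (NN_nonneg hρ f).trans h
  induction k with
  | zero => simpa using NN_one hρ
  | succ k ih =>
    rw [pow_succ, pow_succ]
    exact (NN_mul hρ _ _).trans (mul_le_mul ih h (NN_nonneg hρ _) (pow_nonneg hr _))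

lemma NN_prod {ι : Type*} (hρ : 0 ≤ ρ) (s : Finset ι) (f : ι → Pol n) {r : ι → ℝ} (h : ∀ i ∈ s, NN D ρ (f i) ≤ r i) :
    NN D ρ (∏ i ∈ s, f i) ≤ ∏ i ∈ s, r i := by
  classical
  induction s using Finset.induction_on with
  | empty => simpa using NN_one hρ
  | insert a s ha ih =>
    rw [Finset.prod_insert ha, Finset.prod_insert ha]
    have h1 := h a (mem_insert_self _ _)
    have h2 := ih fun i hi => h i (mem_insert_of_mem hi)
    exact (NN_mul hρ _ _).trans (mul_le_mul h1 h2 (NN_nonneg hρ _) ((NN_nonneg hρ _).trans h1))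

/-- the `ℓ¹` norm of the coefficients -/
noncomputable def ell (f : Pol n) : ℝ := ∑ α ∈ f.support, |coeff α f|

lemma NN_bind (hρ : 0 ≤ ρ) {ψ : Fin n → Pol n} {r : ℝ} (hψ : ∀ i, NN D ρ (ψ i) ≤ r) {d : ℕ} {f : Pol n}
    (hf : f.IsHomogeneous d) : NN D ρ (bind₁ ψ f) ≤ ell f * r ^ d := by
  have h1 : bind₁ ψ f = ∑ α ∈ f.support, C (coeff α f) * ∏ i, ψ i ^ α i := by
    rw [bind₁, aeval_def, eval₂_eq']; rfl
  rw [h1, ell, Finset.sum_mul]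
  refine (NN_sum hρ _ _).trans (Finset.sum_le_sum fun α hα => ?_)
  rw [NN_C_mul]
  refine mul_le_mul_of_nonneg_left ?_ (abs_nonneg _)
  have h2 := NN_prod (D := D) hρ univ (fun i => ψ i ^ α i) (r := fun i => r ^ α i) fun i _ => NN_pow hρ _ (hψ i) _
  refine h2.trans (le_of_eq ?_)
  rw [Finset.prod_pow_eq_pow_sum]
  congr 1
  have := hf (mem_support_iff.1 hα)
  rw [wt_one, Finsupp.degree_eq_sum] at this
  exact this

lemma NN_prod_sub {ι : Type*} (hρ : 0 ≤ ρ) (s : Finset ι) {f g : ι → Pol n} {S : ℝ} (hS : 0 ≤ S)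
    (hf : ∀ i, NN D ρ (f i - g i) ≤ S) (hg : ∀ i, NN D ρ (g i) ≤ 1) :
    NN D ρ (∏ i ∈ s, f i - ∏ i ∈ s, g i) ≤ (1 + S) ^ s.card - 1 := by
  classical
  induction s using Finset.induction_on with
  | empty => simp [NN_zero]
  | insert a s ha ih =>
    rw [Finset.prod_insert ha, Finset.prod_insert ha, Finset.card_insert_of_notMem ha]
    have e : f a * ∏ i ∈ s, f i - g a * ∏ i ∈ s, g i = f a * (∏ i ∈ s, f i - ∏ i ∈ s, g i) + (f a - g a) * ∏ i ∈ s, g i := by ring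
    have h1 : NN D ρ (f a) ≤ 1 + S := by
      have := NN_add (D := D) hρ (g a) (f a - g a)
      rw [add_sub_cancel] at this
      linarith [hf a, hg a]
    have h2 : NN D ρ (∏ i ∈ s, g i) ≤ 1 := by
      simpa using NN_prod hρ s g (r := fun _ => 1) fun i _ => hg i
    rw [e]
    have h3 := (NN_mul (D := D) hρ (f a) (∏ i ∈ s, f i - ∏ i ∈ s, g i)).trans
      (mul_le_mul h1 ih (NN_nonneg hρ _) (by linarith))
    have h4 := (NN_mul (D := D) hρ (f a - g a) (∏ i ∈ s, g i)).trans
      (mul_le_mul (hf a) h2 (NN_nonneg hρ _) hS)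
    refine (NN_add hρ _ _).trans ((add_le_add h3 h4).trans (le_of_eq ?_))
    rw [pow_succ]; ring

end bounds

end NambuLin


namespace NambuLin

open MvPolynomial Finset
open scoped Nat Topology ContDiff

section bounds
variable {n q : ℕ} {τ : Top n (q+1)} {p : ℕ → Ten (Pol n) n q} {D : ℕ} {v Z : Fin n → Pol n} {ρ : ℝ}

/-- majorant of the Jacobian -/
noncomputable def SS (D : ℕ) (v : Fin n → Pol n) (ρ : ℝ) : ℝ := ∑ i, ∑ d ∈ range (D+1), d * bom d (v i) * ρ ^ (d - 1)

lemma SS_nonneg (hρ : 0 ≤ ρ) : 0 ≤ SS D v ρ :=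
  Finset.sum_nonneg fun i _ => Finset.sum_nonneg fun d _ =>
    mul_nonneg (mul_nonneg (Nat.cast_nonneg d) (bom_nonneg _ _)) (pow_nonneg hρ _)

lemma SS_single (hρ : 0 ≤ ρ) (i : Fin n) : ∑ d ∈ range (D+1), d * bom d (v i) * ρ ^ (d - 1) ≤ SS D v ρ :=
  Finset.single_le_sum (f := fun i => ∑ d ∈ range (D+1), d * bom d (v i) * ρ ^ (d - 1))
    (fun i _ => Finset.sum_nonneg fun d _ =>
      mul_nonneg (mul_nonneg (Nat.cast_nonneg d) (bom_nonneg _ _)) (pow_nonneg hρ _)) (mem_univ i)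

lemma bom_zero_of_homComp {d : ℕ} {f : Pol n} (h : homogeneousComponent d f = 0) : bom d f = 0 := by
  rw [← bom_homComp, h, bom_zero]

lemma NN_pderiv_v (h : St τ p D v Z) (hρ : 0 ≤ ρ) (i l : Fin n) : NN D ρ (pderiv l (v i)) ≤ SS D v ρ := by
  refine le_trans ?_ (SS_single hρ i)
  have h1 : NN D ρ (pderiv l (v i)) ≤ ∑ d ∈ range (D+1), ((d+1 : ℕ) : ℝ) * bom (d+1) (v i) * ρ ^ (d + 1 - 1) := by
    refine Finset.sum_le_sum fun d _ => ?_
    rw [Nat.add_sub_cancel]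
    push_cast
    exact mul_le_mul_of_nonneg_right (bom_pderiv d l (v i)) (pow_nonneg hρ _)
  refine h1.trans (le_of_eq ?_)
  have h2 := Finset.sum_range_succ' (fun d : ℕ => (d : ℝ) * bom d (v i) * ρ ^ (d - 1)) (D+1)
  have h3 := Finset.sum_range_succ (fun d : ℕ => (d : ℝ) * bom d (v i) * ρ ^ (d - 1)) (D+1)
  rw [bom_zero_of_homComp (h.vdeg i (D+1) (by omega))] at h3
  simp only [Nat.cast_zero, zero_mul, mul_zero, add_zero] at h2 h3
  rw [← h2, h3]

lemma NN_v (h : St τ p D v Z) (hρ : 0 ≤ ρ) (i : Fin n) : NN D ρ (v i) ≤ ρ * SS D v ρ := by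
  refine le_trans ?_ (mul_le_mul_of_nonneg_left (SS_single (D := D) (v := v) hρ i) hρ)
  rw [Finset.mul_sum]
  refine Finset.sum_le_sum fun d _ => ?_
  rcases d with _ | d
  · rw [bom_ord (by omega) (h.v2 i)]; simp
  · rw [Nat.add_sub_cancel, pow_succ]
    have h1 : 0 ≤ bom (d+1) (v i) * ρ ^ d * ρ := mul_nonneg (mul_nonneg (bom_nonneg _ _) (pow_nonneg hρ _)) hρ
    have h2 : (0:ℝ) ≤ d := Nat.cast_nonneg d
    push_cast
    nlinarith [mul_nonneg h2 h1]

lemma NN_JJ (h : St τ p D v Z) (hρ : 0 ≤ ρ) (i l : Fin n) :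
    NN D ρ (JJ v i l - (1 : Matrix (Fin n) (Fin n) (Pol n)) i l) ≤ SS D v ρ := by
  rw [JJ_apply, add_sub_cancel_left]; exact NN_pderiv_v h hρ i l

lemma sum_homComp {f : Pol n} (h : ∀ d, D < d → homogeneousComponent d f = 0) :
    f = ∑ d ∈ range (D+1), homogeneousComponent d f := by
  ext α
  rw [coeff_sum]
  simp only [coeff_homogeneousComponent]
  by_cases hα : α.degree ∈ range (D+1)
  · rw [Finset.sum_ite_eq, if_pos hα]
  · rw [Finset.sum_ite_eq, if_neg hα]
    have := congrArg (coeff α) (h α.degree (by rw [mem_range] at hα; omega))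
    simpa [coeff_homogeneousComponent] using this

lemma bom_sum_hom {g : ℕ → Pol n} (hg : ∀ e, (g e).IsHomogeneous e) {d : ℕ} (hd : d ∈ range (D+1)) :
    bom d (∑ e ∈ range (D+1), g e) = bom d (g d) := by
  rw [← bom_homComp, map_sum]
  congr 1
  rw [Finset.sum_eq_single d]
  · exact homComp_self (hg d)
  · intro e _ he; exact homComp_ne he (hg e)
  · intro h; exact absurd hd h

/-- estimate of `Z` by `L_Z P0` -/
lemma NN_Z (hq : 2 ≤ q) (h : St τ p D v Z) (hρ : 0 ≤ ρ) (r : Fin n) :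
    NN D ρ (Z r) ≤ (q+1) * ∑ j, NN D ρ (τ.LZ Z j) := by
  have h1 : τ.LZ Z = ∑ e ∈ range (D+1), τ.LZ (fun i => homogeneousComponent e (Z i)) := by
    rw [← τ.LZ_sum]
    congr 1
    funext i
    rw [Finset.sum_apply]
    exact sum_homComp (h.Zdeg i)
  have hh : ∀ e j, (τ.LZ (fun i => homogeneousComponent e (Z i)) j).IsHomogeneous e := by
    intro e j
    rcases e with _ | e
    · have : (fun i => homogeneousComponent 0 (Z i)) = 0 := by
        funext i; exact homComp_ord (by omega) (h.Z2 i)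
      rw [this, τ.LZ_zero]; exact isHomogeneous_zero _ _ _
    · exact τ.LZ_hom (by omega) (fun i => homogeneousComponent_isHomogeneous _ _) j
  have h2 : ∀ d ∈ range (D+1), ∀ j, bom d (τ.LZ Z j) = bom d (τ.LZ (fun i => homogeneousComponent d (Z i)) j) := by
    intro d hd j
    rw [h1, Finset.sum_apply]
    exact bom_sum_hom (fun e => hh e j) hd
  unfold NN
  rw [Finset.sum_comm, Finset.mul_sum]
  refine Finset.sum_le_sum fun d hd => ?_
  rw [← Finset.sum_mul, ← mul_assoc]
  refine mul_le_mul_of_nonneg_right ?_ (pow_nonneg hρ _)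
  rcases d with _ | d
  · rw [bom_ord (by omega) (h.Z2 r)]
    exact mul_nonneg (by positivity) (Finset.sum_nonneg fun j _ => bom_nonneg _ _)
  · rw [← bom_homComp]
    simp only [h2 _ hd]
    exact τ.nrm_bound hq (fun i => homogeneousComponent_isHomogeneous _ _) (by omega)
      (h.nrm (d+1) (by omega) (by rw [mem_range] at hd; omega)) r

lemma bom_euler (h : St τ p D v Z) (i : Fin n) {d : ℕ} (hd : d ∈ range (D+1)) :
    bom d (Dv X (v i) - v i) = |(d:ℝ) - 1| * bom d (v i) := by
  have h1 : Dv X (v i) - v i = ∑ e ∈ range (D+1), C ((e:ℝ) - 1) * homogeneousComponent e (v i) := by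
    have h2 := sum_homComp (h.vdeg i)
    have h3 : Dv X (v i) - v i = Dv X (∑ e ∈ range (D+1), homogeneousComponent e (v i)) -
      ∑ e ∈ range (D+1), homogeneousComponent e (v i) := by rw [← h2]
    rw [h3, Dv_sum', ← Finset.sum_sub_distrib]
    refine Finset.sum_congr rfl fun e _ => ?_
    have := (homogeneousComponent_isHomogeneous e (v i)).sum_X_mul_pderiv
    unfold Dv
    rw [this, nsmul_eq_mul, C_sub, C_1, map_natCast]; ring
  rw [h1, bom_sum_hom (fun e => hom_mul' (isHomogeneous_C _ _) (homogeneousComponent_isHomogeneous e (v i)) (zero_add e)) hd,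
    bom_C_mul, bom_homComp]

lemma SS_rec (h : St τ p D v Z) (hρ : 0 ≤ ρ) :
    ρ * SS D v ρ ≤ 2 * (1 + n * SS D v ρ) * ∑ l, NN D ρ (Z l) := by
  set S := SS D v ρ with hS
  have hS0 : 0 ≤ S := SS_nonneg hρ
  have h1 : ∀ i, NN D ρ (Dv X (v i) - v i) ≤ NN D ρ (Z i) + S * ∑ l, NN D ρ (Z l) := by
    intro i
    have e1 : Dv X (v i) - v i = (Dv (fun l => X l - Z l) (ps v i) - ps v i) + (Z i + Dv Z (v i)) := by
      have : Dv (fun l => X l - Z l) (ps v i) = X i - Z i + (Dv X (v i) - Dv Z (v i)) := by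
        rw [ps, Dv_add', Dv_X]
        congr 1
        simp only [Dv, sub_mul, Finset.sum_sub_distrib]
      rw [this, ps]; ring
    have e2 : NN D ρ (Dv Z (v i)) ≤ S * ∑ l, NN D ρ (Z l) := by
      unfold Dv
      rw [Finset.mul_sum]
      refine (NN_sum hρ _ _).trans (Finset.sum_le_sum fun l _ => ?_)
      refine (NN_mul hρ _ _).trans ?_
      rw [mul_comm]
      exact mul_le_mul_of_nonneg_right (NN_pderiv_v h hρ i l) (NN_nonneg hρ _)
    rw [e1]
    refine (NN_add hρ _ _).trans ?_
    rw [NN_ord (h.rel i), zero_add]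
    exact (NN_add hρ _ _).trans (by linarith)
  have h2 : ∀ i, ρ * ∑ d ∈ range (D+1), d * bom d (v i) * ρ ^ (d - 1) ≤ 2 * NN D ρ (Dv X (v i) - v i) := by
    intro i
    unfold NN
    rw [Finset.mul_sum, Finset.mul_sum]
    refine Finset.sum_le_sum fun d hd => ?_
    rw [bom_euler h i hd]
    rcases d with _ | _ | d
    · simp [bom_nonneg]
    · rw [bom_ord (by omega) (h.v2 i)]; simp
    · have hx : 0 ≤ bom (d+2) (v i) * (ρ ^ (d+1) * ρ) :=
        mul_nonneg (bom_nonneg _ _) (mul_nonneg (pow_nonneg hρ _) hρ)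
      have hd0 : (0:ℝ) ≤ d := Nat.cast_nonneg d
      have e3 : |((d+1+1 : ℕ) : ℝ) - 1| = d + 1 := by
        push_cast
        rw [abs_of_nonneg (by linarith)]; ring
      rw [e3, show d + 1 + 1 - 1 = d + 1 by omega, pow_succ ρ (d+1)]
      push_cast
      nlinarith [mul_nonneg hd0 hx]
  have h3 : ρ * S ≤ ∑ i, 2 * (NN D ρ (Z i) + S * ∑ l, NN D ρ (Z l)) := by
    rw [hS, SS, Finset.mul_sum]
    exact Finset.sum_le_sum fun i _ => (h2 i).trans (by have := h1 i; rw [hS, SS] at this; linarith)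
  refine h3.trans (le_of_eq ?_)
  rw [← Finset.mul_sum, Finset.sum_add_distrib]
  simp only [sum_const, card_univ, Fintype.card_fin, nsmul_eq_mul]
  ring

lemma LZ_rec (hp : Dat τ p) (h : St τ p D v Z) (hρ : 0 ≤ ρ) (j : Fin q → Fin n) :
    NN D ρ (τ.LZ Z j) ≤ ∑ d ∈ range (D+1), |(d:ℝ) - 1| * NN D ρ (bind₁ (ps v) (p d j)) +
      ((1 + SS D v ρ) ^ q - 1) * ∑ i, NN D ρ (τ.LZ Z i) := by
  have h1 := h.diff hp j
  set Q := ∑ d ∈ range (D+1), C ((d:ℝ) - 1) * bind₁ (ps v) (p d j) with hQ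
  have e1 : τ.LZ Z j = (act (JJ v) (τ.LZ Z) j + Q) - Q -
      ∑ i : Fin q → Fin n, (∏ a, JJ v (j a) (i a) - ∏ a, (1 : Matrix (Fin n) (Fin n) (Pol n)) (j a) (i a)) * τ.LZ Z i := by
    have : act 1 (τ.LZ Z) j = τ.LZ Z j := by rw [act_one]
    conv_lhs => rw [← this]
    unfold act
    simp only [sub_mul, Finset.sum_sub_distrib]
    ring
  have h2 : NN D ρ Q ≤ ∑ d ∈ range (D+1), |(d:ℝ) - 1| * NN D ρ (bind₁ (ps v) (p d j)) := by
    refine (NN_sum hρ _ _).trans (le_of_eq ?_)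
    exact Finset.sum_congr rfl fun d _ => NN_C_mul _ _
  have h3 : NN D ρ (∑ i : Fin q → Fin n, (∏ a, JJ v (j a) (i a) - ∏ a, (1 : Matrix (Fin n) (Fin n) (Pol n)) (j a) (i a)) * τ.LZ Z i)
      ≤ ((1 + SS D v ρ) ^ q - 1) * ∑ i, NN D ρ (τ.LZ Z i) := by
    rw [Finset.mul_sum]
    refine (NN_sum hρ _ _).trans (Finset.sum_le_sum fun i _ => ?_)
    refine (NN_mul hρ _ _).trans (mul_le_mul_of_nonneg_right ?_ (NN_nonneg hρ _))
    have := NN_prod_sub (D := D) hρ univ (f := fun a => JJ v (j a) (i a))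
      (g := fun a => (1 : Matrix (Fin n) (Fin n) (Pol n)) (j a) (i a)) (SS_nonneg (D := D) (v := v) hρ) (fun a => NN_JJ h hρ _ _) ?_
    · simpa using this
    · intro a
      rw [Matrix.one_apply]
      split_ifs
      · exact NN_one hρ
      · rw [NN_zero]; exact zero_le_one
  rw [e1]
  refine (NN_sub hρ _ _).trans (add_le_add ?_ h3)
  refine (NN_sub hρ _ _).trans ?_
  rw [NN_ord h1, zero_add]
  exact h2

end bounds

end NambuLin


namespace NambuLin

open MvPolynomial Finset
open scoped Nat Topology ContDiff

section bounds
variable {n q : ℕ} {τ : Top n (q+1)} {p : ℕ → Ten (Pol n) n q} {D : ℕ} {v Z : Fin n → Pol n} {ρ : ℝ}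

lemma Q_bound (hp : Dat τ p) {M L : ℝ} (hM : 0 ≤ M) (hL : 0 ≤ L) (hpM : ∀ d j, ell (p d j) ≤ M * L ^ d)
    (h : St τ p D v Z) (hρ : 0 ≤ ρ) (hS : SS D v ρ ≤ 1) (hρL : 4 * L * ρ ≤ 1 / 2) (j : Fin q → Fin n) :
    ∑ d ∈ range (D+1), |(d:ℝ) - 1| * NN D ρ (bind₁ (ps v) (p d j)) ≤ 8 * M * (4 * L * ρ) ^ 2 := by
  set x := 4 * L * ρ with hx
  have hx0 : 0 ≤ x := by positivity
  have hψ : ∀ i, NN D ρ (ps v i) ≤ 2 * ρ := by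
    intro i
    have h1 := NN_X (D := D) hρ i
    have h2 := NN_v h hρ i
    have h3 := NN_add (D := D) hρ (X i) (v i)
    have h4 : ρ * SS D v ρ ≤ ρ * 1 := mul_le_mul_of_nonneg_left hS hρ
    rw [ps]; linarith
  have hterm : ∀ d ∈ range (D+1), |(d:ℝ) - 1| * NN D ρ (bind₁ (ps v) (p d j)) ≤ 4 * M * x ^ 2 * (1 / 2) ^ d := by
    intro d _
    rcases d with _ | _ | d
    · rw [hp.p0]; simp [NN_zero]; positivity
    · simp; positivity
    · have h1 := NN_bind hρ hψ (hp.hom (d+2) j)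
      have h2 : NN D ρ (bind₁ (ps v) (p (d+2) j)) ≤ M * L ^ (d+2) * (2 * ρ) ^ (d+2) :=
        h1.trans (mul_le_mul_of_nonneg_right (hpM _ _) (by positivity))
      have h3 : |((d+1+1 : ℕ) : ℝ) - 1| ≤ 2 ^ (d+2) := by
        have : ((d+1 : ℕ) : ℝ) ≤ 2 ^ (d+1) := by exact_mod_cast (Nat.lt_two_pow_self (n := d+1)).le
        push_cast at this ⊢
        rw [abs_of_nonneg (by linarith [(Nat.cast_nonneg d : (0:ℝ) ≤ d)]), pow_succ]
        have h2 : (0:ℝ) ≤ 2 ^ (d+1) := by positivity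
        linarith
      have h4 : x ^ (d+2) ≤ x ^ 2 * (1/2) ^ d := by
        rw [pow_add, mul_comm]
        exact mul_le_mul_of_nonneg_left (pow_le_pow_left₀ hx0 hρL d) (by positivity)
      calc |((d+1+1 : ℕ) : ℝ) - 1| * NN D ρ (bind₁ (ps v) (p (d+2) j))
          ≤ 2 ^ (d+2) * (M * L ^ (d+2) * (2 * ρ) ^ (d+2)) := mul_le_mul h3 h2 (NN_nonneg hρ _) (by positivity)
        _ = M * x ^ (d+2) := by
          rw [hx, show 4 * L * ρ = 2 * (L * (2 * ρ)) by ring]; simp only [mul_pow]; ring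
        _ ≤ M * (x ^ 2 * (1/2) ^ d) := mul_le_mul_of_nonneg_left h4 hM
        _ = 4 * M * x ^ 2 * (1 / 2) ^ (d+1+1) := by rw [pow_succ, pow_succ]; ring
  refine (Finset.sum_le_sum hterm).trans ?_
  rw [← Finset.mul_sum]
  have := sum_geometric_two_le (D+1)
  have h0 : 0 ≤ 4 * M * x ^ 2 := by positivity
  calc 4 * M * x ^ 2 * ∑ i ∈ range (D+1), (1 / 2 : ℝ) ^ i ≤ 4 * M * x ^ 2 * 2 := mul_le_mul_of_nonneg_left this h0
    _ = 8 * M * x ^ 2 := by ring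

lemma key_bound (hq : 2 ≤ q) (hp : Dat τ p) {M L : ℝ} (hM : 0 ≤ M) (hL : 0 ≤ L) (hpM : ∀ d j, ell (p d j) ≤ M * L ^ d)
    (h : St τ p D v Z) (hρ : 0 ≤ ρ) {δ : ℝ} (hδ : δ ≤ 1) (hδ2 : (n:ℝ) ^ q * ((1 + δ) ^ q - 1) ≤ 1 / 2)
    (hS : SS D v ρ ≤ δ) (hρL : 4 * L * ρ ≤ 1 / 2) :
    ρ * SS D v ρ ≤ (2 * (1 + n)) * (n * ((q+1) * (16 * n ^ q * M * (4 * L) ^ 2))) * ρ ^ 2 := by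
  set S := SS D v ρ with hSd
  have hS0 : 0 ≤ S := SS_nonneg hρ
  set B := ∑ j, NN D ρ (τ.LZ Z j) with hB
  have hB0 : 0 ≤ B := Finset.sum_nonneg fun j _ => NN_nonneg hρ _
  have h1 : B ≤ ∑ _j : Fin q → Fin n, (8 * M * (4 * L * ρ) ^ 2 + ((1 + S) ^ q - 1) * B) := by
    refine Finset.sum_le_sum fun j _ => (LZ_rec hp h hρ j).trans ?_
    exact add_le_add (Q_bound hp hM hL hpM h hρ (hS.trans hδ) hρL j) le_rfl
  simp only [sum_const, card_univ, Fintype.card_fun, Fintype.card_fin, nsmul_eq_mul, Nat.cast_pow] at h1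
  have hn0 : (0:ℝ) ≤ (n:ℝ) ^ q := by positivity
  have h2 : (n:ℝ) ^ q * ((1 + S) ^ q - 1) ≤ 1 / 2 := by
    refine le_trans (mul_le_mul_of_nonneg_left ?_ hn0) hδ2
    have := pow_le_pow_left₀ (by linarith : 0 ≤ 1 + S) (by linarith : 1 + S ≤ 1 + δ) q
    linarith
  have h3 : B ≤ 16 * n ^ q * M * (4 * L * ρ) ^ 2 := by
    have := mul_le_mul_of_nonneg_right h2 hB0
    nlinarith
  have h4 : ∑ l, NN D ρ (Z l) ≤ n * ((q+1) * B) := by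
    have : ∑ l, NN D ρ (Z l) ≤ ∑ _l : Fin n, ((q+1) * B) := Finset.sum_le_sum fun l _ => NN_Z hq h hρ l
    simpa using this
  have hq0 : (0:ℝ) ≤ q + 1 := by positivity
  have hnn : (0:ℝ) ≤ n := by positivity
  have h5 : ∑ l, NN D ρ (Z l) ≤ n * ((q+1) * (16 * n ^ q * M * (4 * L * ρ) ^ 2)) :=
    h4.trans (mul_le_mul_of_nonneg_left (mul_le_mul_of_nonneg_left h3 hq0) hnn)
  have h6 : 2 * (1 + n * S) ≤ 2 * (1 + n) := by
    have := mul_le_mul_of_nonneg_left (hS.trans hδ) hnn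
    linarith
  refine (SS_rec h hρ).trans ?_
  refine (mul_le_mul h6 h5 (Finset.sum_nonneg fun l _ => NN_nonneg hρ _) (by positivity)).trans (le_of_eq ?_)
  ring

/-- a priori bound, uniform in the truncation order -/
lemma apriori (hq : 2 ≤ q) (hp : Dat τ p) {M L : ℝ} (hM : 0 ≤ M) (hL : 0 ≤ L) (hpM : ∀ d j, ell (p d j) ≤ M * L ^ d) :
    ∃ ρ : ℝ, 0 < ρ ∧ ∀ D v Z, St τ p D v Z → SS D v ρ ≤ 1 := by
  obtain ⟨δ, hδ0, hδ1, hδ2⟩ : ∃ δ : ℝ, 0 < δ ∧ δ ≤ 1 ∧ (n:ℝ) ^ q * ((1 + δ) ^ q - 1) ≤ 1 / 2 := by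
    have hc : Filter.Tendsto (fun δ : ℝ => (n:ℝ) ^ q * ((1 + δ) ^ q - 1)) (𝓝[>] 0) (𝓝 ((n:ℝ) ^ q * ((1 + 0) ^ q - 1))) := by
      apply Filter.Tendsto.mono_left _ nhdsWithin_le_nhds
      apply Continuous.tendsto
      fun_prop
    simp only [add_zero, one_pow, sub_self, mul_zero] at hc
    have h1 := hc.eventually (eventually_le_nhds (by norm_num : (0:ℝ) < 1/2))
    have h2 : ∀ᶠ δ : ℝ in 𝓝[>] 0, δ ≤ 1 := Filter.Eventually.filter_mono nhdsWithin_le_nhds (eventually_le_nhds one_pos)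
    have h3 : ∀ᶠ δ : ℝ in 𝓝[>] 0, 0 < δ := eventually_mem_nhdsWithin
    obtain ⟨δ, h⟩ := (h1.and (h2.and h3)).exists
    exact ⟨δ, h.2.2, h.2.1, h.1⟩
  set K : ℝ := (2 * (1 + n)) * (n * ((q+1) * (16 * n ^ q * M * (4 * L) ^ 2))) with hK
  have hK0 : 0 ≤ K := by positivity
  obtain ⟨ρ0, hρ0, hρ1, hρ2⟩ : ∃ ρ : ℝ, 0 < ρ ∧ K * ρ < δ ∧ 4 * L * ρ ≤ 1 / 2 := by
    refine ⟨min (δ / (K + 1) / 2) (1 / (8 * L + 1)), by positivity, ?_, ?_⟩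
    · have h1 : K * min (δ / (K + 1) / 2) (1 / (8 * L + 1)) ≤ (K+1) * (δ / (K + 1) / 2) := by
        apply mul_le_mul (by linarith) (min_le_left _ _) (by positivity) (by positivity)
      have h2 : (K+1) * (δ / (K + 1) / 2) = δ / 2 := by field_simp
      linarith
    · have h1 : 4 * L * min (δ / (K + 1) / 2) (1 / (8 * L + 1)) ≤ 4 * L * (1 / (8 * L + 1)) :=
        mul_le_mul_of_nonneg_left (min_le_right _ _) (by positivity)
      refine h1.trans ?_
      rw [mul_one_div, div_le_div_iff₀ (by positivity) (by norm_num)]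
      linarith
  refine ⟨ρ0, hρ0, fun D v Z h => ?_⟩
  by_contra! hc
  have hcont : ContinuousOn (fun ρ => SS D v ρ) (Set.Icc 0 ρ0) := by
    apply Continuous.continuousOn
    unfold SS
    fun_prop
  have hzero : SS D v 0 = 0 := by
    unfold SS
    refine Finset.sum_eq_zero fun i _ => Finset.sum_eq_zero fun d _ => ?_
    rcases d with _ | _ | d
    · simp
    · rw [bom_ord (by omega) (h.v2 i)]; simp
    · simp
  obtain ⟨ρ, hρ, hρS⟩ := intermediate_value_Icc hρ0.le hcont (show δ ∈ Set.Icc (SS D v 0) (SS D v ρ0) from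
    ⟨by rw [hzero]; exact hδ0.le, hδ1.trans hc.le⟩)
  simp only at hρS
  have hρpos : 0 < ρ := by
    rcases hρ.1.eq_or_lt with h0 | h0
    · rw [← h0, hzero] at hρS; exact absurd hρS hδ0.ne
    · exact h0
  have h1 := key_bound hq hp hM hL hpM h hρpos.le hδ1 hδ2 hρS.le
    ((mul_le_mul_of_nonneg_left hρ.2 (by positivity)).trans hρ2)
  rw [← hK, hρS] at h1
  have h2 : δ ≤ K * ρ := by
    have : ρ * δ ≤ ρ * (K * ρ) := by linarith [h1, (by ring : K * ρ ^ 2 = ρ * (K * ρ))]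
    exact le_of_mul_le_mul_left this hρpos
  have h3 : K * ρ ≤ K * ρ0 := mul_le_mul_of_nonneg_left hρ.2 hK0
  linarith

end bounds

end NambuLin


namespace NambuLin

open MvPolynomial Finset
open scoped Nat Topology ContDiff

section link
open Asymptotics Filter
variable {n q : ℕ}

/-- an analytic Nambu tensor together with its Taylor components -/
structure Src (τ : Top n (q+1)) (t : Fin q → Fin n) (T : (Fin n → ℝ) → Ten ℝ n q) (p : ℕ → Ten (Pol n) n q) : Prop where
  ht : Function.Injective t
  alt : ∀ x, IsAlt (T x)
  an : AnalyticAt ℝ T 0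
  nam : ∀ᶠ x in 𝓝 0, T x ≠ 0 → NamAt t T x
  dat : Dat τ p
  tay : ∀ D j, (fun x => T x j - eval x (psum p D j)) =O[𝓝 0] (fun x : Fin n → ℝ => ‖x‖ ^ (D+1))

variable {τ : Top n (q+1)} {t : Fin q → Fin n} {T : (Fin n → ℝ) → Ten ℝ n q} {p : ℕ → Ten (Pol n) n q}

noncomputable def psi (v : Fin n → Pol n) (x : Fin n → ℝ) : Fin n → ℝ := fun i => eval x (ps v i)

lemma eval_act {x : Fin n → ℝ} (J : Matrix (Fin n) (Fin n) (Pol n)) (w : Ten (Pol n) n q) (j : Fin q → Fin n) :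
    eval x (act J w j) = act (J.map (eval x)) (fun i => eval x (w i)) j := by
  simp [act, map_sum, map_mul, map_prod]

lemma psi_an (v : Fin n → Pol n) (x : Fin n → ℝ) : AnalyticAt ℝ (psi v) x :=
  (analyticAt_pi_iff).2 fun i => eval_analytic _ _

lemma jac_psi (v : Fin n → Pol n) (x : Fin n → ℝ) : jac (psi v) x = (JJ v).map (eval x) := by
  ext i j
  simp only [jac, JJ, Matrix.of_apply, Matrix.map_apply]
  rw [← (eval_pderiv_fderiv (ps v i) x).2 j]
  have := fderiv_apply (𝕜 := ℝ) (i := i) (hΦ := (psi_an v x).differentiableAt)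
  exact (congrArg (fun L => L (Pi.single j 1)) this).symm

lemma jac_comp {Φ ψ : (Fin n → ℝ) → (Fin n → ℝ)} {x : Fin n → ℝ} (hΦ : DifferentiableAt ℝ Φ (ψ x))
    (hψ : DifferentiableAt ℝ ψ x) : jac (Φ ∘ ψ) x = jac Φ (ψ x) * jac ψ x := by
  ext i j
  have h1 : fderiv ℝ (Φ ∘ ψ) x = (fderiv ℝ Φ (ψ x)).comp (fderiv ℝ ψ x) := fderiv_comp x hΦ hψ
  have h2 := jac_mulVec hΦ (fderiv ℝ ψ x (Pi.single j 1)) i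
  rw [fderiv_apply (𝕜 := ℝ) (hΦ := hΦ)] at h2
  simp only [jac, Matrix.of_apply, h1, Matrix.mul_apply]
  exact h2.symm

lemma act_isBigO {k : ℕ} {M : (Fin n → ℝ) → Matrix (Fin n) (Fin n) ℝ} {B : (Fin n → ℝ) → Ten ℝ n q}
    (hM : ∀ i j, (fun x => M x i j) =O[𝓝 0] (fun _ => (1:ℝ)))
    (hB : ∀ j, (fun x => B x j) =O[𝓝 0] (fun x : Fin n → ℝ => ‖x‖ ^ k)) (j : Fin q → Fin n) :
    (fun x => act (M x) (B x) j) =O[𝓝 0] (fun x : Fin n → ℝ => ‖x‖ ^ k) := by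
  unfold act
  refine IsBigO.fun_sum (E' := ℝ) fun i _ => ?_
  have h1 : (fun x => ∏ a, M x (j a) (i a)) =O[𝓝 0] (fun _ => ∏ a : Fin q, (1:ℝ)) :=
    IsBigO.finsetProd fun a _ => hM _ _
  simpa using h1.mul (hB i)

lemma psi_zero {v : Fin n → Pol n} (hv : ∀ i, v i ∈ Ord n 2) : psi v 0 = 0 := by
  funext i
  have := (mem_ord.1 (ps_ord hv i)) 0 (by simp)
  simpa [psi, constantCoeff_eq] using this

lemma JJ_zero_eval {v : Fin n → Pol n} (hv : ∀ i, v i ∈ Ord n 2) : (JJ v).map (eval 0) = 1 := by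
  ext i j
  have := (mem_ord.1 (JJ_ord hv i j)) 0 (by simp)
  rw [coeff_sub, sub_eq_zero] at this
  rw [Matrix.map_apply]
  have h1 : ∀ f : Pol n, eval 0 f = coeff 0 f := fun f => by simp [constantCoeff_eq]
  rw [h1, this, Matrix.one_apply, Matrix.one_apply]
  split_ifs <;> simp

lemma psi_isBigO {v : Fin n → Pol n} (hv : ∀ i, v i ∈ Ord n 2) : psi v =O[𝓝 0] (fun x : Fin n → ℝ => ‖x‖) := by
  rw [isBigO_pi]
  intro i
  have := eval_isBigO (ps_ord hv i)
  simp only [pow_one] at this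
  exact this

lemma kap_alt (hp : Dat τ p) (D : ℕ) (v : Fin n → Pol n) : IsAlt (kap τ p D v) := by
  have h : IsAlt (GG τ p (D+1) v) := by
    have h1 : IsAlt (psum p (D+1)) := by
      have : psum p (D+1) = ∑ d ∈ range (D+1+1), p d := by funext j; simp [psum]
      rw [this]; exact IsAlt.sum _ fun d _ => hp.alt d
    refine IsAlt.sub ?_ (τ.P0_alt.act _)
    intro j σ
    show bind₁ _ _ = _ * bind₁ _ _
    rw [h1 j σ, map_mul, map_intCast]
  intro j σ
  unfold kap
  rw [h j σ]
  rcases Int.units_eq_one_or (Equiv.Perm.sign σ) with h | h <;> simp [h]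

lemma inv_an {v : Fin n → Pol n} (hv : ∀ i, v i ∈ Ord n 2) (i j : Fin n) :
    AnalyticAt ℝ (fun x => ((JJ v).map (eval x))⁻¹ i j) 0 := by
  have h1 : (fun x => ((JJ v).map (eval x))⁻¹ i j) = fun x => (eval x (JJ v).det)⁻¹ * eval x ((JJ v).adjugate i j) := by
    funext x
    have e1 := RingHom.map_det (eval x) (JJ v)
    have e2 := RingHom.map_adjugate (eval x) (JJ v)
    rw [Matrix.inv_def, Ring.inverse_eq_inv', Matrix.smul_apply, smul_eq_mul, e1]
    congr 1
    have := congrFun (congrFun e2 i) j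
    exact this.symm
  rw [h1]
  refine AnalyticAt.mul (AnalyticAt.inv (eval_analytic _ _) ?_) (eval_analytic _ _)
  rw [RingHom.map_det, RingHom.mapMatrix_apply, JJ_zero_eval hv]
  simp

lemma det_ev {v : Fin n → Pol n} (hv : ∀ i, v i ∈ Ord n 2) :
    ∀ᶠ x in 𝓝 0, IsUnit ((JJ v).map (eval x)).det := by
  have h1 : ∀ x : Fin n → ℝ, ((JJ v).map (eval x)).det = eval x (JJ v).det := fun x => (RingHom.map_det (eval x) (JJ v)).symm
  have h2 := (eval_analytic (JJ v).det 0).continuousAt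
  have h3 : eval 0 (JJ v).det ≠ 0 := by rw [← h1, JJ_zero_eval hv]; simp
  filter_upwards [h2.eventually_ne h3] with x hx
  rw [h1]; exact hx.isUnit

lemma Src.cyc (h : Src τ t T p) {D : ℕ} (hD : 1 ≤ D) {v Z : Fin n → Pol n} (hs : St τ p D v Z) :
    Cyc τ t (fun x => act ((JJ v).map (eval x))⁻¹ (T (psi v x))) (kap τ p D v) (D+1) := by
  have hψ0 : Tendsto (psi v) (𝓝 0) (𝓝 0) := by
    have := (psi_an v 0).continuousAt.tendsto
    rwa [psi_zero hs.v2] at this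
  have khom : ∀ j, (kap τ p D v j).IsHomogeneous (D+1) := fun j => homogeneousComponent_isHomogeneous _ _
  refine ⟨h.ht, by omega, fun x => (h.alt _).act _, ?_, ?_, kap_alt h.dat D v, khom, ?_⟩
  · rw [analyticAt_pi_iff]
    intro j
    unfold act
    refine Finset.analyticAt_fun_sum _ fun i _ => ?_
    refine AnalyticAt.mul (Finset.analyticAt_fun_prod _ fun a _ => inv_an hs.v2 _ _) ?_
    have h1 : AnalyticAt ℝ T (psi v 0) := by rw [psi_zero hs.v2]; exact h.an
    exact (analyticAt_pi_iff.1 (h1.comp (psi_an v 0))) i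
  · filter_upwards [hψ0.eventually h.nam, (det_ev hs.v2).eventually_nhds] with x hx hd hR
    obtain ⟨Φ, hΦ, hΦ2⟩ := hx (fun h0 => hR (by rw [h0, act_zero]))
    refine ⟨Φ ∘ psi v, hΦ.comp x (psi_an v x).contDiffAt, ?_⟩
    have hdΦ : ∀ᶠ y in 𝓝 (psi v x), DifferentiableAt ℝ Φ y := by
      filter_upwards [hΦ.eventually (by simp)] with y hy
      exact hy.differentiableAt (by simp)
    have hc := (psi_an v x).continuousAt
    filter_upwards [hc.eventually hΦ2, hc.eventually hdΦ, hd] with y h1 h2 h3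
    rw [jac_comp h2 (psi_an v y).differentiableAt, jac_psi]
    refine ⟨h1.1.mul ((Matrix.isUnit_iff_isUnit_det _).2 h3), ?_⟩
    rw [← act_mul, Matrix.mul_assoc, Matrix.mul_nonsing_inv _ h3, Matrix.mul_one, h1.2]
  · intro j
    refine ⟨add_mem (P0_ord j) (ord_homog (by omega) (khom j)), ?_⟩
    set w : Ten (Pol n) n q := τ.P0 + kap τ p D v with hw
    let B : (Fin n → ℝ) → Ten ℝ n q := fun x => T (psi v x) - act ((JJ v).map (eval x)) (fun i => eval x (w i))
    have hB : ∀ j, (fun x => B x j) =O[𝓝 0] (fun x : Fin n → ℝ => ‖x‖ ^ (D+1+1)) := by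
      intro j
      have h1 : (fun x => T (psi v x) j - eval (psi v x) (psum p (D+1) j)) =O[𝓝 0] (fun x : Fin n → ℝ => ‖x‖ ^ (D+1+1)) :=
        ((h.tay (D+1) j).comp_tendsto hψ0).trans ((psi_isBigO hs.v2).norm_left.pow (D+1+1))
      have h2 : bind₁ (ps v) (psum p (D+1) j) - act (JJ v) w j ∈ Ord n (D+1+1) := by
        have e1 := ord_sub_homComp (GG_succ h.dat hs.v2 j (hs.eq j))
        have e2 := ord_mono (show D+1+1 ≤ 1 + (D+1) by omega) (act_ord (JJ_ord hs.v2) (fun i => ord_homog le_rfl (khom i)) j)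
        rw [act_one] at e2
        convert sub_mem e1 e2 using 1
        rw [hw, act_add]
        simp only [GG, kap, Pi.add_apply]
        ring
      refine (h1.add (eval_isBigO h2)).congr_left fun x => ?_
      simp only [B, Pi.sub_apply, map_sub, eval_act]
      have : eval x (bind₁ (ps v) (psum p (D+1) j)) = eval (psi v x) (psum p (D+1) j) := eval₂Hom_bind₁ _ _ _ _
      rw [this]; ring
    have hM : ∀ i j, (fun x => ((JJ v).map (eval x))⁻¹ i j) =O[𝓝 0] (fun _ => (1:ℝ)) := fun i j =>
      (inv_an hs.v2 i j).continuousAt.tendsto.isBigO_one ℝ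
    have := act_isBigO hM hB j
    rw [show 1 + (D+1) = D+1+1 by omega]
    refine this.congr' ?_ (EventuallyEq.refl _ _)
    filter_upwards [det_ev hs.v2] with x hx
    have e3 : act ((JJ v).map (eval x))⁻¹ (act ((JJ v).map (eval x)) (fun i => eval x (w i))) = fun i => eval x (w i) := by
      rw [← act_mul, Matrix.nonsing_inv_mul _ hx, act_one]
    have e4 : act ((JJ v).map (eval x))⁻¹ (T (psi v x)) = act ((JJ v).map (eval x))⁻¹ (B x) + fun i => eval x (w i) := by
      rw [← e3, ← act_add]; simp [B]
    rw [e4]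
    simp [w]

lemma Src.step (h : Src τ t T p) (hq : 2 ≤ q) {D : ℕ} (hD : 1 ≤ D) {v Z : Fin n → Pol n} (hs : St τ p D v Z) :
    ∃ u z : Fin n → Pol n, (∀ i, (u i).IsHomogeneous (D+1)) ∧ St τ p (D+1) (v + u) (Z + z) := by
  obtain ⟨u, z, hu, -, h⟩ := hs.step h.dat hD (fun c W hW => τ.hom_step hq (h.cyc hD hs) c hW)
  exact ⟨u, z, hu, h⟩

end link

end NambuLin


namespace NambuLin

open MvPolynomial Finset
open scoped Nat Topology ContDiff

section taylor
open Asymptotics Filter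
variable {n q : ℕ}

lemma ell_le_of_subset {f : Pol n} {s : Finset (Fin n →₀ ℕ)} (h : f.support ⊆ s) : ell f = ∑ α ∈ s, |coeff α f| := by
  unfold ell
  refine Finset.sum_subset h fun α _ hα => ?_
  rw [notMem_support_iff.1 hα, abs_zero]

lemma ell_add (f g : Pol n) : ell (f + g) ≤ ell f + ell g := by
  classical
  rw [ell_le_of_subset (s := f.support ∪ g.support) support_add,
    ell_le_of_subset (f := f) (s := f.support ∪ g.support) subset_union_left,
    ell_le_of_subset (f := g) (s := f.support ∪ g.support) subset_union_right, ← Finset.sum_add_distrib]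
  exact Finset.sum_le_sum fun α _ => by rw [coeff_add]; exact abs_add_le _ _

lemma ell_zero : ell (0 : Pol n) = 0 := by simp [ell]

lemma ell_sum {ι : Type*} (s : Finset ι) (f : ι → Pol n) : ell (∑ i ∈ s, f i) ≤ ∑ i ∈ s, ell (f i) := by
  classical
  induction s using Finset.induction_on with
  | empty => simp [ell_zero]
  | insert a s ha ih =>
    rw [sum_insert ha, sum_insert ha]
    exact (ell_add _ _).trans (by linarith)

lemma ell_nonneg (f : Pol n) : 0 ≤ ell f := Finset.sum_nonneg fun _ _ => abs_nonneg _

lemma ell_C_mul (c : ℝ) (f : Pol n) : ell (C c * f) = |c| * ell f := by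
  have h : (C c * f).support ⊆ f.support := by
    intro α hα
    rw [mem_support_iff, coeff_C_mul] at hα
    exact mem_support_iff.2 (right_ne_zero_of_mul hα)
  rw [ell_le_of_subset h, ell, Finset.mul_sum]
  exact Finset.sum_congr rfl fun α _ => by rw [coeff_C_mul, abs_mul]

lemma ell_prod_X {d : ℕ} (σ : Fin d → Fin n) : ell (∏ i, (X (σ i) : Pol n)) ≤ 1 := by
  have : ∏ i, (X (σ i) : Pol n) = monomial (∑ i, Finsupp.single (σ i) 1) 1 := by
    simp only [X]
    rw [monomial_sum_one]
  rw [this, ell_le_of_subset support_monomial_subset]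
  simp

/-- the homogeneous polynomial of a multilinear map, componentwise -/
noncomputable def tpol {ι : Type*} [Fintype ι] {d : ℕ} (S : ContinuousMultilinearMap ℝ (fun _ : Fin d => (Fin n → ℝ)) (ι → ℝ)) (I : ι) : Pol n :=
  ∑ σ : Fin d → Fin n, C (S (fun i => Pi.single (σ i) 1) I) * ∏ i, X (σ i)

variable {ι : Type*} [Fintype ι] {d : ℕ} (S : ContinuousMultilinearMap ℝ (fun _ : Fin d => (Fin n → ℝ)) (ι → ℝ)) (I : ι)

lemma tpol_hom : (tpol S I).IsHomogeneous d := by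
  refine IsHomogeneous.sum _ _ _ fun σ _ => ?_
  have h1 : (∏ i, (X (σ i) : Pol n)).IsHomogeneous (∑ i : Fin d, 1) := IsHomogeneous.prod _ _ _ fun i _ => isHomogeneous_X _ _
  have := (isHomogeneous_C (Fin n) (S (fun i => Pi.single (σ i) 1) I)).mul h1
  simpa using this

lemma tpol_eval (x : Fin n → ℝ) : eval x (tpol S I) = S (fun _ => x) I := by
  have hx : x = ∑ j, x j • (Pi.single j 1 : Fin n → ℝ) := by
    funext i
    simp [Finset.sum_apply, Pi.single_apply]
  conv_rhs => rw [hx]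
  have := S.map_sum (fun (_ : Fin d) j => x j • (Pi.single j 1 : Fin n → ℝ))
  rw [this, Finset.sum_apply, tpol, map_sum]
  refine Finset.sum_congr rfl fun σ _ => ?_
  rw [S.map_smul_univ (fun i => x (σ i)) (fun i => Pi.single (σ i) 1)]
  simp [mul_comm]

lemma tpol_ell : ell (tpol S I) ≤ ‖S‖ * (n:ℝ) ^ d := by
  refine (ell_sum _ _).trans ?_
  have : ∀ σ ∈ (univ : Finset (Fin d → Fin n)), ell (C (S (fun i => Pi.single (σ i) 1) I) * ∏ i, (X (σ i) : Pol n)) ≤ ‖S‖ := by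
    intro σ _
    rw [ell_C_mul]
    have h1 : |S (fun i => Pi.single (σ i) 1) I| ≤ ‖S‖ := by
      have h2 := norm_le_pi_norm (S (fun i => Pi.single (σ i) 1)) I
      have h3 := S.le_opNorm (fun i => Pi.single (σ i) 1)
      have h4 : ∏ i, ‖(Pi.single (σ i) 1 : Fin n → ℝ)‖ = 1 := by simp [Pi.norm_single]
      rw [h4, mul_one] at h3
      exact h2.trans h3
    calc _ ≤ ‖S‖ * 1 := mul_le_mul h1 (ell_prod_X σ) (ell_nonneg _) (norm_nonneg _)
      _ = _ := mul_one _
  refine (Finset.sum_le_sum this).trans ?_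
  rw [Finset.sum_const, card_univ, Fintype.card_fun]
  simp [mul_comm]

lemma dt_C (t : Fin q → Fin n) (j : Fin q → Fin n) : dt (eI (R := Pol n) t) j = C (dt (eI (R := ℝ) t) j) := by
  unfold dt
  rw [RingHom.map_det]
  congr 1
  ext a b : 1
  simp only [Matrix.submatrix_apply, eI, RingHom.mapMatrix_apply, Matrix.map_apply, id]
  split_ifs <;> simp

lemma exists_dat {τ : Top n (q+1)} {P : (Fin n → ℝ) → MultiVec n q} (hP : AnalyticAt ℝ P 0) (hP0 : P 0 = 0)
    (hlin : ∀ x j, toT (fderiv ℝ P 0 x) j = eval x (τ.P0 j)) :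
    ∃ (p : ℕ → Ten (Pol n) n q) (M L : ℝ), Dat τ p ∧ 0 ≤ M ∧ 0 ≤ L ∧ (∀ d j, ell (p d j) ≤ M * L ^ d) ∧
      ∀ D j, (fun x => toT (P x) j - eval x (psum p D j)) =O[𝓝 0] (fun x : Fin n → ℝ => ‖x‖ ^ (D+1)) := by
  obtain ⟨S, hS⟩ := hP
  let p : ℕ → Ten (Pol n) n q := fun d => ∑ I : Idx n q, tpol (S d) I • dt (eI (I.1.orderEmbOfFin I.2))
  have hpj : ∀ d j, p d j = ∑ I : Idx n q, C (dt (eI (R := ℝ) (I.1.orderEmbOfFin I.2)) j) * tpol (S d) I := by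
    intro d j
    simp only [p, Finset.sum_apply, Pi.smul_apply, smul_eq_mul, dt_C]
    exact Finset.sum_congr rfl fun I _ => mul_comm _ _
  have hev : ∀ d j x, eval x (p d j) = toT (S d (fun _ => x)) j := by
    intro d j x
    rw [hpj, map_sum, toT, Finset.sum_apply]
    refine Finset.sum_congr rfl fun I _ => ?_
    rw [map_mul, eval_C, tpol_eval, Pi.smul_apply, smul_eq_mul, mul_comm]
  have hhom : ∀ d j, (p d j).IsHomogeneous d := by
    intro d j
    rw [hpj]
    refine IsHomogeneous.sum _ _ _ fun I _ => ?_
    have := (isHomogeneous_C (Fin n) (dt (eI (R := ℝ) (I.1.orderEmbOfFin I.2)) j)).mul (tpol_hom (S d) I)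
    simpa using this
  obtain ⟨r, hr0, hr⟩ := ENNReal.lt_iff_exists_nnreal_btwn.1 hS.radius_pos
  have hr0' : (0:ℝ) < r := by exact_mod_cast hr0
  obtain ⟨c, hc, hcS⟩ := S.norm_le_div_pow_of_pos_of_lt_radius hr0' hr
  let K : ℝ := ∑ I : Idx n q, ∑ j : Fin q → Fin n, |dt (eI (R := ℝ) (I.1.orderEmbOfFin I.2)) j|
  refine ⟨p, K * c, n / r, ⟨hhom, fun d => IsAlt.sum _ fun I _ => (dt_alt _).smul _, ?_, ?_⟩,
    mul_nonneg (by positivity) hc.le, by positivity, ?_, ?_⟩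
  · funext j
    apply MvPolynomial.funext
    intro x
    rw [hev]
    have : S 0 (fun _ => x) = 0 := by rw [← hP0]; exact hS.coeff_zero _
    rw [this]; simp [toT]
  · funext j
    apply MvPolynomial.funext
    intro x
    rw [hev, ← hlin, hS.fderiv_eq]
    rfl
  · intro d j
    rw [hpj]
    refine (ell_sum _ _).trans ?_
    have h1 : ∀ I : Idx n q, ell (C (dt (eI (R := ℝ) (I.1.orderEmbOfFin I.2)) j) * tpol (S d) I) ≤
        (∑ j : Fin q → Fin n, |dt (eI (R := ℝ) (I.1.orderEmbOfFin I.2)) j|) * (c * (n / r) ^ d) := by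
      intro I
      rw [ell_C_mul]
      refine mul_le_mul ?_ ?_ (ell_nonneg _) (by positivity)
      · exact Finset.single_le_sum (f := fun j => |dt (eI (R := ℝ) (I.1.orderEmbOfFin I.2)) j|)
          (fun _ _ => abs_nonneg _) (mem_univ j)
      · refine (tpol_ell _ _).trans ((mul_le_mul_of_nonneg_right (hcS d) (by positivity)).trans_eq ?_)
        rw [div_pow]; ring
    refine (Finset.sum_le_sum fun I _ => h1 I).trans_eq ?_
    rw [← Finset.sum_mul, mul_assoc]
  · intro D j
    have h1 := hS.isBigO_sub_partialSum_pow (D+1)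
    simp only [zero_add] at h1
    rw [isBigO_pi] at h1
    have h2 : (fun x => ∑ I : Idx n q, dt (eI (R := ℝ) (I.1.orderEmbOfFin I.2)) j * (P x - S.partialSum (D+1) x) I)
        =O[𝓝 0] (fun x : Fin n → ℝ => ‖x‖ ^ (D+1)) :=
      IsBigO.fun_sum (E' := ℝ) fun I _ => (h1 I).const_mul_left _
    refine h2.congr_left fun x => ?_
    simp only [psum, map_sum, hev, toT, Finset.sum_apply, Pi.smul_apply, smul_eq_mul, Pi.sub_apply,
      FormalMultilinearSeries.partialSum]
    rw [Finset.sum_comm, ← Finset.sum_sub_distrib]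
    refine Finset.sum_congr rfl fun I _ => ?_
    rw [← Finset.sum_mul]; ring

end taylor

end NambuLin


namespace NambuLin

open MvPolynomial Finset
open scoped Nat Topology ContDiff

section conv
open Asymptotics Filter
variable {n q : ℕ}

lemma exists_slots (d : ℕ) : ∀ α : Fin n →₀ ℕ, α.degree = d →
    ∃ σ : Fin d → Fin n, ∀ x : Fin n → ℝ, ∏ i, x (σ i) = ∏ i, x i ^ α i := by
  induction d with
  | zero =>
    intro α hα
    have : α = 0 := (Finsupp.degree_eq_zero_iff α).1 hα
    exact ⟨Fin.elim0, fun x => by simp [this]⟩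
  | succ d ih =>
    intro α hα
    have h1 : ∃ i, α i ≠ 0 := by
      by_contra h
      push Not at h
      have : α = 0 := Finsupp.ext h
      rw [this] at hα; simp at hα
    obtain ⟨i, hi⟩ := h1
    have h2 : α - Finsupp.single i 1 + Finsupp.single i 1 = α := by
      ext j
      by_cases hj : j = i
      · subst hj; simp; omega
      · simp [hj, Finsupp.single_apply, Ne.symm hj]
    have h3 : (α - Finsupp.single i 1).degree = d := by
      have := congrArg Finsupp.degree h2
      rw [map_add, hα, Finsupp.degree_single] at this
      omega
    obtain ⟨σ, hσ⟩ := ih _ h3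
    refine ⟨Fin.cons i σ, fun x => ?_⟩
    rw [Fin.prod_univ_succ]
    simp only [Fin.cons_zero, Fin.cons_succ]
    rw [hσ]
    conv_rhs => rw [← h2]
    simp only [Finsupp.add_apply, pow_add, Finset.prod_mul_distrib]
    have : ∏ l, x l ^ (Finsupp.single i 1 : Fin n →₀ ℕ) l = x i := by
      rw [Finset.prod_eq_single i]
      · simp
      · intro b _ hb; simp [Finsupp.single_apply, Ne.symm hb]
      · simp
    rw [this, mul_comm]

lemma exists_cmm {d : ℕ} {f : Pol n} (hf : f.IsHomogeneous d) :
    ∃ S : ContinuousMultilinearMap ℝ (fun _ : Fin d => (Fin n → ℝ)) ℝ,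
      (∀ x, S (fun _ => x) = eval x f) ∧ ‖S‖ ≤ ell f := by
  have h1 : ∀ α : Fin n →₀ ℕ, ∃ S : ContinuousMultilinearMap ℝ (fun _ : Fin d => (Fin n → ℝ)) ℝ,
      (α ∈ f.support → ∀ x, S (fun _ => x) = ∏ i, x i ^ α i) ∧ ‖S‖ ≤ 1 := by
    intro α
    by_cases hα : α ∈ f.support
    · have hd : α.degree = d := by
        have := hf (mem_support_iff.1 hα)
        rwa [wt_one] at this
      obtain ⟨σ, hσ⟩ := exists_slots d α hd
      refine ⟨(ContinuousMultilinearMap.mkPiAlgebra ℝ (Fin d) ℝ).compContinuousLinearMap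
        (fun i => (ContinuousLinearMap.proj (σ i) : (Fin n → ℝ) →L[ℝ] ℝ)), fun _ x => ?_, ?_⟩
      · rw [← hσ x]; simp
      · refine ContinuousMultilinearMap.opNorm_le_bound zero_le_one fun m => ?_
        simp only [ContinuousMultilinearMap.compContinuousLinearMap_apply, ContinuousLinearMap.proj_apply,
          ContinuousMultilinearMap.mkPiAlgebra_apply, one_mul, norm_prod]
        exact Finset.prod_le_prod (fun _ _ => norm_nonneg _) fun i _ => norm_le_pi_norm (m i) (σ i)
    · exact ⟨0, fun h => absurd h hα, by simp⟩
  choose S hS1 hS2 using h1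
  refine ⟨∑ α ∈ f.support, coeff α f • S α, fun x => ?_, ?_⟩
  · rw [eval_eq', ContinuousMultilinearMap.sum_apply]
    refine Finset.sum_congr rfl fun α hα => ?_
    rw [ContinuousMultilinearMap.smul_apply, hS1 α hα, smul_eq_mul]
  · refine (norm_sum_le _ _).trans (Finset.sum_le_sum fun α _ => ?_)
    rw [norm_smul, Real.norm_eq_abs]
    exact mul_le_of_le_one_right (abs_nonneg _) (hS2 α)

lemma exists_analytic {f : ℕ → Pol n} (hf : ∀ d, (f d).IsHomogeneous d) {M L : ℝ} (hL : 0 < L)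
    (hM : ∀ d, ell (f d) ≤ M * L ^ d) :
    ∃ g : (Fin n → ℝ) → ℝ, AnalyticAt ℝ g 0 ∧
      ∀ D, (fun x => g x - ∑ d ∈ range D, eval x (f d)) =O[𝓝 0] (fun x : Fin n → ℝ => ‖x‖ ^ D) := by
  choose S hS1 hS2 using fun d => exists_cmm (hf d)
  let p : FormalMultilinearSeries ℝ (Fin n → ℝ) ℝ := S
  have hr : 0 < p.radius := by
    let r : NNReal := ⟨L⁻¹, by positivity⟩
    have h1 : (r : ENNReal) ≤ p.radius := by
      refine p.le_radius_of_bound M fun d => ?_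
      have h2 : ‖p d‖ ≤ M * L ^ d := (hS2 d).trans (hM d)
      calc ‖p d‖ * (L⁻¹) ^ d ≤ M * L ^ d * (L⁻¹) ^ d := mul_le_mul_of_nonneg_right h2 (by positivity)
        _ = M := by rw [mul_assoc, ← mul_pow, mul_inv_cancel₀ hL.ne', one_pow, mul_one]
    refine lt_of_lt_of_le ?_ h1
    have : (0:ℝ) < L⁻¹ := by positivity
    exact ENNReal.coe_pos.2 this
  have h := (p.hasFPowerSeriesOnBall hr).hasFPowerSeriesAt
  refine ⟨p.sum, h.analyticAt, fun D => ?_⟩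
  refine (h.isBigO_sub_partialSum_pow D).congr_left fun x => ?_
  simp only [zero_add, FormalMultilinearSeries.partialSum]
  congr 1
  exact Finset.sum_congr rfl fun d _ => hS1 d x

lemma multinom_le {d : ℕ} {α : Fin n →₀ ℕ} (hα : α.degree = d) : (d ! : ℝ) ≤ (n:ℝ) ^ d * mfac α := by
  have h1 := Finset.sum_pow_eq_sum_piAntidiag (univ : Finset (Fin n)) (fun _ => (1:ℕ)) d
  have h2 : Nat.multinomial univ α ≤ n ^ d := by
    simp at h1
    rw [h1]
    refine Finset.single_le_sum (f := fun k => Nat.multinomial univ k) (fun _ _ => Nat.zero_le _) (a := (α : Fin n → ℕ)) ?_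
    rw [mem_piAntidiag]
    exact ⟨by rw [← hα, Finsupp.degree_eq_sum], fun _ _ => mem_univ _⟩
  have h3 := Nat.multinomial_spec univ α
  rw [← Finsupp.degree_eq_sum, hα] at h3
  have h4 : (d ! : ℝ) = mfac α * Nat.multinomial univ α := by
    rw [← h3, mfac]; push_cast; ring
  rw [h4, mul_comm]
  exact mul_le_mul_of_nonneg_right (by exact_mod_cast h2) (mfac_pos α).le

lemma card_expo_le (d : ℕ) : ((expo n d).card : ℝ) ≤ (n:ℝ) ^ d := by
  have h1 := Finset.sum_pow_eq_sum_piAntidiag (univ : Finset (Fin n)) (fun _ => (1:ℕ)) d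
  simp at h1
  have h2 : (expo n d).card ≤ (piAntidiag (univ : Finset (Fin n)) d).card := by
    refine Finset.card_le_card_of_injOn (fun α => (α : Fin n → ℕ)) ?_ ?_
    · intro α hα
      have := mem_expo.1 hα
      show _ ∈ piAntidiag _ _
      rw [mem_piAntidiag]
      exact ⟨by rw [← this, Finsupp.degree_eq_sum], fun _ _ => mem_univ _⟩
    · exact fun a _ b _ h => DFunLike.coe_injective h
  have h3 : (piAntidiag (univ : Finset (Fin n)) d).card ≤ n ^ d := by
    rw [h1, Finset.card_eq_sum_ones]
    exact Finset.sum_le_sum fun k _ => Nat.multinomial_pos _ _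
  exact_mod_cast h2.trans h3

lemma ell_le_bom (hn : 1 ≤ n) {d : ℕ} {f : Pol n} (hf : f.IsHomogeneous d) : ell f ≤ ((n:ℝ) ^ 2) ^ d * bom d f := by
  have hn' : (1:ℝ) ≤ n := by exact_mod_cast hn
  have hnd : (1:ℝ) ≤ (n:ℝ) ^ d := one_le_pow₀ hn'
  have hb := bom_nonneg d f
  have h1 : ∀ α ∈ expo n d, |coeff α f| ≤ (n:ℝ) ^ d * bom d f := by
    intro α hα
    have h2 := multinom_le (mem_expo.1 hα)
    have h3 : mfac α / (d ! : ℝ) * coeff α f ^ 2 ≤ bom d f ^ 2 := by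
      rw [bom_sq]
      exact Finset.single_le_sum (f := fun α => mfac α / (d ! : ℝ) * coeff α f ^ 2)
        (fun β _ => mul_nonneg (div_nonneg (mfac_pos β).le (by positivity)) (sq_nonneg _)) hα
    have hd : (0:ℝ) < d ! := by exact_mod_cast Nat.factorial_pos d
    have h4 : 1 ≤ (n:ℝ) ^ d * (mfac α / (d ! : ℝ)) := by
      rw [← mul_div_assoc, le_div_iff₀ hd, one_mul]; exact h2
    apply abs_le_of_sq_le_sq _ (by positivity)
    calc coeff α f ^ 2 ≤ ((n:ℝ) ^ d * (mfac α / (d ! : ℝ))) * coeff α f ^ 2 := le_mul_of_one_le_left (sq_nonneg _) h4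
      _ = (n:ℝ) ^ d * ((mfac α / (d ! : ℝ)) * coeff α f ^ 2) := by ring
      _ ≤ (n:ℝ) ^ d * bom d f ^ 2 := mul_le_mul_of_nonneg_left h3 (by positivity)
      _ ≤ (n:ℝ) ^ d * ((n:ℝ) ^ d * bom d f ^ 2) := 
        mul_le_mul_of_nonneg_left (le_mul_of_one_le_left (sq_nonneg _) hnd) (by positivity)
      _ = ((n:ℝ) ^ d * bom d f) ^ 2 := by ring
  have hsub : f.support ⊆ expo n d := by
    intro α hα
    rw [mem_expo]
    have := hf (mem_support_iff.1 hα)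
    rwa [wt_one] at this
  rw [ell_le_of_subset hsub]
  refine (Finset.sum_le_card_nsmul _ _ _ h1).trans ?_
  rw [nsmul_eq_mul]
  calc ((expo n d).card : ℝ) * ((n:ℝ) ^ d * bom d f) ≤ (n:ℝ) ^ d * ((n:ℝ) ^ d * bom d f) :=
        mul_le_mul_of_nonneg_right (card_expo_le d) (by positivity)
    _ = _ := by rw [← pow_mul, ← mul_assoc, ← pow_add, two_mul]

end conv

end NambuLin


namespace NambuLin

open MvPolynomial Finset
open scoped Nat Topology ContDiff

section limit
open Asymptotics Filter
variable {n q : ℕ} {τ : Top n (q+1)} {t : Fin q → Fin n} {T : (Fin n → ℝ) → Ten ℝ n q} {p : ℕ → Ten (Pol n) n q}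

lemma Src.exists_seq (h : Src τ t T p) (hq : 2 ≤ q) : ∃ U : ℕ → Fin n → Pol n, (∀ d i, (U d i).IsHomogeneous d) ∧
    U 0 = 0 ∧ ∀ D, 1 ≤ D → ∃ Z, St τ p D (∑ d ∈ range (D+1), U d) Z := by
  have hstep : ∀ m (s : {vz : (Fin n → Pol n) × (Fin n → Pol n) // St τ p (m+1) vz.1 vz.2}),
      ∃ s' : {vz : (Fin n → Pol n) × (Fin n → Pol n) // St τ p (m+1+1) vz.1 vz.2},
        ∀ i, ((s'.1.1 - s.1.1) i).IsHomogeneous (m+2) := by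
    rintro m ⟨⟨v, Z⟩, hs⟩
    obtain ⟨u, z, hu, hs'⟩ := h.step hq (by omega) hs
    exact ⟨⟨(v + u, Z + z), hs'⟩, fun i => by simpa using hu i⟩
  choose nxt hnxt using hstep
  let F : ∀ m, {vz : (Fin n → Pol n) × (Fin n → Pol n) // St τ p (m+1) vz.1 vz.2} :=
    fun m => Nat.rec ⟨(0, 0), St.base h.dat⟩ (fun m s => nxt m s) m
  have hF0 : (F 0).1.1 = 0 := rfl
  have hF : ∀ m i, (((F (m+1)).1.1 - (F m).1.1) i).IsHomogeneous (m+2) := fun m i => hnxt m (F m) i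
  let U : ℕ → Fin n → Pol n := fun d => match d with
    | 0 => 0
    | 1 => 0
    | m+2 => (F (m+1)).1.1 - (F m).1.1
  have hsum : ∀ m, ∑ d ∈ range (m+1+1), U d = (F m).1.1 := by
    intro m
    induction m with
    | zero => rw [hF0]; simp [sum_range_succ, U]
    | succ m ih =>
      rw [Finset.sum_range_succ, ih]
      simp [U]
  refine ⟨U, ?_, rfl, ?_⟩
  · intro d i
    match d with
    | 0 => exact isHomogeneous_zero _ _ _
    | 1 => exact isHomogeneous_zero _ _ _
    | m+2 => exact hF m i
  · intro D hD
    obtain ⟨m, rfl⟩ : ∃ m, D = m+1 := ⟨D-1, by omega⟩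
    rw [hsum m]
    exact ⟨_, (F m).2⟩

lemma Src.exists_conv (h : Src τ t T p) (hq : 2 ≤ q) (hn : 1 ≤ n) {M L : ℝ} (hM : 0 ≤ M) (hL : 0 ≤ L)
    (hpM : ∀ d j, ell (p d j) ≤ M * L ^ d) :
    ∃ ψ : (Fin n → ℝ) → (Fin n → ℝ), AnalyticAt ℝ ψ 0 ∧ ∀ D, 1 ≤ D → ∃ v Z, St τ p D v Z ∧
      (fun x => ψ x - psi v x) =O[𝓝 0] (fun x : Fin n → ℝ => ‖x‖ ^ (D+1)) := by
  obtain ⟨U, hU, hU0, hSt⟩ := h.exists_seq hq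
  obtain ⟨ρ, hρ, hap⟩ := apriori hq h.dat hM hL hpM
  have hn' : (0:ℝ) < n := by exact_mod_cast hn
  have hb : ∀ d i, ell (U d i) ≤ ρ * ((n:ℝ) ^ 2 / ρ) ^ d := by
    intro d i
    rcases Nat.eq_zero_or_pos d with rfl | hd
    · rw [hU0]
      simp only [Pi.zero_apply, ell_zero]; positivity
    obtain ⟨Z, hs⟩ := hSt d hd
    have h1 := hap _ _ _ hs
    have h2 := (SS_single (D := d) (v := ∑ e ∈ range (d+1), U e) hρ.le i).trans h1
    have h3 : d * bom d ((∑ e ∈ range (d+1), U e) i) * ρ ^ (d - 1) ≤ 1 := by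
      refine le_trans ?_ h2
      exact Finset.single_le_sum (f := fun d' : ℕ => (d':ℝ) * bom d' ((∑ e ∈ range (d+1), U e) i) * ρ ^ (d' - 1))
        (fun e _ => mul_nonneg (mul_nonneg (Nat.cast_nonneg e) (bom_nonneg _ _)) (pow_nonneg hρ.le _))
        (Finset.self_mem_range_succ d)
    have h4 : bom d ((∑ e ∈ range (d+1), U e) i) = bom d (U d i) := by
      rw [← bom_homComp, Finset.sum_apply, map_sum, Finset.sum_eq_single d]
      · rw [homComp_self (hU d i)]
      · intro e _ he; exact homComp_ne he (hU e i)
      · intro hc; exact absurd (Finset.self_mem_range_succ d) hc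
    rw [h4] at h3
    have hb0 := bom_nonneg d (U d i)
    have hd1 : (1:ℝ) ≤ d := by exact_mod_cast hd
    have h5 : bom d (U d i) * ρ ^ (d-1) ≤ 1 := by
      refine le_trans (mul_le_mul_of_nonneg_right ?_ (by positivity)) h3
      exact le_mul_of_one_le_left hb0 hd1
    have h6 : bom d (U d i) ≤ ρ / ρ ^ d := by
      rw [le_div_iff₀ (by positivity)]
      obtain ⟨e, rfl⟩ : ∃ e, d = e+1 := ⟨d-1, by omega⟩
      rw [Nat.add_sub_cancel] at h5
      rw [pow_succ]
      nlinarith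
    refine (ell_le_bom hn (hU d i)).trans ((mul_le_mul_of_nonneg_left h6 (by positivity)).trans_eq ?_)
    rw [div_pow]; ring
  have hg := fun i => exists_analytic (f := fun d => U d i) (fun d => hU d i) (show 0 < (n:ℝ)^2/ρ by positivity) (fun d => hb d i)
  choose g hg1 hg2 using hg
  refine ⟨fun x => x + fun i => g i x, analyticAt_id.add (analyticAt_pi_iff.2 hg1), fun D hD => ?_⟩
  obtain ⟨Z, hs⟩ := hSt D hD
  refine ⟨_, Z, hs, ?_⟩
  rw [isBigO_pi]
  intro i
  refine (hg2 i (D+1)).congr_left fun x => ?_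
  simp [psi, ps]

lemma prod_sub_isBigO {ι : Type*} (s : Finset ι) {k : ℕ} {f g : ι → (Fin n → ℝ) → ℝ}
    (hf : ∀ a, f a =O[𝓝 0] (fun _ => (1:ℝ))) (hg : ∀ a, g a =O[𝓝 0] (fun _ => (1:ℝ)))
    (hfg : ∀ a, (fun x => f a x - g a x) =O[𝓝 0] (fun x : Fin n → ℝ => ‖x‖ ^ k)) :
    (fun x => ∏ a ∈ s, f a x - ∏ a ∈ s, g a x) =O[𝓝 0] (fun x : Fin n → ℝ => ‖x‖ ^ k) := by
  classical
  induction s using Finset.induction_on with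
  | empty => simp only [Finset.prod_empty, sub_self]; exact isBigO_zero _ _
  | insert a s ha ih =>
    have h1 : (fun x => ∏ a ∈ s, g a x) =O[𝓝 0] (fun _ => ∏ a ∈ s, (1:ℝ)) :=
      IsBigO.finsetProd fun a _ => hg a
    have h2 := (hf a).mul ih
    have h3 := (hfg a).mul h1
    simp only [one_mul, Finset.prod_const_one, mul_one] at h2 h3
    refine (h2.add h3).congr_left fun x => ?_
    rw [Finset.prod_insert ha, Finset.prod_insert ha]; ring

lemma jac_an {ψ : (Fin n → ℝ) → (Fin n → ℝ)} {x : Fin n → ℝ} (h : AnalyticAt ℝ ψ x) (i j : Fin n) :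
    AnalyticAt ℝ (fun y => jac ψ y i j) x := by
  have h1 := h.fderiv
  have h2 : AnalyticAt ℝ (fun y => fderiv ℝ ψ y (Pi.single j 1)) x :=
    ((ContinuousLinearMap.apply ℝ (Fin n → ℝ) (Pi.single j 1 : Fin n → ℝ)).analyticAt _).comp h1
  exact analyticAt_pi_iff.1 h2 i

lemma Src.exists_conj (h : Src τ t T p) (hq : 2 ≤ q) (hn : 1 ≤ n) {M L : ℝ} (hM : 0 ≤ M) (hL : 0 ≤ L)
    (hpM : ∀ d j, ell (p d j) ≤ M * L ^ d) :
    ∃ ψ : (Fin n → ℝ) → (Fin n → ℝ), AnalyticAt ℝ ψ 0 ∧ ψ 0 = 0 ∧ jac ψ 0 = 1 ∧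
      ∀ᶠ x in 𝓝 0, T (ψ x) = act (jac ψ x) (fun j => eval x (τ.P0 j)) := by
  obtain ⟨ψ, hψ, hc⟩ := h.exists_conv hq hn hM hL hpM
  have hjd : ∀ D v Z, St τ p D v Z → (fun x => ψ x - psi v x) =O[𝓝 0] (fun x : Fin n → ℝ => ‖x‖ ^ (D+1)) →
      ∀ i j, (fun x => jac ψ x i j - (JJ v).map (eval x) i j) =O[𝓝 0] (fun x : Fin n → ℝ => ‖x‖ ^ D) := by
    intro D v Z hs hO i j
    have h1 := fderiv_isBigO (hψ.sub (psi_an v 0)) hO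
    have h2 : (fun x => fderiv ℝ (ψ - psi v) x (Pi.single j 1) i) =O[𝓝 0] (fun x : Fin n → ℝ => ‖x‖ ^ D) := by
      refine IsBigO.trans (IsBigO.of_bound 1 (Eventually.of_forall fun x => ?_)) h1
      rw [one_mul]
      refine (norm_le_pi_norm _ i).trans ?_
      have := (fderiv ℝ (ψ - psi v) x).le_opNorm (Pi.single j 1)
      simpa [Pi.norm_single] using this
    refine h2.congr' ?_ (EventuallyEq.refl _ _)
    filter_upwards [hψ.eventually_analyticAt] with x hx
    rw [← jac_psi, fderiv_sub hx.differentiableAt (psi_an v x).differentiableAt]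
    simp [jac]
  have h00 : ψ 0 = 0 ∧ jac ψ 0 = 1 := by
    obtain ⟨v, Z, hs, hO⟩ := hc 1 le_rfl
    constructor
    · have := hO.eq_zero_imp.self_of_nhds (by simp)
      rw [sub_eq_zero, psi_zero hs.v2] at this
      exact this
    · ext i j
      have := (hjd 1 v Z hs hO i j).eq_zero_imp.self_of_nhds (by simp)
      rw [sub_eq_zero, JJ_zero_eval hs.v2] at this
      exact this
  refine ⟨ψ, hψ, h00.1, h00.2, ?_⟩
  have hT : AnalyticAt ℝ (fun x => T (ψ x)) 0 := by
    have : AnalyticAt ℝ T (ψ 0) := by rw [h00.1]; exact h.an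
    exact this.comp hψ
  have hψ0 : Tendsto ψ (𝓝 0) (𝓝 0) := by
    have := hψ.continuousAt.tendsto
    rwa [h00.1] at this
  have hmain : ∀ j, ∀ᶠ x in 𝓝 0, T (ψ x) j - act (jac ψ x) (fun j => eval x (τ.P0 j)) j = 0 := by
    intro j
    apply analytic_flat
    · refine (analyticAt_pi_iff.1 hT j).sub ?_
      unfold act
      refine Finset.analyticAt_fun_sum _ fun i _ => ?_
      exact AnalyticAt.mul (Finset.analyticAt_fun_prod _ fun a _ => jac_an hψ _ _) (eval_analytic _ _)
    · intro k
      suffices H : ∀ D, 1 ≤ D → (fun x => T (ψ x) j - act (jac ψ x) (fun j => eval x (τ.P0 j)) j) =O[𝓝 0] (fun x : Fin n → ℝ => ‖x‖ ^ D) by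
        exact (H (k+1) (by omega)).trans (isBigO_pow_mono (Nat.le_succ k))
      intro D hD
      obtain ⟨v, Z, hs, hO⟩ := hc D hD
      have hψv0 : Tendsto (psi v) (𝓝 0) (𝓝 0) := by
        have := (psi_an v 0).continuousAt.tendsto
        rwa [psi_zero hs.v2] at this
      have e1 : (fun x => T (ψ x) j - T (psi v x) j) =O[𝓝 0] (fun x : Fin n → ℝ => ‖x‖ ^ (D+1)) := by
        have := (analyticAt_pi_iff.1 h.an j).hasStrictFDerivAt.isBigO_sub
        exact (this.comp_tendsto (hψ0.prodMk_nhds hψv0)).trans hO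
      have e2 : (fun x => T (psi v x) j - eval (psi v x) (psum p D j)) =O[𝓝 0] (fun x : Fin n → ℝ => ‖x‖ ^ (D+1)) :=
        ((h.tay D j).comp_tendsto hψv0).trans ((psi_isBigO hs.v2).norm_left.pow (D+1))
      have e3 := eval_isBigO (hs.eq j)
      have e4 : (fun x => act (jac ψ x) (fun j => eval x (τ.P0 j)) j - act ((JJ v).map (eval x)) (fun j => eval x (τ.P0 j)) j)
          =O[𝓝 0] (fun x : Fin n → ℝ => ‖x‖ ^ D) := by
        have e5 : (fun x => ∑ i : Fin q → Fin n, (∏ a, jac ψ x (j a) (i a) - ∏ a, (JJ v).map (eval x) (j a) (i a)) * eval x (τ.P0 i))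
          =O[𝓝 0] (fun x : Fin n → ℝ => ‖x‖ ^ D) := by
          refine IsBigO.fun_sum (E' := ℝ) fun i _ => ?_
          have e6 := prod_sub_isBigO (univ : Finset (Fin q)) (f := fun a x => jac ψ x (j a) (i a)) (g := fun a x => (JJ v).map (eval x) (j a) (i a))
            (fun a => (jac_an hψ _ _).continuousAt.tendsto.isBigO_one ℝ)
            (fun a => (eval_analytic (JJ v (j a) (i a)) 0).continuousAt.tendsto.isBigO_one ℝ)
            (fun a => hjd D v Z hs hO _ _)
          have e7 : (fun x => eval x (τ.P0 i)) =O[𝓝 0] (fun _ => (1:ℝ)) := (eval_analytic (τ.P0 i) 0).continuousAt.tendsto.isBigO_one ℝ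
          simpa only [mul_one] using e6.mul e7
        refine e5.congr_left fun x => ?_
        simp only [act, ← Finset.sum_sub_distrib, sub_mul]
      have e8 := (((e1.add e2).add e3).trans (isBigO_pow_mono (Nat.le_succ D))).sub e4
      refine e8.congr_left fun x => ?_
      have e9 : eval x (bind₁ (ps v) (psum p D j)) = eval (psi v x) (psum p D j) := eval₂Hom_bind₁ _ _ _ _
      simp only [GG, map_sub, eval_act, e9]
      ring
  filter_upwards [eventually_all.2 hmain] with x hx
  funext j
  exact sub_eq_zero.1 (hx j)

end limit

end NambuLin


namespace NambuLin

open MvPolynomial Finset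
open scoped Nat Topology ContDiff

section final
open Asymptotics Filter
variable {n q : ℕ}

/-- the standard model data -/
noncomputable def stdTop (n q k : ℕ) (hn : q < n) : Top n (q+1) where
  e := Fin.castLE hn
  inj := Fin.castLE_injective hn
  s := fun j => eps k j
  sq := fun i => by unfold eps; split_ifs <;> norm_num

lemma toT_modelPi (k : ℕ) (hn : q < n) (x : Fin n → ℝ) (j : Fin q → Fin n) :
    toT (modelPi n q k x) j = eval x ((stdTop n q k hn).P0 j) := by
  have hcard : ∀ m : Fin (q+1), ((topIdx n q).erase (Fin.castLE hn m)).card = q := by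
    intro m
    have h1 : topIdx n q = Finset.univ.map (Fin.castLEEmb hn) := by
      ext i
      simp only [topIdx, Finset.mem_filter, Finset.mem_univ, true_and, Finset.mem_map]
      constructor
      · intro h; exact ⟨⟨i, h⟩, rfl⟩
      · rintro ⟨a, rfl⟩; exact a.2
    rw [Finset.card_erase_of_mem]
    · rw [h1]; simp
    · simp only [topIdx, Finset.mem_filter, Finset.mem_univ, true_and]; exact m.2
  have hord : ∀ m : Fin (q+1), (Fin.castLE hn ∘ m.succAbove : Fin q → Fin n) =
      ((topIdx n q).erase (Fin.castLE hn m)).orderEmbOfFin (hcard m) := by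
    intro m
    apply Finset.orderEmbOfFin_unique
    · intro a
      simp only [Function.comp, Finset.mem_erase, topIdx, Finset.mem_filter, Finset.mem_univ, true_and]
      refine ⟨fun h => Fin.succAbove_ne m a (Fin.castLE_injective hn h), (m.succAbove a).2⟩
    · exact (Fin.strictMono_castLE hn).comp (Fin.strictMono_succAbove m)
  have hR : eval x ((stdTop n q k hn).P0 j) = ∑ m : Fin (q+1), ((-1) ^ (m : ℕ) * (eps k m * x (Fin.castLE hn m))) *
      dt (eI (R := ℝ) (Fin.castLE hn ∘ m.succAbove)) j := by
    simp only [Top.P0, Finset.sum_apply, Pi.smul_apply, smul_eq_mul, map_sum, map_mul, dt_C, eval_C, Top.A, eval_X,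
      map_pow, map_neg, map_one]
    rfl
  rw [hR]
  unfold toT
  simp only [Finset.sum_apply, Pi.smul_apply, smul_eq_mul, modelPi, Finset.sum_mul, ite_mul, zero_mul]
  rw [Finset.sum_comm]
  symm
  apply Finset.sum_of_injOn (Fin.castLE hn)
  · exact (Fin.castLE_injective hn).injOn
  · intro _ _; simp
  · intro i _ hi
    apply Finset.sum_eq_zero
    intro I _
    rw [if_neg]
    rintro ⟨h, _⟩
    exact hi ⟨⟨i, h⟩, by simp, rfl⟩
  · intro m _
    rw [Finset.sum_eq_single (⟨(topIdx n q).erase (Fin.castLE hn m), hcard m⟩ : Idx n q)]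
    · rw [if_pos ⟨m.2, rfl⟩]
      simp only [hord m, Fin.val_castLE, eps]
      ring
    · intro I _ hI
      rw [if_neg]
      rintro ⟨_, h⟩
      exact hI (Subtype.ext h)
    · simp

lemma toT_stdVec (hn : q ≤ n) : toT (stdVec n q) = dt (eI (R := ℝ) (Fin.castLE hn)) := by
  have h1 : Finset.univ.filter (fun i : Fin n => (i : ℕ) < q) = Finset.univ.map (Fin.castLEEmb hn) := by
    ext i
    simp only [Finset.mem_filter, Finset.mem_univ, true_and, Finset.mem_map]
    constructor
    · intro h; exact ⟨⟨i, h⟩, rfl⟩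
    · rintro ⟨a, rfl⟩; exact a.2
  have hc : (Finset.univ.filter (fun i : Fin n => (i : ℕ) < q)).card = q := by rw [h1]; simp
  have hord : (Fin.castLE hn : Fin q → Fin n) = (Finset.univ.filter (fun i : Fin n => (i : ℕ) < q)).orderEmbOfFin hc := by
    apply Finset.orderEmbOfFin_unique
    · intro a; simp
    · exact Fin.strictMono_castLE hn
  rw [toT_smul_single (stdVec n q) ⟨_, hc⟩]
  · rw [hord]; simp [stdVec]
  · intro J hJ
    unfold stdVec
    rw [if_neg]
    intro h; exact hJ (Subtype.ext h)

lemma toT_zero : toT (0 : MultiVec n q) = 0 := by simp [toT]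

lemma toT_inj {v w : MultiVec n q} (h : toT v = toT w) : v = w := by
  funext J
  rw [← toT_sorted v J, ← toT_sorted w J, h]

lemma toT_an {P : (Fin n → ℝ) → MultiVec n q} {x : Fin n → ℝ} (h : AnalyticAt ℝ P x) : AnalyticAt ℝ (fun y => toT (P y)) x := by
  rw [analyticAt_pi_iff]
  intro j
  simp only [toT, Finset.sum_apply, Pi.smul_apply, smul_eq_mul]
  apply Finset.analyticAt_fun_sum
  intro I _
  exact (analyticAt_pi_iff.1 h I).mul analyticAt_const

lemma jac_id (x : Fin n → ℝ) : jac (fun y => y) x = 1 := by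
  ext i j
  have : fderiv ℝ (fun y : Fin n → ℝ => y) x = ContinuousLinearMap.id ℝ _ := fderiv_fun_id
  simp only [jac, Matrix.of_apply, this, ContinuousLinearMap.id_apply, Matrix.one_apply, Pi.single_apply]

lemma jac_congr {Φ Ψ : (Fin n → ℝ) → (Fin n → ℝ)} {x : Fin n → ℝ} (h : Φ =ᶠ[𝓝 x] Ψ) : jac Φ x = jac Ψ x := by
  unfold jac; rw [h.fderiv_eq]

lemma jac_left_inv {Φ Ψ : (Fin n → ℝ) → (Fin n → ℝ)} {x : Fin n → ℝ} (hΨ : DifferentiableAt ℝ Ψ (Φ x))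
    (hΦ : DifferentiableAt ℝ Φ x) (h : ∀ᶠ y in 𝓝 x, Ψ (Φ y) = y) : jac Ψ (Φ x) * jac Φ x = 1 := by
  rw [← jac_comp hΨ hΦ, ← jac_id x]
  exact jac_congr h

lemma nam_of (hn : q ≤ n) {P : (Fin n → ℝ) → MultiVec n q} {U : Set (Fin n → ℝ)} (hN : IsNambu n q P U)
    {x : Fin n → ℝ} (hx : x ∈ U) (h0 : toT (P x) ≠ 0) : NamAt (Fin.castLE hn) (fun y => toT (P y)) x := by
  have hP : P x ≠ 0 := fun h => h0 (by rw [h, toT_zero])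
  obtain ⟨W, hxW, -, Φ, ⟨hW, hW', hΦ, Ψ, hΨ, h1, -⟩, h3⟩ := hN.2 x hx hP
  refine ⟨Φ, (hΦ.contDiffAt (hW.mem_nhds hxW)).of_le (WithTop.coe_le_coe.2 le_top), ?_⟩
  filter_upwards [hW.mem_nhds hxW] with y hy
  constructor
  · have hd1 : DifferentiableAt ℝ Φ y := (hΦ.contDiffAt (hW.mem_nhds hy)).differentiableAt (by simp)
    have hd2 : DifferentiableAt ℝ Ψ (Φ y) :=
      (hΨ.contDiffAt (hW'.mem_nhds (Set.mem_image_of_mem _ hy))).differentiableAt (by simp)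
    have := jac_left_inv hd2 hd1 (by filter_upwards [hW.mem_nhds hy] with z hz using h1 z hz)
    exact IsUnit.of_mul_eq_one_right _ this
  · rw [← toT_extPow, h3 y hy, toT_stdVec hn]

lemma lin_aux (n q k : ℕ) (hq : 2 ≤ q) (hn : q < n)
    (U : Set (Fin n → ℝ)) (hU : IsOpen U) (h0U : (0 : Fin n → ℝ) ∈ U)
    (P : (Fin n → ℝ) → MultiVec n q) (hN : IsNambu n q P U)
    (hPanalytic : AnalyticOnNhd ℝ P U)
    (hP0 : P 0 = 0) (hlin : ∀ v : Fin n → ℝ, fderiv ℝ P 0 v = modelPi n q k v) :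
    ∃ W : Set (Fin n → ℝ), W ⊆ U ∧ (0 : Fin n → ℝ) ∈ W ∧
      ∃ Φ : (Fin n → ℝ) → (Fin n → ℝ), IsAnalyticDiffeoOn Φ W ∧ Φ 0 = 0 ∧
        ∀ x ∈ W, extPow n q (jac Φ x) (P x) = modelPi n q k (Φ x) := by
  have hPa := hPanalytic 0 h0U
  obtain ⟨p, M, L, hdat, hM, hL, hb, htay⟩ := exists_dat (τ := stdTop n q k hn) hPa hP0
    (fun x j => by rw [hlin, toT_modelPi k hn])
  have hsrc : Src (stdTop n q k hn) (Fin.castLE hn.le) (fun y => toT (P y)) p :=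
    { ht := Fin.castLE_injective _
      alt := fun x => toT_alt _
      an := toT_an hPa
      nam := by
        filter_upwards [hU.mem_nhds h0U] with x hx h0
        exact nam_of hn.le hN hx h0
      dat := hdat
      tay := htay }
  obtain ⟨ψ, hψ, hψ0, hj, hconj⟩ := hsrc.exists_conj hq (by omega) hM hL hb
  have hfd : fderiv ℝ ψ 0 = (ContinuousLinearEquiv.refl ℝ (Fin n → ℝ) : (Fin n → ℝ) →L[ℝ] (Fin n → ℝ)) := by
    ext v i
    have := jac_mulVec hψ.differentiableAt v i
    rw [fderiv_apply (𝕜 := ℝ) (hΦ := hψ.differentiableAt), hj, Matrix.one_mulVec] at this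
    exact this.symm
  have hst : HasStrictFDerivAt ψ (ContinuousLinearEquiv.refl ℝ (Fin n → ℝ) : (Fin n → ℝ) →L[ℝ] (Fin n → ℝ)) 0 := by
    rw [← hfd]; exact hψ.hasStrictFDerivAt
  set F := hst.toOpenPartialHomeomorph ψ with hF
  have hFc : ∀ x, F x = ψ x := fun x => rfl
  have h0s : (0 : Fin n → ℝ) ∈ F.source := hst.mem_toOpenPartialHomeomorph_source
  have hF0 : F 0 = 0 := hψ0
  have hs0 : F.symm 0 = 0 := by
    conv_lhs => rw [← hF0]
    exact F.left_inv h0s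
  have h0t : (0 : Fin n → ℝ) ∈ F.target := by
    have := F.map_source h0s
    rwa [hF0] at this
  have han : AnalyticAt ℝ F.symm 0 := by
    have := F.analyticAt_symm' h0s (i := ContinuousLinearEquiv.refl ℝ (Fin n → ℝ)) hψ hfd
    rwa [hF0] at this
  have hcont : Tendsto F.symm (𝓝 0) (𝓝 0) := by
    have := han.continuousAt.tendsto
    rwa [hs0] at this
  let S : Set (Fin n → ℝ) := {y | y ∈ U ∧ AnalyticAt ℝ F.symm y ∧ AnalyticAt ℝ ψ (F.symm y) ∧
    toT (P (ψ (F.symm y))) = act (jac ψ (F.symm y)) (fun j => eval (F.symm y) ((stdTop n q k hn).P0 j))}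
  have hS : S ∈ 𝓝 (0 : Fin n → ℝ) := by
    filter_upwards [hU.mem_nhds h0U, han.eventually_analyticAt, hcont.eventually hψ.eventually_analyticAt,
      hcont.eventually hconj] with y a b c d
    exact ⟨a, b, c, d⟩
  have hWt : interior S ∩ F.target ⊆ F.target := Set.inter_subset_right
  have hWS : ∀ y ∈ interior S ∩ F.target, y ∈ S := fun y hy => interior_subset hy.1
  have hWo : IsOpen (interior S ∩ F.target) := isOpen_interior.inter F.open_target
  refine ⟨interior S ∩ F.target, fun y hy => (hWS y hy).1, ⟨mem_interior_iff_mem_nhds.2 hS, h0t⟩, F.symm,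
    ⟨hWo, F.symm.isOpen_image_of_subset_source hWo hWt, fun y hy => (hWS y hy).2.1, ψ, ?_, ?_, ?_⟩, hs0, ?_⟩
  · rintro _ ⟨y, hy, rfl⟩
    exact (hWS y hy).2.2.1
  · intro y hy
    exact F.right_inv (hWt hy)
  · rintro _ ⟨y, hy, rfl⟩
    exact F.left_inv (F.map_target (hWt hy))
  · intro y hy
    have hyt := hWt hy
    obtain ⟨-, h1, h2, h3⟩ := hWS y hy
    have hr : ψ (F.symm y) = y := F.right_inv hyt
    have hmul : jac F.symm y * jac ψ (F.symm y) = 1 := by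
      have := jac_left_inv (Φ := ψ) (Ψ := F.symm) (x := F.symm y) (by rw [hr]; exact h1.differentiableAt) h2.differentiableAt
        (by filter_upwards [F.open_source.mem_nhds (F.map_target hyt)] with z hz using F.left_inv hz)
      rwa [hr] at this
    apply toT_inj
    rw [hr] at h3
    rw [toT_extPow, h3, ← act_mul, hmul, act_one]
    funext j
    exact (toT_modelPi k hn _ j).symm

end final

end NambuLin

namespace NambuLin

/-- Theorem 1.3 of the paper, real case: analytic linearization.
A real-analytic Nambu structure of order `q ≥ 2` vanishing at `0` whose linear part
at `0` is the nondegenerate Type 1 model `Π_{k,q}` is locally analytically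
linearizable at `0`. -/
theorem analytic_linearization (n q k : ℕ) (hq : 2 ≤ q) (hn : q < n) (hk : k ≤ q + 1)
    (U : Set (Fin n → ℝ)) (hU : IsOpen U) (h0U : (0 : Fin n → ℝ) ∈ U)
    (P : (Fin n → ℝ) → MultiVec n q) (hN : IsNambu n q P U)
    (hPanalytic : AnalyticOnNhd ℝ P U)
    (hP0 : P 0 = 0) (hlin : ∀ v : Fin n → ℝ, fderiv ℝ P 0 v = modelPi n q k v) :
    ∃ W : Set (Fin n → ℝ), W ⊆ U ∧ (0 : Fin n → ℝ) ∈ W ∧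
      ∃ φ : (Fin n → ℝ) → (Fin n → ℝ), IsAnalyticDiffeoOn φ W ∧ φ 0 = 0 ∧
        ∀ x ∈ W, extPow n q (jac φ x) (P x) = modelPi n q k (φ x) := by
  exact lin_aux n q k hq hn U hU h0U P hN hPanalytic hP0 hlin

end NambuLin
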